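/- Let q ≡ 7 (mod 8) and r ≡ s ≡ 3 (mod 8) be distinct primes with (q/r) = (q/s) = -1 and (s/r) = 1. Write ε_{2qrs} = a + b√(2qrs) and assume 2q(a-1) is not a perfect square. Let 2^m = h₂(2qrs). Then for every n ≥ 0, the 2-class group of the n-th layer K_n of the cyclotomic Z₂-extension of K = Q(√(2q), √(rs)) is isomorphic to Z/2Z × Z/2^{m-2}Z; in particular the Iwasawa invariants λ and μ of K vanish and Greenberg's conjecture holds for K. -/

import Mathlib

open NumberField

/-- The subfield of ℝ generated over ℚ by a set of real numbers. -/
noncomputable def Qadj (S : Set ℝ) : IntermediateField ℚ ℝ := IntermediateField.adjoin ℚ S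

/-- The n-th layer of the cyclotomic Z₂-extension of the subfield of ℝ generated by `S`:
it is obtained by adjoining 2cos(2π/2^(n+2)). -/
noncomputable def layer (S : Set ℝ) (n : ℕ) : IntermediateField ℚ ℝ :=
  IntermediateField.adjoin ℚ (S ∪ {2 * Real.cos (2 * Real.pi / 2 ^ (n + 2))})

set_option linter.unusedSectionVars false
set_option linter.style.haveILetI false
set_option linter.unusedSimpArgs false

section cls
variable {R : Type*} [CommRing R] [IsDedekindDomain R]

open Classical in
noncomputable def cls (I : Ideal R) : ClassGroup R :=
  if h : I ≠ ⊥ then ClassGroup.mk0 ⟨I, mem_nonZeroDivisors_iff_ne_zero.2 h⟩ else 1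

lemma cls_mk0 {I : Ideal R} (h : I ≠ ⊥) :
    cls I = ClassGroup.mk0 ⟨I, mem_nonZeroDivisors_iff_ne_zero.2 h⟩ := by
  simp [cls, h]

lemma cls_mul {I J : Ideal R} (hI : I ≠ ⊥) (hJ : J ≠ ⊥) : cls (I * J) = cls I * cls J := by
  have : I * J ≠ ⊥ := mul_ne_zero hI hJ
  rw [cls_mk0 hI, cls_mk0 hJ, cls_mk0 this, ← map_mul]; rfl

lemma cls_surj (c : ClassGroup R) : ∃ I : Ideal R, I ≠ ⊥ ∧ cls I = c := by
  obtain ⟨I, rfl⟩ := ClassGroup.mk0_surjective c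
  have h : (I : Ideal R) ≠ ⊥ := mem_nonZeroDivisors_iff_ne_zero.1 I.2
  exact ⟨I, h, cls_mk0 h⟩

lemma cls_eq_iff {I J : Ideal R} (hI : I ≠ ⊥) (hJ : J ≠ ⊥) :
    cls I = cls J ↔ ∃ x y : R, x ≠ 0 ∧ y ≠ 0 ∧ Ideal.span {x} * I = Ideal.span {y} * J := by
  rw [cls_mk0 hI, cls_mk0 hJ, ClassGroup.mk0_eq_mk0_iff]
  constructor
  · rintro ⟨x, y, hx, hy, h⟩; exact ⟨x, y, hx, hy, h⟩
  · rintro ⟨x, y, hx, hy, h⟩; exact ⟨x, y, hx, hy, h⟩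

lemma cls_span {x : R} (hx : x ≠ 0) : cls (Ideal.span {x}) = 1 := by
  rw [cls_mk0 (by simpa using hx), ClassGroup.mk0_eq_one_iff]
  exact ⟨⟨x, rfl⟩⟩

lemma cls_top : cls (⊤ : Ideal R) = 1 := by
  rw [← Ideal.span_singleton_one]; exact cls_span one_ne_zero

lemma cls_eq_one_iff {I : Ideal R} (hI : I ≠ ⊥) :
    cls I = 1 ↔ ∃ x : R, x ≠ 0 ∧ I = Ideal.span {x} := by
  constructor
  · intro h
    rw [cls_mk0 hI, ClassGroup.mk0_eq_one_iff] at h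
    obtain ⟨⟨x, hx⟩⟩ := h
    refine ⟨x, ?_, hx⟩
    rintro rfl
    apply hI; rw [hx]; simp
  · rintro ⟨x, hx, rfl⟩; exact cls_span hx

lemma cls_pow {I : Ideal R} (hI : I ≠ ⊥) (n : ℕ) : cls (I ^ n) = cls I ^ n := by
  induction n with
  | zero => simp [cls_top]
  | succ k ih => rw [pow_succ, cls_mul (pow_ne_zero _ hI) hI, ih, pow_succ]

lemma cls_inv_rep {I : Ideal R} (hI : I ≠ ⊥) :
    ∃ J : Ideal R, J ≠ ⊥ ∧ ∃ z : R, z ≠ 0 ∧ I * J = Ideal.span {z} := by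
  obtain ⟨J, hJ, h⟩ := cls_surj (cls I)⁻¹
  refine ⟨J, hJ, ?_⟩
  apply (cls_eq_one_iff (mul_ne_zero hI hJ)).1
  rw [cls_mul hI hJ, h, mul_inv_cancel]

/-- lift a multiplicative map on ideals to class groups -/
lemma exists_lift {S : Type*} [CommRing S] [IsDedekindDomain S] (f : Ideal R →* Ideal S)
    (hf : ∀ I, I ≠ ⊥ → f I ≠ ⊥) (hp : ∀ x : R, x ≠ 0 → ∃ y : S, f (Ideal.span {x}) = Ideal.span {y}) :
    ∃ F : ClassGroup R →* ClassGroup S, ∀ I, I ≠ ⊥ → F (cls I) = cls (f I) := by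
  have hp' : ∀ x : R, x ≠ 0 → cls (f (Ideal.span {x})) = 1 := by
    intro x hx
    obtain ⟨y, hy⟩ := hp x hx
    have := hf _ (show Ideal.span {x} ≠ ⊥ by simpa using hx)
    rw [hy] at this ⊢
    exact cls_span (by simpa using this)
  choose rep hrep hrep' using (cls_surj (R := R))
  have key : ∀ I J : Ideal R, I ≠ ⊥ → J ≠ ⊥ → cls I = cls J → cls (f I) = cls (f J) := by
    intro I J hI hJ h
    obtain ⟨x, y, hx, hy, h⟩ := (cls_eq_iff hI hJ).1 h
    have h2 := congrArg (fun I => cls (f I)) h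
    simp only [map_mul] at h2
    have hx' : Ideal.span {x} ≠ ⊥ := by simpa using hx
    have hy' : Ideal.span {y} ≠ ⊥ := by simpa using hy
    rwa [cls_mul (hf _ hx') (hf _ hI), cls_mul (hf _ hy') (hf _ hJ), hp' x hx, hp' y hy,
      one_mul, one_mul] at h2
  have key2 : ∀ I, I ≠ ⊥ → cls (f (rep (cls I))) = cls (f I) := fun I hI =>
    key _ _ (hrep _) hI (hrep' _)
  refine ⟨⟨⟨fun c => cls (f (rep c)), ?_⟩, ?_⟩, fun I hI => key2 I hI⟩
  · rw [← cls_top, key2 ⊤ (by simp), ← Ideal.one_eq_top, map_one, Ideal.one_eq_top, cls_top]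
  · intro c d
    obtain ⟨I, hI, rfl⟩ := cls_surj c
    obtain ⟨J, hJ, rfl⟩ := cls_surj d
    simp only
    rw [← cls_mul hI hJ, key2 _ (mul_ne_zero hI hJ), map_mul, cls_mul (hf _ hI) (hf _ hJ),
      key2 _ hI, key2 _ hJ]

/-- two multiplicative maps of ideals agreeing on principal ideals agree -/
lemma ideal_maps_agree {S : Type*} [CommRing S] [IsDedekindDomain S] [Finite (ClassGroup R)]
    (f f' : Ideal R →* Ideal S)
    (hp : ∀ x : R, x ≠ 0 → f (Ideal.span {x}) = f' (Ideal.span {x})) (I : Ideal R) (hI : I ≠ ⊥) :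
    f I = f' I := by
  have h1 : cls (I ^ Nat.card (ClassGroup R)) = 1 := by rw [cls_pow hI, pow_card_eq_one']
  obtain ⟨x, hx, h⟩ := (cls_eq_one_iff (pow_ne_zero _ hI)).1 h1
  have h2 := hp x hx
  rw [← h, map_pow, map_pow] at h2
  have hpos : Nat.card (ClassGroup R) ≠ 0 := Nat.card_pos.ne'
  exact (pow_left_inj hpos).1 h2
end cls

section maps
variable (K L : Type*) [Field K] [NumberField K] [Field L] [NumberField L] [Algebra K L]

/-- extension of ideals -/
noncomputable def iExt : Ideal (𝓞 K) →* Ideal (𝓞 L) :=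
  (Ideal.mapHom (algebraMap (𝓞 K) (𝓞 L))).toMonoidHom

lemma iExt_apply (I : Ideal (𝓞 K)) : iExt K L I = I.map (algebraMap (𝓞 K) (𝓞 L)) := rfl

lemma algMap_inj : Function.Injective (algebraMap (𝓞 K) (𝓞 L)) :=
  FaithfulSMul.algebraMap_injective _ _

lemma iExt_ne {I : Ideal (𝓞 K)} (h : I ≠ ⊥) : iExt K L I ≠ ⊥ := by
  rw [iExt_apply, Ne, Ideal.map_eq_bot_iff_of_injective (algMap_inj K L)]; exact h

lemma iExt_span (x : 𝓞 K) : iExt K L (Ideal.span {x}) = Ideal.span {algebraMap (𝓞 K) (𝓞 L) x} := by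
  rw [iExt_apply, Ideal.map_span]; simp

noncomputable def iNm : Ideal (𝓞 L) →* Ideal (𝓞 K) :=
  (Ideal.relNorm (𝓞 K) (S := 𝓞 L)).toMonoidHom

lemma iNm_apply (I : Ideal (𝓞 L)) : iNm K L I = Ideal.relNorm (𝓞 K) I := rfl

lemma iNm_ne {I : Ideal (𝓞 L)} (h : I ≠ ⊥) : iNm K L I ≠ ⊥ := by
  rw [iNm_apply, Ne, Ideal.relNorm_eq_bot_iff]; exact h

lemma iNm_span (x : 𝓞 L) : iNm K L (Ideal.span {x}) = Ideal.span {Algebra.intNorm (𝓞 K) (𝓞 L) x} := by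
  rw [iNm_apply, Ideal.relNorm_singleton]

lemma iNm_iExt (I : Ideal (𝓞 K)) : iNm K L (iExt K L I) = I ^ (Module.finrank K L) := by
  rw [iNm_apply, iExt_apply, Ideal.relNorm_algebraMap]
  congr 1
  exact (IsFractionRing.finrank_eq (𝓞 K) K (𝓞 L) L).symm

lemma absNorm_iNm (I : Ideal (𝓞 L)) : Ideal.absNorm (iNm K L I) = Ideal.absNorm I := by
  rw [iNm_apply, Ideal.absNorm_relNorm]

noncomputable def clNorm : ClassGroup (𝓞 L) →* ClassGroup (𝓞 K) :=
  Classical.choose (exists_lift (iNm K L) (fun _ h => iNm_ne K L h) (fun x _ => ⟨_, iNm_span K L x⟩))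

lemma clNorm_cls {I : Ideal (𝓞 L)} (hI : I ≠ ⊥) : clNorm K L (cls I) = cls (iNm K L I) :=
  Classical.choose_spec
    (exists_lift (iNm K L) (fun _ h => iNm_ne K L h) (fun x _ => ⟨_, iNm_span K L x⟩)) I hI

noncomputable def clExt : ClassGroup (𝓞 K) →* ClassGroup (𝓞 L) :=
  Classical.choose (exists_lift (iExt K L) (fun _ h => iExt_ne K L h) (fun x _ => ⟨_, iExt_span K L x⟩))

lemma clExt_cls {I : Ideal (𝓞 K)} (hI : I ≠ ⊥) : clExt K L (cls I) = cls (iExt K L I) :=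
  Classical.choose_spec
    (exists_lift (iExt K L) (fun _ h => iExt_ne K L h) (fun x _ => ⟨_, iExt_span K L x⟩)) I hI

lemma clNorm_clExt (c : ClassGroup (𝓞 K)) : clNorm K L (clExt K L c) = c ^ (Module.finrank K L) := by
  obtain ⟨I, hI, rfl⟩ := cls_surj c
  rw [clExt_cls K L hI, clNorm_cls K L (iExt_ne K L hI), iNm_iExt, cls_pow hI]

variable {K L}

/-- Action on integers. -/
noncomputable abbrev oAct (g : L ≃+* L) : 𝓞 L ≃+* 𝓞 L := RingOfIntegers.mapRingEquiv g

noncomputable def iAct (g : L ≃+* L) : Ideal (𝓞 L) →* Ideal (𝓞 L) :=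
  (Ideal.mapHom (oAct g : 𝓞 L →+* 𝓞 L)).toMonoidHom

lemma iAct_apply (g : L ≃+* L) (I : Ideal (𝓞 L)) : iAct g I = I.map (oAct g : 𝓞 L →+* 𝓞 L) := rfl

lemma iAct_ne (g : L ≃+* L) {I : Ideal (𝓞 L)} (h : I ≠ ⊥) : iAct g I ≠ ⊥ := by
  rw [iAct_apply, Ne, Ideal.map_eq_bot_iff_of_injective (f := (oAct g : 𝓞 L →+* 𝓞 L)) (oAct g).injective]; exact h

lemma iAct_span (g : L ≃+* L) (x : 𝓞 L) : iAct g (Ideal.span {x}) = Ideal.span {oAct g x} := by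
  rw [iAct_apply, Ideal.map_span]; simp

lemma mem_iAct (g : L ≃+* L) (I : Ideal (𝓞 L)) (x : 𝓞 L) : x ∈ iAct g I ↔ (oAct g).symm x ∈ I := by
  rw [iAct_apply]
  constructor
  · intro h
    rw [Ideal.mem_map_iff_of_surjective (oAct g : 𝓞 L →+* 𝓞 L) (oAct g).surjective] at h
    obtain ⟨y, hy, rfl⟩ := h
    simpa using hy
  · intro h
    have := Ideal.mem_map_of_mem (oAct g : 𝓞 L →+* 𝓞 L) h
    simpa using this

noncomputable def clAct (g : L ≃+* L) : ClassGroup (𝓞 L) →* ClassGroup (𝓞 L) :=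
  Classical.choose (exists_lift (iAct g) (fun _ h => iAct_ne g h) (fun x _ => ⟨_, iAct_span g x⟩))

lemma clAct_cls (g : L ≃+* L) {I : Ideal (𝓞 L)} (hI : I ≠ ⊥) : clAct g (cls I) = cls (iAct g I) :=
  Classical.choose_spec
    (exists_lift (iAct g) (fun _ h => iAct_ne g h) (fun x _ => ⟨_, iAct_span g x⟩)) I hI

lemma iAct_iAct (g h : L ≃+* L) (I : Ideal (𝓞 L)) : iAct g (iAct h I) = iAct (h.trans g) I := by
  ext x
  rw [mem_iAct, mem_iAct, mem_iAct]; rfl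

lemma clAct_clAct (g h : L ≃+* L) (c : ClassGroup (𝓞 L)) :
    clAct g (clAct h c) = clAct (h.trans g) c := by
  obtain ⟨I, hI, rfl⟩ := cls_surj c
  rw [clAct_cls h hI, clAct_cls g (iAct_ne h hI), clAct_cls _ hI, iAct_iAct]

lemma clAct_refl (c : ClassGroup (𝓞 L)) : clAct (RingEquiv.refl L) c = c := by
  obtain ⟨I, hI, rfl⟩ := cls_surj c
  rw [clAct_cls _ hI]; congr 1
  ext x; rw [mem_iAct]; rfl

/-- relative norm of integers in terms of the field norm. -/
lemma intNorm_coe (x : 𝓞 L) : ((Algebra.intNorm (𝓞 K) (𝓞 L) x : 𝓞 K) : K) = Algebra.norm K (x : L) :=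
  Algebra.algebraMap_intNorm (A := 𝓞 K) (K := K) (L := L) (B := 𝓞 L) x

lemma coe_algMap (x : 𝓞 K) : ((algebraMap (𝓞 K) (𝓞 L) x : 𝓞 L) : L) = algebraMap K L (x : K) := rfl

/-- norm commutes with automorphisms preserving `K`. -/
lemma norm_act (g : L ≃+* L) (g' : K ≃+* K) (h : ∀ x : K, g (algebraMap K L x) = algebraMap K L (g' x))
    (x : L) : Algebra.norm K (g x) = g' (Algebra.norm K x) := by
  exact (Algebra.norm_eq_of_equiv_equiv g' g (by ext x; simp [h]) x) ▸ by simp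

/-- `L/K` is quadratic with conjugation `g` and `L = K(β)`, `g β = -β`. -/
structure IsQuad (K L : Type*) [Field K] [Field L] [Algebra K L] (g : L ≃+* L) (β : L) : Prop where
  fix : ∀ x : K, g (algebraMap K L x) = algebraMap K L x
  neg : g β = -β
  ne : β ≠ 0
  rep : ∀ x : L, ∃ a b : K, x = algebraMap K L a + algebraMap K L b * β

namespace IsQuad
variable {g : L ≃+* L} {β : L} (H : IsQuad K L g β)
include H

lemma invol (x : L) : g (g x) = x := by
  obtain ⟨a, b, rfl⟩ := H.rep x
  simp [H.fix, H.neg]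

lemma fixed {x : L} (hx : g x = x) : ∃ a : K, x = algebraMap K L a := by
  obtain ⟨a, b, rfl⟩ := H.rep x
  refine ⟨a, ?_⟩
  simp only [map_add, map_mul, H.fix, H.neg] at hx
  have h2 : (2 : L) ≠ 0 := two_ne_zero
  have : 2 * (algebraMap K L b * β) = 0 := by linear_combination -hx
  have := (mul_eq_zero.1 this).resolve_left h2
  rw [this, add_zero]

lemma ne_one : g β ≠ β := by
  rw [H.neg]; intro h
  have : 2 * β = 0 := by linear_combination -h
  exact H.ne ((mul_eq_zero.1 this).resolve_left two_ne_zero)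

lemma finrank : Module.finrank K L = 2 := by
  have hli : LinearIndependent K ![(1 : L), β] := by
    rw [LinearIndependent.pair_iff]
    intro s t h
    simp only [Algebra.smul_def, mul_one] at h
    have h' := congrArg g h
    simp only [map_add, map_mul, H.fix, H.neg, map_zero] at h'
    have h1 : (2 : L) * algebraMap K L s = 0 := by linear_combination h + h'
    have h2 : (2 : L) * (algebraMap K L t * β) = 0 := by linear_combination h - h'
    have h3 := (mul_eq_zero.1 h1).resolve_left two_ne_zero
    have h4 := (mul_eq_zero.1 ((mul_eq_zero.1 h2).resolve_left two_ne_zero)).resolve_right H.ne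
    exact ⟨by simpa using h3, by simpa using h4⟩
  have hsp : ⊤ ≤ Submodule.span K (Set.range ![(1 : L), β]) := by
    intro x _
    obtain ⟨a, b, rfl⟩ := H.rep x
    simp only [Matrix.range_cons, Matrix.range_empty, Set.union_empty]
    rw [show ({(1 : L)} ∪ {β} : Set L) = {1, β} from rfl, Submodule.mem_span_pair]
    exact ⟨a, b, by simp [Algebra.smul_def]⟩
  have := Module.finrank_eq_card_basis (Module.Basis.mk hli hsp)
  simpa using this

/-- conjugation as algebra automorphism -/
noncomputable def alg (H : IsQuad K L g β) : L ≃ₐ[K] L := AlgEquiv.ofRingEquiv (f := g) H.fix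

lemma norm_eq (x : L) : algebraMap K L (Algebra.norm K x) = x * g x := by
  classical
  have : Algebra.IsQuadraticExtension K L := ⟨H.finrank⟩
  have : IsGalois K L := inferInstance
  rw [Algebra.norm_eq_prod_automorphisms]
  have hc : Fintype.card (L ≃ₐ[K] L) = 2 := by
    rw [← Nat.card_eq_fintype_card, IsGalois.card_aut_eq_finrank, H.finrank]
  have hne : (1 : L ≃ₐ[K] L) ≠ H.alg := by
    intro h
    have := congrArg (fun σ : L ≃ₐ[K] L => σ β) h
    exact H.ne_one this.symm
  have hu : (Finset.univ : Finset (L ≃ₐ[K] L)) = {1, H.alg} := by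
    symm; apply Finset.eq_univ_of_card
    rw [Finset.card_pair hne, hc]
  rw [hu, Finset.prod_pair hne]; rfl

lemma iExt_iNm {I : Ideal (𝓞 L)} (hI : I ≠ ⊥) : iExt K L (iNm K L I) = I * iAct g I := by
  refine ideal_maps_agree ((iExt K L).comp (iNm K L)) ((MonoidHom.id _) * iAct g) ?_ I hI
  intro x hx
  simp only [MonoidHom.comp_apply, MonoidHom.mul_apply, MonoidHom.id_apply, iNm_span, iExt_span,
    iAct_span, Ideal.span_singleton_mul_span_singleton]
  congr 2
  apply RingOfIntegers.ext
  rw [coe_algMap, intNorm_coe, H.norm_eq]; simp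

lemma clExt_clNorm (c : ClassGroup (𝓞 L)) : clExt K L (clNorm K L c) = c * clAct g c := by
  obtain ⟨I, hI, rfl⟩ := cls_surj c
  rw [clNorm_cls K L hI, clExt_cls K L (iNm_ne K L hI), H.iExt_iNm hI, cls_mul hI (iAct_ne g hI),
    clAct_cls g hI]
end IsQuad

lemma iNm_iAct (g : L ≃+* L) (g' : K ≃+* K) (h : ∀ x : K, g (algebraMap K L x) = algebraMap K L (g' x))
    {I : Ideal (𝓞 L)} (hI : I ≠ ⊥) : iNm K L (iAct g I) = iAct g' (iNm K L I) := by
  refine ideal_maps_agree ((iNm K L).comp (iAct g)) ((iAct g').comp (iNm K L)) ?_ I hI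
  intro x hx
  simp only [MonoidHom.comp_apply, iNm_span, iAct_span]
  congr 2
  apply RingOfIntegers.ext
  erw [intNorm_coe]
  simp only [RingOfIntegers.mapRingEquiv_apply]
  erw [intNorm_coe]
  exact norm_act g g' h _

lemma clNorm_clAct (g : L ≃+* L) (g' : K ≃+* K)
    (h : ∀ x : K, g (algebraMap K L x) = algebraMap K L (g' x)) (c : ClassGroup (𝓞 L)) :
    clNorm K L (clAct g c) = clAct g' (clNorm K L c) := by
  obtain ⟨I, hI, rfl⟩ := cls_surj c
  rw [clAct_cls g hI, clNorm_cls K L (iAct_ne g hI), clNorm_cls K L hI, clAct_cls g' (iNm_ne K L hI),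
    iNm_iAct g g' h hI]

lemma clNorm_tower {F : Type*} [Field F] [NumberField F] [Algebra F K] [Algebra F L]
    [IsScalarTower F K L] (c : ClassGroup (𝓞 L)) : clNorm F K (clNorm K L c) = clNorm F L c := by
  obtain ⟨I, hI, rfl⟩ := cls_surj c
  rw [clNorm_cls K L hI, clNorm_cls F K (iNm_ne K L hI), clNorm_cls F L hI]
  congr 1
  simp only [iNm_apply]
  exact Ideal.relNorm_relNorm (R := 𝓞 F) (T := 𝓞 K) (S := 𝓞 L) I

end maps

section inert
variable {K L : Type*} [Field K] [NumberField K] [Field L] [NumberField L] [Algebra K L]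
  {g : L ≃+* L} {β : L}

/-- inertial primes -/
def Inertial (g : L ≃+* L) (P : Ideal (𝓞 L)) : Prop := ∀ x : 𝓞 L, x - oAct g x ∈ P

namespace IsQuad
variable (H : IsQuad K L g β)
include H

lemma oinvol (x : 𝓞 L) : oAct g (oAct g x) = x := by
  apply RingOfIntegers.ext; simp [H.invol]

lemma osymm (x : 𝓞 L) : (oAct g).symm x = oAct g x := by
  rw [RingEquiv.symm_apply_eq, H.oinvol]

lemma mem_iAct' (I : Ideal (𝓞 L)) (x : 𝓞 L) : x ∈ iAct g I ↔ oAct g x ∈ I := by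
  rw [mem_iAct, H.osymm]

lemma iAct_invol (I : Ideal (𝓞 L)) : iAct g (iAct g I) = I := by
  ext x; rw [H.mem_iAct', H.mem_iAct', H.oinvol]

lemma iAct_of_inertial {P : Ideal (𝓞 L)} (hP : Inertial g P) : iAct g P = P := by
  ext x; rw [H.mem_iAct']
  have := hP x
  exact ⟨fun h => by simpa using P.add_mem this h, fun h => by simpa using P.sub_mem h this⟩

lemma iAct_prime {P : Ideal (𝓞 L)} (hP : P.IsPrime) : (iAct g P).IsPrime := by
  have : iAct g P = Ideal.comap (oAct g : 𝓞 L →+* 𝓞 L) P := by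
    ext x; rw [H.mem_iAct']; rfl
  rw [this]; exact Ideal.comap_isPrime _ _

lemma iAct_iExt (J : Ideal (𝓞 K)) : iAct g (iExt K L J) = iExt K L J := by
  rw [iAct_apply, iExt_apply, Ideal.map_map]
  congr 1
  ext x
  simp [coe_algMap, H.fix]

lemma prime_cases {P : Ideal (𝓞 L)} (hP : P.IsPrime) (hP0 : P ≠ ⊥) (hg : iAct g P = P)
    (hin : ¬ Inertial g P) : ∃ p : Ideal (𝓞 K), p ≠ ⊥ ∧ P = iExt K L p := by
  have hPm : P.IsMaximal := hP.isMaximal hP0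
  set p : Ideal (𝓞 K) := P.under (𝓞 K) with hp
  have hpP : p.IsPrime := inferInstance
  have hp0 : p ≠ ⊥ := Ideal.under_ne_bot (𝓞 K) hP0
  have hpm : p.IsMaximal := hpP.isMaximal hp0
  obtain ⟨s, hs⟩ := Ideal.exists_relNorm_eq_pow_of_isPrime P p
  have h1 : iExt K L p ^ s = P * P := by
    have := H.iExt_iNm hP0
    rw [hg, iNm_apply, hs, map_pow] at this; exact this
  have hdvd : P ∣ iExt K L p := by
    rw [Ideal.dvd_iff_le, iExt_apply, Ideal.map_le_iff_le_comap]
  obtain ⟨J, hJ⟩ := hdvd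
  have h2 : p ^ 2 = p ^ s * iNm K L J := by
    have := congrArg (iNm K L) hJ
    rw [iNm_iExt, H.finrank, map_mul, iNm_apply _ _ P, hs] at this; exact this
  have hs2 : s ≤ 2 := by
    refine (pow_dvd_pow_iff (a := p) hp0 ?_).1 ⟨_, h2⟩
    rw [Ideal.isUnit_iff]; exact hpP.ne_top
  have hs0 : s ≠ 0 := by
    rintro rfl
    rw [pow_zero, Ideal.one_eq_top] at h1
    have : (⊤ : Ideal (𝓞 L)) ≤ P := h1 ▸ Ideal.mul_le_right
    exact hP.ne_top (top_le_iff.1 this)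
  have hs1 : s ≠ 1 := by
    rintro rfl
    apply hin
    have hn : Ideal.absNorm p = Ideal.absNorm P := by
      rw [← absNorm_iNm K L P, iNm_apply, hs, pow_one]
    let f : 𝓞 K ⧸ p →+* 𝓞 L ⧸ P := Ideal.quotientMap P (algebraMap (𝓞 K) (𝓞 L)) (le_of_eq hp)
    have hinj : Function.Injective f := Ideal.quotientMap_injective' (le_of_eq hp.symm)
    have : Finite (𝓞 L ⧸ P) := Ideal.finiteQuotientOfFreeOfNeBot P hP0
    have : Finite (𝓞 K ⧸ p) := Ideal.finiteQuotientOfFreeOfNeBot p hp0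
    have hbij : Function.Bijective f := by
      rw [Nat.bijective_iff_injective_and_card]
      exact ⟨hinj, hn⟩
    intro x
    obtain ⟨y, hy⟩ := hbij.2 (Ideal.Quotient.mk P x)
    obtain ⟨y, rfl⟩ := Ideal.Quotient.mk_surjective y
    have hxy : x - algebraMap (𝓞 K) (𝓞 L) y ∈ P := by
      rw [← Ideal.Quotient.eq]; rw [← hy]; simp [f]
    have hgx : oAct g (x - algebraMap (𝓞 K) (𝓞 L) y) ∈ P := by
      rw [← H.mem_iAct', hg]; exact hxy
    have hgy : oAct g (algebraMap (𝓞 K) (𝓞 L) y) = algebraMap (𝓞 K) (𝓞 L) y := by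
      apply RingOfIntegers.ext; simp [coe_algMap, H.fix]
    have := P.sub_mem hxy hgx
    rw [map_sub, hgy] at this
    simpa using this
  have : s = 2 := by omega
  subst this
  refine ⟨p, hp0, ?_⟩
  rw [← pow_two] at h1
  exact ((pow_left_inj (two_ne_zero)).1 h1).symm

open UniqueFactorizationMonoid in
lemma exists_factor {I : Ideal (𝓞 L)} (hI0 : I ≠ ⊥) (hI1 : I ≠ ⊤) (hg : iAct g I = I)
    (hev : ∀ Q : Ideal (𝓞 L), Q.IsPrime → Inertial g Q → Even ((normalizedFactors I).count Q)) :
    ∃ b : Ideal (𝓞 K), b ≠ ⊥ ∧ iExt K L b ∣ I ∧ iExt K L b ≠ ⊤ ∧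
      ∀ Q : Ideal (𝓞 L), Q.IsPrime → Inertial g Q → Even ((normalizedFactors (iExt K L b)).count Q) := by
  obtain ⟨P, hPm, hPI⟩ := Ideal.exists_le_maximal I hI1
  have hP := hPm.isPrime
  have hP0 : P ≠ ⊥ := by rintro rfl; exact hI0 (le_bot_iff.1 hPI)
  have hPp : Prime P := Ideal.prime_of_isPrime hP0 hP
  have hgP0 := iAct_ne g hP0
  have hgPp : Prime (iAct g P) := Ideal.prime_of_isPrime hgP0 (H.iAct_prime hP)
  have hdvd : P ∣ I := Ideal.dvd_iff_le.2 hPI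
  have hev2 : ∀ Q : Ideal (𝓞 L), Q.IsPrime → Inertial g Q →
      Even ((normalizedFactors (P * iAct g P)).count Q) := by
    intro Q hQ hin
    rw [normalizedFactors_mul hP0 hgP0, Multiset.count_add, normalizedFactors_irreducible hPp.irreducible,
      normalizedFactors_irreducible hgPp.irreducible, normalize_eq, normalize_eq,
      Multiset.count_singleton, Multiset.count_singleton]
    have : Q = P ↔ Q = iAct g P := by
      constructor
      · rintro rfl; exact (H.iAct_of_inertial hin).symm
      · intro h
        rw [← H.iAct_invol P, ← h, H.iAct_of_inertial hin]
    by_cases h : Q = P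
    · rw [if_pos h, if_pos (this.1 h)]; exact ⟨1, rfl⟩
    · rw [if_neg h, if_neg (fun h' => h (this.2 h'))]; exact ⟨0, rfl⟩
  have hnt : P * iAct g P ≠ ⊤ := fun h => hP.ne_top (top_le_iff.1 (h ▸ Ideal.mul_le_left))
  by_cases hgP : iAct g P = P
  · by_cases hin : Inertial g P
    · refine ⟨iNm K L P, iNm_ne K L hP0, ?_, ?_, ?_⟩
      · rw [H.iExt_iNm hP0, hgP]
        have h1 := hev P hP hin
        have h2 : 1 ≤ (normalizedFactors I).count P := by
          rw [Multiset.one_le_count_iff_mem, mem_normalizedFactors_iff' hI0]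
          exact ⟨hPp.irreducible, normalize_eq _, hdvd⟩
        have h3 : 2 ≤ (normalizedFactors I).count P := by
          rcases h1 with ⟨k, hk⟩; omega
        rw [← pow_two]
        rw [dvd_iff_normalizedFactors_le_normalizedFactors (pow_ne_zero 2 hP0) hI0,
          normalizedFactors_pow, normalizedFactors_irreducible hPp.irreducible, normalize_eq,
          Multiset.nsmul_singleton, ← Multiset.le_count_iff_replicate_le]
        exact h3
      · rw [H.iExt_iNm hP0]; exact hnt
      · rw [H.iExt_iNm hP0]; exact hev2
    · obtain ⟨p, hp0, hp⟩ := H.prime_cases hP hP0 hgP hin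
      refine ⟨p, hp0, hp ▸ hdvd, hp ▸ hP.ne_top, ?_⟩
      intro Q hQ hinQ
      rw [← hp, normalizedFactors_irreducible hPp.irreducible, normalize_eq, Multiset.count_singleton,
        if_neg (fun h : Q = P => hin (h ▸ hinQ))]
      exact ⟨0, rfl⟩
  · refine ⟨iNm K L P, iNm_ne K L hP0, ?_, ?_, ?_⟩
    · rw [H.iExt_iNm hP0]
      obtain ⟨J, hJ⟩ := hdvd
      have h1 : iAct g P ∣ P * J := by
        refine ⟨iAct g J, ?_⟩
        rw [← map_mul, ← hJ, hg]
      rcases hgPp.2.2 _ _ h1 with h | h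
      · exact absurd (associated_iff_eq.1 (hgPp.associated_of_dvd hPp h)) hgP
      · rw [hJ]; exact mul_dvd_mul_left _ h
    · rw [H.iExt_iNm hP0]; exact hnt
    · rw [H.iExt_iNm hP0]; exact hev2

open UniqueFactorizationMonoid in
lemma even_inv : ∀ (n : ℕ) (I : Ideal (𝓞 L)), Multiset.card (normalizedFactors I) ≤ n → I ≠ ⊥ →
    iAct g I = I →
    (∀ Q : Ideal (𝓞 L), Q.IsPrime → Inertial g Q → Even ((normalizedFactors I).count Q)) →
    ∃ b : Ideal (𝓞 K), b ≠ ⊥ ∧ I = iExt K L b := by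
  intro n
  induction n with
  | zero =>
    intro I hc hI0 _ _
    refine ⟨⊤, by simp, ?_⟩
    rw [Nat.le_zero, Multiset.card_eq_zero, normalizedFactors_eq_zero_iff hI0, Ideal.isUnit_iff] at hc
    rw [hc, iExt_apply, Ideal.map_top]
  | succ n ih =>
    intro I hc hI0 hg hev
    by_cases hI1 : I = ⊤
    · refine ⟨⊤, by simp, ?_⟩
      rw [hI1, iExt_apply, Ideal.map_top]
    obtain ⟨b, hb0, ⟨J, hJ⟩, hb1, hbev⟩ := H.exists_factor hI0 hI1 hg hev
    have hE0 := iExt_ne K L hb0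
    have hJ0 : J ≠ ⊥ := by rintro rfl; apply hI0; rw [hJ]; simp
    have hnf : normalizedFactors I = normalizedFactors (iExt K L b) + normalizedFactors J := by
      rw [hJ, normalizedFactors_mul hE0 hJ0]
    have hpos : 1 ≤ Multiset.card (normalizedFactors (iExt K L b)) := by
      rw [Nat.one_le_iff_ne_zero, Ne, Multiset.card_eq_zero, normalizedFactors_eq_zero_iff hE0,
        Ideal.isUnit_iff]; exact hb1
    obtain ⟨c, hc0, hcJ⟩ := ih J (by rw [hnf, Multiset.card_add] at hc; omega) hJ0 (by
        have := hg
        rw [hJ, map_mul, H.iAct_iExt] at this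
        exact mul_left_cancel₀ hE0 this) (by
        intro Q hQ hin
        have h1 := hev Q hQ hin
        rw [hnf, Multiset.count_add] at h1
        exact (Nat.even_add.1 h1).1 (hbev Q hQ hin))
    exact ⟨b * c, mul_ne_zero hb0 hc0, by rw [hJ, hcJ, map_mul]⟩

lemma inertial_unique {P P' : Ideal (𝓞 L)} (hP : P.IsPrime) (hP' : P'.IsPrime) (hP0 : P ≠ ⊥)
    (_hP0' : P' ≠ ⊥) (h : Inertial g P) (hu : P.under (𝓞 K) = P'.under (𝓞 K)) : P = P' := by
  have h1 : iNm K L P ≤ P'.under (𝓞 K) := by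
    rw [← hu]; exact Ideal.relNorm_le_comap (𝓞 K) P
  have h2 : P * P ≤ P' := by
    have := H.iExt_iNm hP0
    rw [H.iAct_of_inertial h] at this
    rw [← this, iExt_apply, Ideal.map_le_iff_le_comap]; exact h1
  have h3 : P ≤ P' := by
    rcases hP'.mul_le.1 h2 with h | h <;> exact h
  exact (hP.isMaximal hP0).eq_of_le hP'.ne_top h3

end IsQuad
end inert

section herb
open Module

lemma index_two {S : Type*} [AddCommGroup S] [Module.Finite ℤ S] (z : S) (hz : z ≠ 0) (h2z : 2 • z = 0)
    (htor : ∀ x : S, ∀ n : ℤ, n ≠ 0 → n • x = 0 → x = 0 ∨ x = z) (hsq : ∀ x : S, 2 • x ≠ z) :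
    (nsmulAddMonoidHom (α := S) 2).range.index = 2 ^ (finrank ℤ S + 1) := by
  let T : Submodule ℤ S := Submodule.torsion ℤ S
  have hT : ∀ x, x ∈ T ↔ x = 0 ∨ x = z := by
    intro x
    constructor
    · intro h
      obtain ⟨n, hn⟩ := (Submodule.mem_torsion_iff x).1 h
      exact htor x n (nonZeroDivisors.ne_zero n.2) hn
    · rintro (rfl | rfl)
      · exact T.zero_mem
      · refine (Submodule.mem_torsion_iff _).2 ⟨⟨2, by simp⟩, ?_⟩
        change (2 : ℤ) • x = 0
        rw [two_smul, ← two_nsmul]; exact h2z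
  let V := S ⧸ T
  have h1 : (nsmulAddMonoidHom (α := V) 2).range.index = 2 ^ finrank ℤ S := by
    have := AddSubgroup.index_range_nsmul (M := V) 2
    rw [this, finrank_quotient_eq_of_le_torsion le_rfl]
  let π : S →+ V := T.mkQ.toAddMonoidHom
  have hπ : Function.Surjective π := T.mkQ_surjective
  have hker : π.ker = T.toAddSubgroup := by
    ext x; rw [AddMonoidHom.mem_ker]; exact Submodule.Quotient.mk_eq_zero T
  have h2 : (nsmulAddMonoidHom (α := V) 2).range = (nsmulAddMonoidHom (α := S) 2).range.map π := by
    ext y; constructor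
    · rintro ⟨v, rfl⟩
      obtain ⟨x, rfl⟩ := hπ v
      exact ⟨2 • x, ⟨x, rfl⟩, by simp⟩
    · rintro ⟨_, ⟨x, rfl⟩, rfl⟩
      exact ⟨π x, by simp⟩
  set R := (nsmulAddMonoidHom (α := S) 2).range with hR
  have h3 : (R ⊔ T.toAddSubgroup).index = 2 ^ finrank ℤ S := by
    rw [← h1, h2, AddSubgroup.index_map, hker, AddMonoidHom.range_eq_top.2 hπ]; simp
  have h4 : R.relIndex (R ⊔ T.toAddSubgroup) = 2 := by
    rw [sup_comm, AddSubgroup.relIndex_sup_right]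
    have : R.addSubgroupOf T.toAddSubgroup = ⊥ := by
      rw [eq_bot_iff]
      rintro ⟨x, hx⟩ hxR
      rw [AddSubgroup.mem_addSubgroupOf] at hxR
      obtain ⟨y, hy⟩ := hxR
      rcases (hT x).1 hx with h | h
      · simp [h]
      · exact absurd (hy.trans h) (hsq y)
    rw [AddSubgroup.relIndex, this, AddSubgroup.index_bot]
    have e : (T.toAddSubgroup : Set S) = {0, z} := by ext x; simp [hT]
    have : Nat.card T.toAddSubgroup = Set.ncard ({0, z} : Set S) := by
      rw [← e]; rfl
    rw [this, Set.ncard_pair hz.symm]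
  have h5 := AddSubgroup.relIndex_mul_index (H := R) (K := R ⊔ T.toAddSubgroup) le_sup_left
  rw [← h5, h4, h3, pow_succ, mul_comm]

lemma finrank_rn {A B : Type*} [AddCommGroup A] [Module.Finite ℤ A] [AddCommGroup B] (f : A →ₗ[ℤ] B) :
    finrank ℤ (LinearMap.range f) + finrank ℤ (LinearMap.ker f) = finrank ℤ A := by
  rw [← f.quotKerEquivRange.finrank_eq, Submodule.finrank_quotient_add_finrank]

theorem herbrand {A : Type*} [AddCommGroup A] [Module.Finite ℤ A] (g : A →+ A) (hg : ∀ x, g (g x) = x)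
    (z : A) (hz : z ≠ 0) (h2z : 2 • z = 0)
    (htor : ∀ x : A, ∀ n : ℤ, n ≠ 0 → n • x = 0 → x = 0 ∨ x = z) (hsq : ∀ x : A, 2 • x ≠ z)
    (P M : AddSubgroup A) (hP : ∀ x, x ∈ P ↔ g x = x) (hM : ∀ x, x ∈ M ↔ x + g x = 0)
    (hr : finrank ℤ A + 1 = 2 * (finrank ℤ P + 1)) :
    (AddMonoidHom.id A - g).range.relIndex M = 2 * (AddMonoidHom.id A + g).range.relIndex P ∧
      (AddMonoidHom.id A + g).range.relIndex P ≠ 0 := by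
  set N := AddMonoidHom.id A + g with hN
  set D := AddMonoidHom.id A - g with hD
  have hNa : ∀ x, N x = x + g x := fun x => rfl
  have hDa : ∀ x, D x = x - g x := fun x => rfl
  have hgz : g z = z := by
    rcases htor (g z) 2 (by norm_num) (by
      have : g (2 • z) = 0 := by rw [h2z, map_zero]
      rw [map_nsmul] at this; exact_mod_cast this) with h | h
    · exfalso; apply hz; rw [← hg z, h, map_zero]
    · exact h
  have hzP : z ∈ P := (hP z).2 hgz
  have hzM : z ∈ M := (hM z).2 (by rw [hgz, ← two_nsmul, h2z])
  have hkN : N.ker = M := by ext x; rw [AddMonoidHom.mem_ker, hNa, hM]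
  have hkD : D.ker = P := by ext x; rw [AddMonoidHom.mem_ker, hDa, hP, sub_eq_zero, eq_comm]
  have hNP : N.range ≤ P := by rintro _ ⟨x, rfl⟩; rw [hP, hNa, map_add, hg, add_comm]
  have hDM : D.range ≤ M := by rintro _ ⟨x, rfl⟩; rw [hM, hDa, map_sub, hg]; abel
  have hfin : ∀ S : AddSubgroup A, Module.Finite ℤ S := fun S =>
    Module.Finite.of_injective (S.subtype.toIntLinearMap) Subtype.val_injective
  -- index of doubles in a subgroup containing z
  have hidx : ∀ S : AddSubgroup A, z ∈ S →
      (S.map (nsmulAddMonoidHom 2)).relIndex S = 2 ^ (finrank ℤ S + 1) := by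
    intro S hS
    have := hfin S
    have h := index_two (S := S) ⟨z, hS⟩ (fun h => hz (congrArg Subtype.val h))
      (Subtype.ext h2z) (fun x n hn h => by
        rcases htor x n hn (congrArg Subtype.val h) with h | h
        · exact Or.inl (Subtype.ext h)
        · exact Or.inr (Subtype.ext h)) (fun x h => hsq x (congrArg Subtype.val h))
    rw [← h, AddSubgroup.relIndex]
    congr 1
    ext x
    rw [AddSubgroup.mem_addSubgroupOf]
    constructor
    · rintro ⟨y, hy, h⟩; exact ⟨⟨y, hy⟩, Subtype.ext h⟩
    · rintro ⟨y, rfl⟩; exact ⟨y, y.2, rfl⟩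
  -- rank of M
  have hrM : finrank ℤ M = finrank ℤ P + 1 := by
    have := hfin P
    have h1 := finrank_rn N.toIntLinearMap
    have h2 : finrank ℤ (LinearMap.ker N.toIntLinearMap) = finrank ℤ M := by
      rw [← hkN]; rfl
    let δ : P →ₗ[ℤ] A := (N.comp P.subtype).toIntLinearMap
    have h3 := finrank_rn δ
    have h4 : finrank ℤ (LinearMap.ker δ) = 0 := by
      apply Module.IsTorsion.finrank_eq_zero
      rintro ⟨⟨x, hx⟩, hx'⟩
      refine ⟨⟨2, by simp⟩, ?_⟩
      have : x + g x = 0 := hx'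
      rw [(hP x).1 hx] at this
      apply Subtype.ext; apply Subtype.ext
      change (2 : ℤ) • x = 0
      rw [two_smul]; exact this
    have h5 : finrank ℤ (LinearMap.range δ) ≤ finrank ℤ (LinearMap.range N.toIntLinearMap) := by
      apply Submodule.finrank_mono
      rintro _ ⟨x, rfl⟩; exact ⟨x, rfl⟩
    have h6 : finrank ℤ (LinearMap.range N.toIntLinearMap) ≤ finrank ℤ P := by
      have : LinearMap.range N.toIntLinearMap ≤ AddSubgroup.toIntSubmodule P := by
        rintro _ ⟨x, rfl⟩; exact hNP ⟨x, rfl⟩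
      exact Submodule.finrank_mono this
    omega
  have e1 : P.map (nsmulAddMonoidHom 2) = P.map N := by
    ext x; constructor
    · rintro ⟨y, hy, rfl⟩; exact ⟨y, hy, by rw [hNa, (hP y).1 hy, ← two_nsmul]; rfl⟩
    · rintro ⟨y, hy, rfl⟩; exact ⟨y, hy, by rw [hNa, (hP y).1 hy, ← two_nsmul]; rfl⟩
  have e2 : M.map (nsmulAddMonoidHom 2) = M.map D := by
    have : ∀ y ∈ M, D y = 2 • y := fun y hy => by
      rw [hDa, eq_neg_of_add_eq_zero_right ((hM y).1 hy), two_nsmul]; abel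
    ext x; constructor
    · rintro ⟨y, hy, rfl⟩; exact ⟨y, hy, by rw [this y hy]; rfl⟩
    · rintro ⟨y, hy, rfl⟩; exact ⟨y, hy, by rw [this y hy]; rfl⟩
  have i1 := hidx P hzP
  have i2 := hidx M hzM
  rw [e1] at i1
  rw [e2, hrM] at i2
  have r1 : (P.map N).relIndex N.range = (P ⊔ M).index := by
    rw [AddMonoidHom.range_eq_map, AddSubgroup.relIndex_map_map, hkN, top_sup_eq,
      AddSubgroup.relIndex_top_right]
  have r2 : (M.map D).relIndex D.range = (P ⊔ M).index := by
    rw [AddMonoidHom.range_eq_map, AddSubgroup.relIndex_map_map, hkD, top_sup_eq,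
      AddSubgroup.relIndex_top_right, sup_comm]
  have m1 := AddSubgroup.relIndex_mul_relIndex (P.map N) N.range P
    (by rintro _ ⟨y, _, rfl⟩; exact ⟨y, rfl⟩) hNP
  have m2 := AddSubgroup.relIndex_mul_relIndex (M.map D) D.range M
    (by rintro _ ⟨y, _, rfl⟩; exact ⟨y, rfl⟩) hDM
  rw [r1, i1] at m1
  rw [r2, i2] at m2
  have hne : (P ⊔ M).index ≠ 0 := by
    intro h; rw [h, zero_mul] at m1; exact absurd m1.symm (by positivity)
  refine ⟨?_, ?_⟩
  · apply Nat.eq_of_mul_eq_mul_left (Nat.pos_of_ne_zero hne)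
    rw [m2, ← mul_assoc, mul_comm _ 2, mul_assoc, m1]; ring
  · intro h; rw [h, mul_zero] at m1; exact absurd m1.symm (by positivity)
end herb

section chev
variable {K L : Type*} [Field K] [NumberField K] [Field L] [NumberField L] [Algebra K L]
  {g : L ≃+* L} {β : L}

/-- classes fixed by g -/
noncomputable def fixCl (g : L ≃+* L) : Subgroup (ClassGroup (𝓞 L)) :=
  (clAct g).eqLocus (MonoidHom.id _)

lemma mem_fixCl (g : L ≃+* L) (c : ClassGroup (𝓞 L)) : c ∈ fixCl g ↔ clAct g c = c := Iff.rfl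

/-- classes of invariant ideals -/
noncomputable def invCl (g : L ≃+* L) : Subgroup (ClassGroup (𝓞 L)) where
  carrier := {c | ∃ I : Ideal (𝓞 L), I ≠ ⊥ ∧ iAct g I = I ∧ cls I = c}
  one_mem' := ⟨⊤, by simp, by rw [← Ideal.one_eq_top, map_one], cls_top⟩
  mul_mem' := by
    rintro _ _ ⟨I, hI, hgI, rfl⟩ ⟨J, hJ, hgJ, rfl⟩
    exact ⟨I * J, mul_ne_zero hI hJ, by rw [map_mul, hgI, hgJ], cls_mul hI hJ⟩
  inv_mem' := by
    rintro _ ⟨I, hI, hgI, rfl⟩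
    refine ⟨I ^ (Nat.card (ClassGroup (𝓞 L)) - 1), pow_ne_zero _ hI, by rw [map_pow, hgI], ?_⟩
    rw [cls_pow hI, eq_inv_iff_mul_eq_one, ← pow_succ, Nat.sub_add_cancel Nat.card_pos, pow_card_eq_one']

lemma invCl_le (g : L ≃+* L) : invCl g ≤ fixCl g := by
  rintro _ ⟨I, hI, hgI, rfl⟩
  rw [mem_fixCl, clAct_cls g hI, hgI]

/-- the action on units, additively -/
noncomputable def uAct (g : L ≃+* L) : Additive (𝓞 L)ˣ →+ Additive (𝓞 L)ˣ :=
  MonoidHom.toAdditive (Units.map (oAct g : 𝓞 L →* 𝓞 L))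

lemma uAct_coe (g : L ≃+* L) (u : Additive (𝓞 L)ˣ) :
    ((uAct g u).toMul : 𝓞 L) = oAct g (u.toMul : 𝓞 L) := rfl

noncomputable def uPlus (g : L ≃+* L) : AddSubgroup (Additive (𝓞 L)ˣ) :=
  (uAct g).eqLocus (AddMonoidHom.id _)

lemma mem_uPlus (g : L ≃+* L) (u : Additive (𝓞 L)ˣ) : u ∈ uPlus g ↔ uAct g u = u := Iff.rfl

noncomputable def uMinus (g : L ≃+* L) : AddSubgroup (Additive (𝓞 L)ˣ) :=
  (AddMonoidHom.id _ + uAct g).ker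

lemma mem_uMinus (g : L ≃+* L) (u : Additive (𝓞 L)ˣ) : u ∈ uMinus g ↔ u + uAct g u = 0 := Iff.rfl

/-- units that are norms of field elements -/
noncomputable def uNorm (g : L ≃+* L) : AddSubgroup (Additive (𝓞 L)ˣ) where
  carrier := {u | ∃ w : L, w * g w = ((u.toMul : 𝓞 L) : L)}
  zero_mem' := ⟨1, by simp⟩
  add_mem' := by
    rintro u v ⟨w, hw⟩ ⟨w', hw'⟩
    refine ⟨w * w', ?_⟩
    simp only [map_mul, toMul_add, Units.val_mul, ← hw, ← hw']; ring
  neg_mem' := by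
    rintro u ⟨w, hw⟩
    refine ⟨w⁻¹, ?_⟩
    have h : ((u.toMul : 𝓞 L) : L) * (((-u).toMul : 𝓞 L) : L) = 1 := by
      have : (u.toMul : 𝓞 L) * ((-u).toMul : 𝓞 L) = 1 := by simp
      rw [← map_mul, this, map_one]
    rw [map_inv₀, ← mul_inv, hw]
    exact inv_eq_of_mul_eq_one_right h

lemma unit_ext {u v : Additive (𝓞 L)ˣ} (h : ((u.toMul : 𝓞 L) : L) = ((v.toMul : 𝓞 L) : L)) : u = v := by
  apply Additive.toMul.injective
  apply Units.ext
  exact RingOfIntegers.ext h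

namespace IsQuad
variable (H : IsQuad K L g β)
include H

lemma hilbert90 (w : L) (hw : w * g w = 1) : ∃ y : 𝓞 L, y ≠ 0 ∧ (y : L) = w * g (y : L) := by
  have key : ∃ y : L, y ≠ 0 ∧ y = w * g y := by
    by_cases h : 1 + w = 0
    · refine ⟨β, H.ne, ?_⟩
      rw [H.neg]; linear_combination β * h
    · refine ⟨1 + w, h, ?_⟩
      rw [map_add, map_one]; linear_combination -hw
  obtain ⟨y, hy, h⟩ := key
  obtain ⟨n, hn, hi⟩ := IsAlgebraic.exists_integral_multiple (R := ℤ) ((IsFractionRing.isAlgebraic_iff ℤ ℚ L).2 (Algebra.IsAlgebraic.isAlgebraic y))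
  refine ⟨⟨n • y, hi⟩, ?_, ?_⟩
  · intro h0
    have : n • y = 0 := congrArg (fun z : 𝓞 L => (z : L)) h0
    rcases smul_eq_zero.1 this with h | h
    · exact hn h
    · exact hy h
  · change n • y = w * g (n • y)
    rw [map_zsmul, mul_smul_comm, ← h]

lemma mem_iExt_even {I I' : Ideal (𝓞 L)} (hI : I ≠ ⊥) (hI' : I' ≠ ⊥) (hg : iAct g I = I)
    (hg' : iAct g I' = I') (T : Finset (Ideal (𝓞 L)))
    (hT : ∀ P : Ideal (𝓞 L), P.IsPrime → P ≠ ⊥ → Inertial g P → P ∈ T)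
    (hpat : ∀ P ∈ T, (((UniqueFactorizationMonoid.normalizedFactors I).count P : ℕ) : ZMod 2) =
      (((UniqueFactorizationMonoid.normalizedFactors I').count P : ℕ) : ZMod 2)) :
    ∃ b : Ideal (𝓞 K), b ≠ ⊥ ∧ I * I' = iExt K L b := by
  refine H.even_inv _ (I * I') le_rfl (mul_ne_zero hI hI') (by rw [map_mul, hg, hg']) ?_
  intro Q hQ hin
  rw [UniqueFactorizationMonoid.normalizedFactors_mul hI hI', Multiset.count_add]
  by_cases hQ0 : Q = ⊥
  · subst hQ0
    rw [Multiset.count_eq_zero_of_notMem, Multiset.count_eq_zero_of_notMem]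
    · exact ⟨0, rfl⟩
    · exact fun h => UniqueFactorizationMonoid.zero_notMem_normalizedFactors _ h
    · exact fun h => UniqueFactorizationMonoid.zero_notMem_normalizedFactors _ h
  have h := hpat Q (hT Q hQ hQ0 hin)
  rw [← ZMod.natCast_eq_zero_iff_even]
  push_cast
  rw [h]
  exact CharTwo.add_self_eq_zero _

set_option maxHeartbeats 1000000 in
theorem part1 (T : Finset (Ideal (𝓞 L)))
    (hT : ∀ P : Ideal (𝓞 L), P.IsPrime → P ≠ ⊥ → Inertial g P → P ∈ T)
    (hfin : (AddMonoidHom.id _ - uAct g).range.relIndex (uMinus g) ≠ 0) :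
    Nat.card (invCl g) * (AddMonoidHom.id _ - uAct g).range.relIndex (uMinus g) ≤
      Nat.card (ClassGroup (𝓞 K)) * 2 ^ T.card := by
  classical
  set D := (AddMonoidHom.id (Additive (𝓞 L)ˣ) - uAct g) with hD
  let H1 := uMinus g ⧸ (D.range.addSubgroupOf (uMinus g))
  have hcard : Nat.card H1 = D.range.relIndex (uMinus g) := rfl
  have hI : ∀ c : invCl g, ∃ I : Ideal (𝓞 L), I ≠ ⊥ ∧ iAct g I = I ∧ cls I = c := fun c => c.2
  choose I hI0 hIg hIc using hI
  have hy : ∀ η : H1, ∃ y : 𝓞 L, y ≠ 0 ∧ y = ((η.out : uMinus g).1.toMul : 𝓞 L) * oAct g y := by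
    intro η
    set u := (η.out : uMinus g) with hu
    have h1 : ((u.1.toMul : 𝓞 L)) * oAct g (u.1.toMul : 𝓞 L) = 1 := by
      have := (mem_uMinus g u.1).1 u.2
      have h := congrArg (fun v : Additive (𝓞 L)ˣ => (v.toMul : 𝓞 L)) this
      exact h
    obtain ⟨y, hy0, hy⟩ := H.hilbert90 ((u.1.toMul : 𝓞 L) : L) (by
      have := congrArg (fun z : 𝓞 L => (z : L)) h1
      simpa using this)
    refine ⟨y, hy0, RingOfIntegers.ext ?_⟩
    simpa using hy
  choose y hy0 hy using hy
  let a : invCl g × H1 → Ideal (𝓞 L) := fun x => I x.1 * Ideal.span {y x.2}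
  have hs0 : ∀ {z : 𝓞 L}, z ≠ 0 → Ideal.span {z} ≠ ⊥ := fun h => by simpa using h
  have ha0 : ∀ x, a x ≠ ⊥ := fun x => mul_ne_zero (hI0 _) (hs0 (hy0 _))
  have hag : ∀ x, iAct g (a x) = a x := by
    intro x
    simp only [a, map_mul, hIg, iAct_span]
    congr 1
    rw [Ideal.span_singleton_eq_span_singleton]
    refine ⟨(x.2.out : uMinus g).1.toMul, ?_⟩
    conv_rhs => rw [hy x.2]
    rw [mul_comm]
  let pat : Ideal (𝓞 L) → (T → ZMod 2) := fun J P =>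
    (((UniqueFactorizationMonoid.normalizedFactors J).count P.1 : ℕ) : ZMod 2)
  have hd : ∀ ν : T → ZMod 2, ∃ d : Ideal (𝓞 L), ∀ x, pat (a x) = ν →
      d ≠ ⊥ ∧ iAct g d = d ∧ pat d = ν := by
    intro ν
    by_cases h : ∃ x, pat (a x) = ν
    · obtain ⟨x, hx⟩ := h
      exact ⟨a x, fun _ _ => ⟨ha0 x, hag x, hx⟩⟩
    · exact ⟨⊤, fun x hx => absurd ⟨x, hx⟩ h⟩
  choose d hd using hd
  have hJ : ∀ x, ∃ b : Ideal (𝓞 K), b ≠ ⊥ ∧ a x * d (pat (a x)) = iExt K L b := by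
    intro x
    obtain ⟨h1, h2, h3⟩ := hd _ x rfl
    refine H.mem_iExt_even (ha0 x) h1 (hag x) h2 T hT ?_
    intro P hP
    exact (congrFun h3 ⟨P, hP⟩).symm
  choose b hb0 hb using hJ
  let f : invCl g × H1 → ClassGroup (𝓞 K) × (T → ZMod 2) := fun x => (cls (b x), pat (a x))
  have hf : Function.Injective f := by
    rintro x x' h
    have hc : cls (b x) = cls (b x') := congrArg Prod.fst h
    have hp : pat (a x) = pat (a x') := congrArg Prod.snd h
    obtain ⟨e, e', he, he', hee⟩ := (cls_eq_iff (hb0 x) (hb0 x')).1 hc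
    have hbx := hb x
    rw [hp] at hbx
    have h1 : Ideal.span {algebraMap (𝓞 K) (𝓞 L) e} * iExt K L (b x) =
        Ideal.span {algebraMap (𝓞 K) (𝓞 L) e'} * iExt K L (b x') := by
      rw [← iExt_span, ← iExt_span, ← map_mul, ← map_mul, hee]
    rw [← hbx, ← hb x', ← mul_assoc (Ideal.span {algebraMap (𝓞 K) (𝓞 L) e}) (a x),
      ← mul_assoc (Ideal.span {algebraMap (𝓞 K) (𝓞 L) e'}) (a x')] at h1
    have h2 : Ideal.span {algebraMap (𝓞 K) (𝓞 L) e} * (I x.1 * Ideal.span {y x.2}) =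
        Ideal.span {algebraMap (𝓞 K) (𝓞 L) e'} * (I x'.1 * Ideal.span {y x'.2}) :=
      mul_right_cancel₀ (hd _ x' rfl).1 h1
    have he0 : algebraMap (𝓞 K) (𝓞 L) e ≠ 0 := fun h => he (algMap_inj K L (by rw [h, map_zero]))
    have he0' : algebraMap (𝓞 K) (𝓞 L) e' ≠ 0 := fun h => he' (algMap_inj K L (by rw [h, map_zero]))
    have hge : ∀ e : 𝓞 K, oAct g (algebraMap (𝓞 K) (𝓞 L) e) = algebraMap (𝓞 K) (𝓞 L) e := by
      intro e; apply RingOfIntegers.ext; simp [coe_algMap, H.fix]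
    have hge1 := hge e
    have hge1' := hge e'
    set E := algebraMap (𝓞 K) (𝓞 L) e
    set E' := algebraMap (𝓞 K) (𝓞 L) e'
    have h3 : x.1 = x'.1 := by
      apply Subtype.ext
      rw [← hIc, ← hIc, cls_eq_iff (hI0 _) (hI0 _)]
      refine ⟨E * y x.2, E' * y x'.2, mul_ne_zero he0 (hy0 _), mul_ne_zero he0' (hy0 _), ?_⟩
      rw [← Ideal.span_singleton_mul_span_singleton, ← Ideal.span_singleton_mul_span_singleton]
      rw [mul_assoc, mul_comm _ (I x.1), h2, mul_assoc, mul_comm _ (I x'.1)]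
    have h4 : Ideal.span {E * y x.2} = Ideal.span {E' * y x'.2} := by
      rw [← Ideal.span_singleton_mul_span_singleton, ← Ideal.span_singleton_mul_span_singleton]
      rw [h3, mul_left_comm, mul_left_comm (Ideal.span {E'})] at h2
      exact mul_left_cancel₀ (hI0 _) h2
    obtain ⟨u, hu⟩ := Ideal.span_singleton_eq_span_singleton.1 h4
    have h5 := congrArg (oAct g) hu
    rw [map_mul, map_mul, map_mul, hge1, hge1'] at h5
    set η := ((x.2.out : uMinus g).1) with hη
    set η' := ((x'.2.out : uMinus g).1) with hη'
    have k1 : y x.2 = (η.toMul : 𝓞 L) * oAct g (y x.2) := hy x.2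
    have k2 : y x'.2 = (η'.toMul : 𝓞 L) * oAct g (y x'.2) := hy x'.2
    have h6 : (η.toMul : 𝓞 L) * u = (η'.toMul : 𝓞 L) * oAct g (u : 𝓞 L) := by
      have hgy0 : oAct g (y x.2) ≠ 0 := by simpa using hy0 x.2
      apply mul_left_cancel₀ (mul_ne_zero he0 hgy0)
      rw [k1, k2] at hu
      have : oAct g (y x.2) * E * (η.toMul : 𝓞 L) * u = η'.toMul * (E' * oAct g (y x'.2)) := by
        linear_combination hu
      rw [← h5] at this
      linear_combination this
    have h7 : -η + η' = D (Additive.ofMul u) := by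
      rw [neg_add_eq_iff_eq_add]
      change η' = η + (Additive.ofMul u - uAct g (Additive.ofMul u))
      rw [← add_sub_assoc, eq_sub_iff_add_eq]
      apply Additive.toMul.injective
      apply Units.ext
      exact h6.symm
    have h8 : x.2 = x'.2 := by
      rw [← QuotientAddGroup.out_eq' x.2, ← QuotientAddGroup.out_eq' x'.2, QuotientAddGroup.eq,
        AddSubgroup.mem_addSubgroupOf]
      exact ⟨_, h7.symm⟩
    exact Prod.ext h3 h8
  have hfinH : Finite H1 := Nat.finite_of_card_ne_zero hfin
  have := Nat.card_le_card_of_injective f hf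
  rw [Nat.card_prod, Nat.card_prod, hcard] at this
  simpa using this

set_option maxHeartbeats 1000000 in
theorem part2 (hfin : (AddMonoidHom.id _ + uAct g).range.relIndex (uNorm g) ≠ 0) :
    Nat.card (fixCl g) ≤ (AddMonoidHom.id _ + uAct g).range.relIndex (uNorm g) * Nat.card (invCl g) := by
  classical
  set N := (AddMonoidHom.id (Additive (𝓞 L)ˣ) + uAct g) with hN
  let Q := uNorm g ⧸ (N.range.addSubgroupOf (uNorm g))
  have hcard : Nat.card Q = N.range.relIndex (uNorm g) := rfl
  have hs0 : ∀ {z : 𝓞 L}, z ≠ 0 → Ideal.span {z} ≠ ⊥ := fun h => by simpa using h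
  have hg0 : ∀ {z : 𝓞 L}, z ≠ 0 → oAct g z ≠ 0 := fun h => by simpa using h
  have hX : ∀ c : fixCl g, ∃ (I : Ideal (𝓞 L)) (x y : 𝓞 L) (u : uNorm g), I ≠ ⊥ ∧ cls I = c ∧ x ≠ 0 ∧
      y ≠ 0 ∧ Ideal.span {x} * I = Ideal.span {y} * iAct g I ∧
      x * oAct g x = y * oAct g y * (u.1.toMul : 𝓞 L) := by
    intro c
    obtain ⟨I, hI0, hIc⟩ := cls_surj c.1
    have h1 : cls I = cls (iAct g I) := by
      rw [← clAct_cls g hI0, hIc]; exact c.2.symm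
    obtain ⟨x, y, hx, hy, hxy⟩ := (cls_eq_iff hI0 (iAct_ne g hI0)).1 h1
    have h2 := congrArg (iAct g) hxy
    rw [map_mul, map_mul, iAct_span, iAct_span, H.iAct_invol] at h2
    have h3 : Ideal.span {y * oAct g y} = Ideal.span {x * oAct g x} := by
      rw [← Ideal.span_singleton_mul_span_singleton, ← Ideal.span_singleton_mul_span_singleton]
      apply mul_right_cancel₀ (mul_ne_zero hI0 (iAct_ne g hI0))
      calc _ = (Ideal.span {y} * iAct g I) * (Ideal.span {oAct g y} * I) := by ring
        _ = _ := by rw [← hxy, ← h2]; ring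
    obtain ⟨u, hu⟩ := Ideal.span_singleton_eq_span_singleton.1 h3
    have hxL : (x : L) ≠ 0 := by simpa using hx
    have hyL : (y : L) ≠ 0 := by simpa using hy
    have hgyL : g (y : L) ≠ 0 := by simpa using hyL
    refine ⟨I, x, y, ⟨Additive.ofMul u, (x : L) / y, ?_⟩, hI0, hIc, hx, hy, hxy, hu.symm⟩
    have h4 := congrArg (fun z : 𝓞 L => (z : L)) hu
    simp only [map_mul, RingOfIntegers.mapRingEquiv_apply] at h4
    change _ = ((u : 𝓞 L) : L)
    rw [map_div₀]
    field_simp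
    rw [← h4]
  choose I x y u hI0 hIc hx hy hxy hu using hX
  let G := fixCl g ⧸ (invCl g).subgroupOf (fixCl g)
  let f : G → Q := fun c => QuotientAddGroup.mk (u c.out)
  have hf : Function.Injective f := by
    intro c c' h
    have h1 := QuotientAddGroup.eq.1 h
    rw [AddSubgroup.mem_addSubgroupOf] at h1
    obtain ⟨v, hv⟩ := h1
    rw [← QuotientGroup.out_eq' c, ← QuotientGroup.out_eq' c', QuotientGroup.eq, Subgroup.mem_subgroupOf]
    set k := (c.out : fixCl g)
    set k' := (c'.out : fixCl g)
    obtain ⟨J, hJ0, z, hz, hJ⟩ := cls_inv_rep (hI0 k)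
    have hgJ := congrArg (iAct g) hJ
    rw [map_mul, iAct_span] at hgJ
    -- the ideal B
    set B := I k' * J with hB
    have hB0 : B ≠ ⊥ := mul_ne_zero (hI0 _) hJ0
    have hw : Ideal.span {x k' * y k * oAct g z} * B = Ideal.span {y k' * x k * z} * iAct g B := by
      simp only [← Ideal.span_singleton_mul_span_singleton]
      apply mul_right_cancel₀ (hI0 k)
      have e1 := hxy k
      have e2 := hxy k'
      calc _ = (Ideal.span {x k'} * I k') * Ideal.span {y k} * Ideal.span {oAct g z} * (I k * J) := by
              rw [hB]; ring
        _ = (Ideal.span {y k'} * iAct g (I k')) * Ideal.span {y k} *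
              (iAct g (I k) * iAct g J) * Ideal.span {z} := by rw [hJ, hgJ, e2]
        _ = Ideal.span {y k'} * iAct g (I k') * (Ideal.span {y k} * iAct g (I k)) *
              iAct g J * Ideal.span {z} := by ring
        _ = _ := by rw [← e1, hB, map_mul]; ring
    have hxL : ∀ c, (x c : L) ≠ 0 := fun c => by simpa using hx c
    have hyL : ∀ c, (y c : L) ≠ 0 := fun c => by simpa using hy c
    have hzL : (z : L) ≠ 0 := by simpa using hz
    have hvL : ((v.toMul : 𝓞 L) : L) ≠ 0 := by
      simp
    have huL : ∀ c, (((u c).1.toMul : 𝓞 L) : L) ≠ 0 := fun c => by simp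
    have hgL : ∀ {w : L}, w ≠ 0 → g w ≠ 0 := fun h => by simpa using h
    have huv : (((u k').1.toMul : 𝓞 L) : L) = ((u k).1.toMul : 𝓞 L) * (((v.toMul : 𝓞 L) : L) *
        g ((v.toMul : 𝓞 L) : L)) := by
      have h2 : (u k').1 = (u k).1 + (v + uAct g v) := by
        have : v + uAct g v = -(u k).1 + (u k').1 := hv
        rw [this]; abel
      rw [h2]; rfl
    have hun : ∀ c, (x c : L) * g (x c : L) = (y c : L) * g (y c : L) * (((u c).1.toMul : 𝓞 L) : L) := by
      intro c
      have := congrArg (fun z : 𝓞 L => (z : L)) (hu c)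
      simpa using this
    set w : L := (x k' * y k * g z) / (y k' * x k * z) with hwdef
    obtain ⟨t, ht0, ht⟩ := H.hilbert90 (w / (v.toMul : 𝓞 L)) (by
      rw [hwdef]
      simp only [map_div₀, map_mul, H.invol]
      have a1 := hgL (hxL k)
      have a2 := hgL (hyL k')
      have a3 := hgL hzL
      have a4 := hgL hvL
      have a5 := hxL k
      have a6 := hyL k'
      field_simp
      have b1 := hun k
      have b2 := hun k'
      rw [huv] at b2
      apply mul_left_cancel₀ (huL k)
      linear_combination ((y k : L) * g (y k) * (((u k).1.toMul : 𝓞 L) : L)) * b2 - ((y k' : L) * g (y k') * (((u k).1.toMul : 𝓞 L) : L) * (((v.toMul : 𝓞 L) : L) *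
        g ((v.toMul : 𝓞 L) : L))) * b1)
    have ht2 : t * (y k' * x k * z) * (v.toMul : 𝓞 L) = x k' * y k * oAct g z * oAct g t := by
      apply RingOfIntegers.ext
      simp only [map_mul, RingOfIntegers.mapRingEquiv_apply]
      have a5 := hxL k
      have a6 := hyL k'
      have ht' : (algebraMap (𝓞 L) L) t = w / (v.toMul : 𝓞 L) * g ((algebraMap (𝓞 L) L) t) := ht
      have hvL' := hvL
      have hzL' := hzL
      generalize g ((algebraMap (𝓞 L) L) t) = gt at *
      rw [ht', hwdef]
      field_simp
    refine ⟨Ideal.span {t} * B, mul_ne_zero (hs0 ht0) hB0, ?_, ?_⟩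
    · rw [map_mul, iAct_span]
      have hne : y k' * x k * z ≠ 0 := mul_ne_zero (mul_ne_zero (hy _) (hx _)) hz
      apply mul_left_cancel₀ (hs0 hne)
      calc _ = Ideal.span {oAct g t} * (Ideal.span {y k' * x k * z} * iAct g B) := by ring
        _ = Ideal.span {x k' * y k * oAct g z * oAct g t} * B := by
            rw [← hw, ← mul_assoc, Ideal.span_singleton_mul_span_singleton]; congr 3; ring
        _ = _ := by
            have e3 : Ideal.span {x k' * y k * oAct g z * oAct g t} =
                Ideal.span {y k' * x k * z} * Ideal.span {t} := by
              rw [← ht2, Ideal.span_singleton_mul_right_unit (Units.isUnit _),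
                Ideal.span_singleton_mul_span_singleton]
              congr 2; ring
            rw [e3, mul_assoc]
    · rw [cls_mul (hs0 ht0) hB0, cls_span ht0, one_mul, hB, cls_mul (hI0 _) hJ0, hIc]
      have : cls (I k) * cls J = 1 := by rw [← cls_mul (hI0 _) hJ0, hJ, cls_span hz]
      rw [hIc] at this
      rw [eq_inv_of_mul_eq_one_right this]
      simp [mul_comm]
  have hfinQ : Finite Q := Nat.finite_of_card_ne_zero hfin
  have h1 := Nat.card_le_card_of_injective f hf
  rw [hcard] at h1
  have h2 := Subgroup.card_eq_card_quotient_mul_card_subgroup ((invCl g).subgroupOf (fixCl g))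
  rw [h2, Nat.card_congr (Subgroup.subgroupOfEquivOfLe (invCl_le g)).toEquiv]
  exact Nat.mul_le_mul_right _ h1

end IsQuad
end chev

/-- 2-primary part of an abelian group -/
def tw (G : Type*) [CommGroup G] : Subgroup G where
  carrier := {x | ∃ k : ℕ, x ^ 2 ^ k = 1}
  one_mem' := ⟨0, by simp⟩
  mul_mem' := by
    rintro x y ⟨k, hk⟩ ⟨l, hl⟩
    refine ⟨k + l, ?_⟩
    rw [mul_pow, pow_add, pow_mul, hk, one_pow, mul_comm (2 ^ k), pow_mul, hl, one_pow, one_mul]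
  inv_mem' := by
    rintro x ⟨k, hk⟩
    exact ⟨k, by rw [inv_pow, hk, inv_one]⟩

/-- odd part of an abelian group -/
def od (G : Type*) [CommGroup G] : Subgroup G where
  carrier := {x | ∃ k : ℕ, Odd k ∧ x ^ k = 1}
  one_mem' := ⟨1, odd_one, by simp⟩
  mul_mem' := by
    rintro x y ⟨k, hk, hx⟩ ⟨l, hl, hy⟩
    refine ⟨k * l, hk.mul hl, ?_⟩
    rw [mul_pow, pow_mul, hx, one_pow, mul_comm k, pow_mul, hy, one_pow, one_mul]
  inv_mem' := by
    rintro x ⟨k, hk, hx⟩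
    exact ⟨k, hk, by rw [inv_pow, hx, inv_one]⟩

section grp
variable {G : Type*} [CommGroup G]

lemma mem_tw {x : G} : x ∈ tw G ↔ ∃ k : ℕ, x ^ 2 ^ k = 1 := Iff.rfl
lemma mem_od {x : G} : x ∈ od G ↔ ∃ k : ℕ, Odd k ∧ x ^ k = 1 := Iff.rfl

lemma coprime_eq_one {x : G} {a b : ℕ} (h : Nat.Coprime a b) (ha : x ^ a = 1) (hb : x ^ b = 1) : x = 1 := by
  rw [← orderOf_eq_one_iff]
  exact Nat.eq_one_of_dvd_coprimes h (orderOf_dvd_of_pow_eq_one ha) (orderOf_dvd_of_pow_eq_one hb)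

lemma tw_od {x : G} (h : x ∈ tw G) (h' : x ∈ od G) : x = 1 := by
  obtain ⟨k, hk⟩ := h
  obtain ⟨l, hl, hx⟩ := h'
  exact coprime_eq_one ((Nat.coprime_two_left.2 hl).pow_left k) hk hx

lemma card_le_tw_od [Finite G] : Nat.card G ≤ Nat.card (tw G) * Nat.card (od G) := by
  rw [← Nat.card_prod]
  refine Nat.card_le_card_of_surjective (fun p : tw G × od G => p.1.1 * p.2.1) ?_
  intro x
  obtain ⟨k, m, hm, h⟩ := Nat.exists_eq_two_pow_mul_odd (n := Nat.card G) Nat.card_pos.ne'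
  have hx : x ^ (2 ^ k * m) = 1 := by rw [← h, pow_card_eq_one']
  have hc : IsCoprime ((2 ^ k : ℕ) : ℤ) (m : ℤ) :=
    Nat.isCoprime_iff_coprime.2 ((Nat.coprime_two_left.2 hm).pow_left k)
  obtain ⟨a, b, hab⟩ := hc
  refine ⟨(⟨x ^ (b * m), k, ?_⟩, ⟨x ^ (a * (2 ^ k : ℕ)), m, hm, ?_⟩), ?_⟩
  · rw [← zpow_natCast, ← zpow_mul, show b * m * ((2 ^ k : ℕ) : ℤ) = ((2 ^ k * m : ℕ) : ℤ) * b by push_cast; ring,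
      zpow_mul, zpow_natCast, hx, one_zpow]
  · rw [← zpow_natCast, ← zpow_mul, show a * ((2 ^ k : ℕ) : ℤ) * m = ((2 ^ k * m : ℕ) : ℤ) * a by push_cast; ring,
      zpow_mul, zpow_natCast, hx, one_zpow]
  · simp only
    rw [← zpow_add, add_comm, hab, zpow_one]

lemma map_tw {G' : Type*} [CommGroup G'] (f : G →* G') {x : G} (h : x ∈ tw G) : f x ∈ tw G' := by
  obtain ⟨k, hk⟩ := h
  exact ⟨k, by rw [← map_pow, hk, map_one]⟩

lemma map_od {G' : Type*} [CommGroup G'] (f : G →* G') {x : G} (h : x ∈ od G) : f x ∈ od G' := by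
  obtain ⟨k, hk', hk⟩ := h
  exact ⟨k, hk', by rw [← map_pow, hk, map_one]⟩
end grp

/-- any two primes containing p agree -/
def UniqAbove (K : Type*) [Field K] [NumberField K] (p : ℕ) : Prop :=
  ∀ P P' : Ideal (𝓞 K), P.IsPrime → P'.IsPrime → (p : 𝓞 K) ∈ P → (p : 𝓞 K) ∈ P' → P = P'

section chev
variable {K L : Type*} [Field K] [NumberField K] [Field L] [NumberField L] [Algebra K L]
  {g : L ≃+* L} {β : L}

lemma rank_tr (K : Type*) [Field K] [NumberField K] [IsTotallyReal K] :
    Module.finrank ℤ (Additive (𝓞 K)ˣ) + 1 = Module.finrank ℚ K := by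
  classical
  rw [NumberField.Units.finrank_eq, NumberField.Units.rank]
  have h1 := NumberField.InfinitePlace.card_eq_nrRealPlaces_add_nrComplexPlaces K
  have h2 := NumberField.IsTotallyReal.nrComplexPlaces_eq_zero K
  have h3 := NumberField.IsTotallyReal.finrank K
  have := Module.finrank_pos (R := ℚ) (M := K)
  omega

namespace IsQuad
variable (H : IsQuad K L g β)
include H

lemma finrank_uPlus : Module.finrank ℤ (uPlus g) = Module.finrank ℤ (Additive (𝓞 K)ˣ) := by
  let f : Additive (𝓞 K)ˣ →+ Additive (𝓞 L)ˣ :=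
    MonoidHom.toAdditive (Units.map (algebraMap (𝓞 K) (𝓞 L) : 𝓞 K →* 𝓞 L))
  have hf : ∀ u, ((f u).toMul : 𝓞 L) = algebraMap (𝓞 K) (𝓞 L) (u.toMul : 𝓞 K) := fun _ => rfl
  have hinj : Function.Injective f := by
    intro u v h
    apply Additive.toMul.injective
    apply Units.ext
    apply algMap_inj K L
    rw [← hf, ← hf, h]
  have hr : f.range = uPlus g := by
    ext u
    rw [mem_uPlus]
    constructor
    · rintro ⟨v, rfl⟩
      apply unit_ext
      rw [uAct_coe, hf]
      simp [coe_algMap, H.fix]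
    · intro hu
      have key : ∀ u : Additive (𝓞 L)ˣ, uAct g u = u → ∃ a : 𝓞 K, algebraMap (𝓞 K) (𝓞 L) a = (u.toMul : 𝓞 L) := by
        intro u hu
        have h1 : g ((u.toMul : 𝓞 L) : L) = ((u.toMul : 𝓞 L) : L) := by
          have := congrArg (fun v : Additive (𝓞 L)ˣ => ((v.toMul : 𝓞 L) : L)) hu
          simpa [uAct_coe] using this
        obtain ⟨a, ha⟩ := H.fixed h1
        have hi : IsIntegral ℤ a := by
          have h2 : IsIntegral ℤ (algebraMap K L a) := by
            rw [← ha]; exact RingOfIntegers.isIntegral_coe _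
          exact (isIntegral_algebraMap_iff (algebraMap K L).injective).1 h2
        refine ⟨⟨a, hi⟩, RingOfIntegers.ext ?_⟩
        rw [ha]; rfl
      obtain ⟨a, ha⟩ := key u hu
      obtain ⟨b, hb⟩ := key (-u) (by rw [map_neg, hu])
      have hab : a * b = 1 := by
        apply algMap_inj K L
        rw [map_mul, ha, hb, map_one]; simp
      refine ⟨Additive.ofMul ⟨a, b, hab, by rw [mul_comm, hab]⟩, ?_⟩
      apply Additive.toMul.injective
      apply Units.ext
      exact ha
  have h1 := LinearMap.finrank_range_of_inj (f := f.toIntLinearMap) hinj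
  rw [← h1, ← hr]
  rfl

lemma finrank_Q : Module.finrank ℚ L = 2 * Module.finrank ℚ K := by
  rw [← Module.finrank_mul_finrank ℚ K L, H.finrank, mul_comm]

lemma herb [IsTotallyReal K] [IsTotallyReal L] (φ : L →+* ℝ) :
   (AddMonoidHom.id _ - uAct g).range.relIndex (uMinus g) = 2 * (AddMonoidHom.id _ + uAct g).range.relIndex (uPlus g)
     ∧ (AddMonoidHom.id _ + uAct g).range.relIndex (uPlus g) ≠ 0 := by
  let v : Additive (𝓞 L)ˣ → ℝ := fun u => φ ((u.toMul : 𝓞 L) : L)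
  have hv : ∀ u w, v u = v w → u = w := fun u w h => unit_ext (φ.injective h)
  have hadd : ∀ u w, v (u + w) = v u * v w := fun u w => by simp [v]
  have h0 : v 0 = 1 := by simp [v]
  have hz : v (Additive.ofMul (-1)) = -1 := by simp [v]
  have hn : ∀ (n : ℕ) u, v (n • u) = v u ^ n := by
    intro n u
    induction n with
    | zero => simp [h0]
    | succ k ih => rw [succ_nsmul, hadd, ih, pow_succ]
  refine herbrand (A := Additive (𝓞 L)ˣ) (uAct g) ?_ (Additive.ofMul (-1)) ?_ ?_ ?_ ?_ (uPlus g) (uMinus g)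
    (mem_uPlus g) (mem_uMinus g) ?_
  · intro u
    apply unit_ext
    rw [uAct_coe, uAct_coe, H.oinvol]
  · intro h
    have := congrArg v h
    rw [hz, h0] at this; norm_num at this
  · apply hv
    rw [hn, hz, h0]; norm_num
  · intro x n hn0 hx
    have : n.natAbs • x = 0 := by
      rcases Int.natAbs_eq n with h | h
      · rw [h] at hx; simpa using hx
      · rw [h] at hx; simpa using hx
    have h1 : v x ^ n.natAbs = 1 := by rw [← hn, this, h0]
    have h2 : |v x| = 1 := by
      have := (pow_eq_one_iff_of_nonneg (abs_nonneg (v x)) (n := n.natAbs) (by simpa using hn0)).1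
        (by rw [← abs_pow, h1, abs_one])
      exact this
    rcases (abs_eq zero_le_one).1 h2 with h | h
    · left; apply hv; rw [h, h0]
    · right; apply hv; rw [h, hz]
  · intro x h
    have := congrArg v h
    rw [hn, hz] at this
    nlinarith [sq_nonneg (v x)]
  · rw [H.finrank_uPlus, rank_tr, rank_tr, H.finrank_Q]

theorem chev [IsTotallyReal K] [IsTotallyReal L] (φ : L →+* ℝ) (T : Finset (Ideal (𝓞 L)))
    (hT : ∀ P : Ideal (𝓞 L), P.IsPrime → P ≠ ⊥ → Inertial g P → P ∈ T) :
    2 * Nat.card (fixCl g) * (uNorm g).relIndex (uPlus g) ≤ Nat.card (ClassGroup (𝓞 K)) * 2 ^ T.card ∧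
      (uNorm g).relIndex (uPlus g) ≠ 0 := by
  obtain ⟨h1, h2⟩ := H.herb φ
  set N := (AddMonoidHom.id (Additive (𝓞 L)ˣ) + uAct g) with hN
  have hle1 : N.range ≤ uNorm g := by
    rintro _ ⟨u, rfl⟩
    exact ⟨((u.toMul : 𝓞 L) : L), rfl⟩
  have hle2 : uNorm g ≤ uPlus g := by
    rintro u ⟨w, hw⟩
    rw [mem_uPlus]
    apply unit_ext
    rw [uAct_coe]
    change g ((u.toMul : 𝓞 L) : L) = ((u.toMul : 𝓞 L) : L)
    rw [← hw, map_mul, H.invol, mul_comm]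
  have h3 := AddSubgroup.relIndex_mul_relIndex N.range (uNorm g) (uPlus g) hle1 hle2
  have h4 : N.range.relIndex (uNorm g) ≠ 0 := fun h => h2 (by rw [← h3, h, zero_mul])
  have h5 : (uNorm g).relIndex (uPlus g) ≠ 0 := fun h => h2 (by rw [← h3, h, mul_zero])
  refine ⟨?_, h5⟩
  have p2 := H.part2 h4
  have p1 := H.part1 T hT (by rw [h1]; positivity)
  rw [h1, ← h3] at p1
  calc _ ≤ 2 * (N.range.relIndex (uNorm g) * Nat.card (invCl g)) * (uNorm g).relIndex (uPlus g) := by gcongr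
    _ = Nat.card (invCl g) * (2 * (N.range.relIndex (uNorm g) * (uNorm g).relIndex (uPlus g))) := by ring
    _ ≤ _ := p1

theorem chev_nat [IsTotallyReal K] [IsTotallyReal L] (φ : L →+* ℝ) (S : Finset ℕ)
    (hS : ∀ p ∈ S, UniqAbove K p)
    (hT : ∀ P : Ideal (𝓞 L), P.IsPrime → P ≠ ⊥ → Inertial g P → ∃ p ∈ S, (p : 𝓞 L) ∈ P) :
    2 * Nat.card (fixCl g) * (uNorm g).relIndex (uPlus g) ≤ Nat.card (ClassGroup (𝓞 K)) * 2 ^ S.card ∧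
      (uNorm g).relIndex (uPlus g) ≠ 0 := by
  classical
  let X := {P : Ideal (𝓞 L) | P.IsPrime ∧ P ≠ ⊥ ∧ Inertial g P}
  have hX : ∀ P : X, ∃ p : S, ((p : ℕ) : 𝓞 L) ∈ P.1 := by
    rintro ⟨P, h1, h2, h3⟩
    obtain ⟨p, hp, h⟩ := hT P h1 h2 h3
    exact ⟨⟨p, hp⟩, h⟩
  choose f hf using hX
  have hinj : Function.Injective f := by
    rintro ⟨P, h1, h2, h3⟩ ⟨P', h1', h2', h3'⟩ h
    apply Subtype.ext
    refine H.inertial_unique h1 h1' h2 h2' h3 ?_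
    have a1 := hf ⟨P, h1, h2, h3⟩
    have a2 := hf ⟨P', h1', h2', h3'⟩
    rw [← h] at a2
    refine hS _ (f ⟨P, h1, h2, h3⟩).2 _ _ inferInstance inferInstance ?_ ?_
    · rw [Ideal.mem_comap, map_natCast]; exact a1
    · rw [Ideal.mem_comap, map_natCast]; exact a2
  have hfin : Finite X := Finite.of_injective f hinj
  have hc : (Set.toFinite X).toFinset.card ≤ S.card := by
    rw [← Set.ncard_eq_toFinset_card X, ← Nat.card_coe_set_eq]
    have := Nat.card_le_card_of_injective f hinj
    simpa using this
  have := H.chev φ (Set.toFinite X).toFinset (fun P h1 h2 h3 => by simpa using (show P ∈ X from ⟨h1, h2, h3⟩))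
  refine ⟨this.1.trans ?_, this.2⟩
  exact Nat.mul_le_mul_left _ (Nat.pow_le_pow_right (by norm_num) hc)

/-- the 2-part version -/
theorem chev2 [IsTotallyReal K] [IsTotallyReal L] (φ : L →+* ℝ) (S : Finset ℕ)
    (hS : ∀ p ∈ S, UniqAbove K p)
    (hT : ∀ P : Ideal (𝓞 L), P.IsPrime → P ≠ ⊥ → Inertial g P → ∃ p ∈ S, (p : 𝓞 L) ∈ P) :
    2 * Nat.card ↥(fixCl g ⊓ tw (ClassGroup (𝓞 L))) * (uNorm g).relIndex (uPlus g) ≤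
      Nat.card (tw (ClassGroup (𝓞 K))) * 2 ^ S.card ∧ (uNorm g).relIndex (uPlus g) ≠ 0 := by
  obtain ⟨h1, h2⟩ := H.chev_nat φ S hS hT
  refine ⟨?_, h2⟩
  have h3 : Nat.card ↥(fixCl g ⊓ tw (ClassGroup (𝓞 L))) * Nat.card (od (ClassGroup (𝓞 K))) ≤ Nat.card (fixCl g) := by
    rw [← Nat.card_prod]
    have hfix : ∀ c, clAct g (clExt K L c) = clExt K L c := by
      intro c
      obtain ⟨I, hI, rfl⟩ := cls_surj c
      rw [clExt_cls K L hI, clAct_cls g (iExt_ne K L hI), H.iAct_iExt]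
    refine Nat.card_le_card_of_injective (fun p => (⟨p.1.1 * clExt K L p.2.1,
      mul_mem p.1.2.1 (hfix _)⟩ : fixCl g)) ?_
    rintro ⟨⟨x, hx⟩, ⟨y, hy⟩⟩ ⟨⟨x', hx'⟩, ⟨y', hy'⟩⟩ h
    have h' : x * clExt K L y = x' * clExt K L y' := congrArg Subtype.val h
    have e1 : clExt K L (y * y'⁻¹) = x⁻¹ * x' := by
      rw [map_mul, map_inv, eq_comm, inv_mul_eq_iff_eq_mul, ← mul_assoc, h', mul_assoc, mul_inv_cancel, mul_one]
    have e2 : clExt K L (y * y'⁻¹) = 1 := by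
      apply tw_od
      · rw [e1]; exact mul_mem (inv_mem hx.2) hx'.2
      · exact map_od _ (mul_mem hy (inv_mem hy'))
    have e3 : (y * y'⁻¹) ^ 2 = 1 := by
      have := clNorm_clExt K L (y * y'⁻¹)
      rw [e2, map_one, H.finrank] at this
      exact this.symm
    have e4 : y * y'⁻¹ = 1 := tw_od ⟨1, by simpa using e3⟩ (mul_mem hy (inv_mem hy'))
    have e5 : y = y' := mul_inv_eq_one.1 e4
    subst e5
    have e6 : x = x' := mul_right_cancel h'
    subst e6; rfl
  have h4 := card_le_tw_od (G := ClassGroup (𝓞 K))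
  have h5 : 0 < Nat.card (od (ClassGroup (𝓞 K))) := Nat.card_pos
  apply Nat.le_of_mul_le_mul_right _ h5
  calc _ = 2 * (Nat.card ↥(fixCl g ⊓ tw (ClassGroup (𝓞 L))) * Nat.card (od (ClassGroup (𝓞 K)))) * (uNorm g).relIndex (uPlus g) := by ring
    _ ≤ 2 * Nat.card (fixCl g) * (uNorm g).relIndex (uPlus g) := by gcongr
    _ ≤ _ := h1
    _ ≤ Nat.card (tw (ClassGroup (𝓞 K))) * Nat.card (od (ClassGroup (𝓞 K))) * 2 ^ S.card := by gcongr
    _ = _ := by ring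

theorem chev2a [IsTotallyReal K] [IsTotallyReal L] (φ : L →+* ℝ) (S : Finset ℕ)
    (hS : ∀ p ∈ S, UniqAbove K p)
    (hT : ∀ P : Ideal (𝓞 L), P.IsPrime → P ≠ ⊥ → Inertial g P → ∃ p ∈ S, (p : 𝓞 L) ∈ P) :
    2 * Nat.card ↥(fixCl g ⊓ tw (ClassGroup (𝓞 L))) ≤ Nat.card (tw (ClassGroup (𝓞 K))) * 2 ^ S.card := by
  obtain ⟨h1, h2⟩ := H.chev2 φ S hS hT
  exact (Nat.le_mul_of_pos_right _ (Nat.pos_of_ne_zero h2)).trans h1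

theorem chev2b [IsTotallyReal K] [IsTotallyReal L] (φ : L →+* ℝ) (S : Finset ℕ)
    (hS : ∀ p ∈ S, UniqAbove K p)
    (hT : ∀ P : Ideal (𝓞 L), P.IsPrime → P ≠ ⊥ → Inertial g P → ∃ p ∈ S, (p : 𝓞 L) ∈ P)
    (e : (𝓞 K)ˣ) (he : ∀ y : L, y * g y ≠ algebraMap K L (e : 𝓞 K)) :
    4 * Nat.card ↥(fixCl g ⊓ tw (ClassGroup (𝓞 L))) ≤ Nat.card (tw (ClassGroup (𝓞 K))) * 2 ^ S.card := by
  obtain ⟨h1, h2⟩ := H.chev2 φ S hS hT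
  have h3 : (uNorm g).relIndex (uPlus g) ≠ 1 := by
    rw [Ne, AddSubgroup.relIndex_eq_one]
    intro h
    let u : Additive (𝓞 L)ˣ := Additive.ofMul (Units.map (algebraMap (𝓞 K) (𝓞 L) : 𝓞 K →* 𝓞 L) e)
    have hu : u ∈ uPlus g := by
      rw [mem_uPlus]
      apply unit_ext
      rw [uAct_coe]
      simp [u, coe_algMap, H.fix]
    obtain ⟨w, hw⟩ := h hu
    exact he w hw
  have h4 : 2 ≤ (uNorm g).relIndex (uPlus g) := by omega
  calc _ = 2 * Nat.card ↥(fixCl g ⊓ tw (ClassGroup (𝓞 L))) * 2 := by ring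
    _ ≤ 2 * Nat.card ↥(fixCl g ⊓ tw (ClassGroup (𝓞 L))) * (uNorm g).relIndex (uPlus g) := by gcongr
    _ ≤ _ := h1

end IsQuad
end chev

noncomputable instance algOfFact {E F : IntermediateField ℚ ℝ} [h : Fact (E ≤ F)] : Algebra E F :=
  (IntermediateField.inclusion h.out).toRingHom.toAlgebra

lemma algOfFact_coe {E F : IntermediateField ℚ ℝ} [h : Fact (E ≤ F)] (x : E) :
    ((algebraMap E F x : F) : ℝ) = (x : ℝ) := rfl

instance towerOfFact {E F G : IntermediateField ℚ ℝ} [Fact (E ≤ F)] [Fact (F ≤ G)] [Fact (E ≤ G)] :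
    IsScalarTower E F G := IsScalarTower.of_algebraMap_eq (fun _ => rfl)

section ext
variable {K L : Type*} [Field K] [NumberField K] [Field L] [NumberField L] [Algebra K L]

theorem ext_aut (β : L) (d : K) (hd : β ^ 2 = algebraMap K L d) (hβ : ∀ a, β ≠ algebraMap K L a)
    (rep : ∀ x : L, ∃ a b : K, x = algebraMap K L a + algebraMap K L b * β)
    (σ : K ≃+* K) (y : L) (hy : y ^ 2 = algebraMap K L (σ d)) :
    ∃ τ : L ≃+* L, (∀ a, τ (algebraMap K L a) = algebraMap K L (σ a)) ∧ τ β = y := by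
  have huniq : ∀ a b a' b' : K, algebraMap K L a + algebraMap K L b * β =
      algebraMap K L a' + algebraMap K L b' * β → a = a' ∧ b = b' := by
    intro a b a' b' h
    have hb : b = b' := by
      by_contra hne
      have hne' : algebraMap K L (b - b') ≠ 0 := by
        rw [Ne, map_eq_zero]; exact sub_ne_zero.2 hne
      apply hβ ((a' - a) / (b - b'))
      rw [map_div₀, eq_div_iff hne', map_sub, map_sub]
      linear_combination h
    subst hb
    exact ⟨(algebraMap K L).injective (by linear_combination h), rfl⟩
  choose A B hAB using rep
  let f : L → L := fun x => algebraMap K L (σ (A x)) + algebraMap K L (σ (B x)) * y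
  have hf : ∀ a b, f (algebraMap K L a + algebraMap K L b * β) =
      algebraMap K L (σ a) + algebraMap K L (σ b) * y := by
    intro a b
    obtain ⟨h1, h2⟩ := huniq _ _ _ _ (hAB (algebraMap K L a + algebraMap K L b * β))
    simp only [f]
    rw [← h1, ← h2]
  have hfa : ∀ a, f (algebraMap K L a) = algebraMap K L (σ a) := by
    intro a
    have := hf a 0
    simpa using this
  have hadd : ∀ u v, f (u + v) = f u + f v := by
    intro u v
    obtain ⟨a, b, rfl⟩ : ∃ a b, u = algebraMap K L a + algebraMap K L b * β := ⟨_, _, hAB u⟩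
    obtain ⟨a', b', rfl⟩ : ∃ a b, v = algebraMap K L a + algebraMap K L b * β := ⟨_, _, hAB v⟩
    rw [hf, hf, show algebraMap K L a + algebraMap K L b * β + (algebraMap K L a' + algebraMap K L b' * β) =
      algebraMap K L (a + a') + algebraMap K L (b + b') * β by rw [map_add, map_add]; ring, hf]
    simp only [map_add]; ring
  have hmul : ∀ u v, f (u * v) = f u * f v := by
    intro u v
    obtain ⟨a, b, rfl⟩ : ∃ a b, u = algebraMap K L a + algebraMap K L b * β := ⟨_, _, hAB u⟩
    obtain ⟨a', b', rfl⟩ : ∃ a b, v = algebraMap K L a + algebraMap K L b * β := ⟨_, _, hAB v⟩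
    rw [hf, hf, show (algebraMap K L a + algebraMap K L b * β) * (algebraMap K L a' + algebraMap K L b' * β) =
      algebraMap K L (a * a' + b * b' * d) + algebraMap K L (a * b' + a' * b) * β by
        simp only [map_add, map_mul]; linear_combination (algebraMap K L b * algebraMap K L b') * hd, hf]
    simp only [map_add, map_mul]
    linear_combination -(algebraMap K L (σ b) * algebraMap K L (σ b')) * hy
  let F : L →+* L :=
    { toFun := f
      map_one' := by have := hfa 1; simpa using this
      map_mul' := hmul
      map_zero' := by have := hfa 0; simpa using this
      map_add' := hadd }
  have hinj : Function.Injective F := F.injective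
  have hsurj : Function.Surjective F := by
    have : Function.Injective (F.toRatAlgHom.toLinearMap : L →ₗ[ℚ] L) := hinj
    exact LinearMap.surjective_of_injective this
  refine ⟨RingEquiv.ofBijective F ⟨hinj, hsurj⟩, hfa, ?_⟩
  have := hf 0 1
  have h2 : f β = y := by simpa using this
  exact h2

theorem mk_conj (β : L) (d : K) (hd : β ^ 2 = algebraMap K L d) (hβ : ∀ a, β ≠ algebraMap K L a)
    (rep : ∀ x : L, ∃ a b : K, x = algebraMap K L a + algebraMap K L b * β) :
    ∃ g : L ≃+* L, IsQuad K L g β := by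
  obtain ⟨g, h1, h2⟩ := ext_aut β d hd hβ rep (RingEquiv.refl K) (-β) (by rw [neg_sq, hd]; rfl)
  exact ⟨g, h1, h2, fun h => hβ 0 (by rw [h, map_zero]), rep⟩
end ext

/-- the field E(x), as a set of a + b x -/
noncomputable def sqext (E : IntermediateField ℚ ℝ) (x : ℝ) (hx : x ^ 2 ∈ E) : IntermediateField ℚ ℝ where
  carrier := {z | ∃ a ∈ E, ∃ b ∈ E, z = a + b * x}
  mul_mem' := by
    rintro _ _ ⟨a, ha, b, hb, rfl⟩ ⟨a', ha', b', hb', rfl⟩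
    refine ⟨a * a' + b * b' * x ^ 2, add_mem (mul_mem ha ha') (mul_mem (mul_mem hb hb') hx),
      a * b' + a' * b, add_mem (mul_mem ha hb') (mul_mem ha' hb), by ring⟩
  add_mem' := by
    rintro _ _ ⟨a, ha, b, hb, rfl⟩ ⟨a', ha', b', hb', rfl⟩
    exact ⟨a + a', add_mem ha ha', b + b', add_mem hb hb', by ring⟩
  algebraMap_mem' := fun r => ⟨_, E.algebraMap_mem r, 0, zero_mem _, by simp⟩
  inv_mem' := by
    rintro _ ⟨a, ha, b, hb, rfl⟩
    by_cases hb0 : b = 0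
    · exact ⟨a⁻¹, inv_mem ha, 0, zero_mem _, by simp [hb0]⟩
    by_cases h : a ^ 2 - b ^ 2 * x ^ 2 = 0
    · have h1 : (a - b * x) * (a + b * x) = 0 := by linear_combination h
      have hxE : x ∈ E := by
        rcases mul_eq_zero.1 h1 with h2 | h2
        · have : x = a / b := by field_simp; linear_combination -h2
          rw [this]; exact div_mem ha hb
        · have : x = -a / b := by field_simp; linear_combination h2
          rw [this]; exact div_mem (neg_mem ha) hb
      exact ⟨(a + b * x)⁻¹, inv_mem (add_mem ha (mul_mem hb hxE)), 0, zero_mem _, by simp⟩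
    · have hN : a ^ 2 - b ^ 2 * x ^ 2 ∈ E := sub_mem (pow_mem ha 2) (mul_mem (pow_mem hb 2) hx)
      refine ⟨a / (a ^ 2 - b ^ 2 * x ^ 2), div_mem ha hN, -b / (a ^ 2 - b ^ 2 * x ^ 2), div_mem (neg_mem hb) hN, ?_⟩
      have h3 : a + b * x ≠ 0 := by
        intro h4; apply h; linear_combination (a - b * x) * h4
      rw [inv_eq_iff_eq_inv, eq_comm, inv_eq_iff_eq_inv, ← one_div, eq_div_iff h3]
      field_simp
      ring

lemma le_sqext (E : IntermediateField ℚ ℝ) (x : ℝ) (hx : x ^ 2 ∈ E) : E ≤ sqext E x hx :=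
  fun a ha => ⟨a, ha, 0, zero_mem _, by simp⟩

lemma mem_sqext (E : IntermediateField ℚ ℝ) (x : ℝ) (hx : x ^ 2 ∈ E) : x ∈ sqext E x hx :=
  ⟨0, zero_mem _, 1, one_mem _, by simp⟩

section sub
variable {E F : IntermediateField ℚ ℝ}

theorem sub_rep [Fact (E ≤ F)] {x : ℝ} (hx : x ^ 2 ∈ E) (hxF : x ∈ F) (hle : F ≤ sqext E x hx) (z : F) :
    ∃ a b : E, z = algebraMap E F a + algebraMap E F b * ⟨x, hxF⟩ := by
  obtain ⟨a, ha, b, hb, h⟩ := hle z.2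
  exact ⟨⟨a, ha⟩, ⟨b, hb⟩, Subtype.ext h⟩

theorem sub_conj [NumberField E] [NumberField F] [Fact (E ≤ F)] {x : ℝ} (hx : x ^ 2 ∈ E) (hxF : x ∈ F)
    (hle : F ≤ sqext E x hx) (hxE : x ∉ E) : ∃ g : F ≃+* F, IsQuad E F g ⟨x, hxF⟩ := by
  refine mk_conj _ ⟨x ^ 2, hx⟩ (Subtype.ext rfl) ?_ (sub_rep hx hxF hle)
  intro a h
  apply hxE
  have : x = (a : ℝ) := congrArg Subtype.val h
  rw [this]; exact a.2

theorem sub_ext [NumberField E] [NumberField F] [Fact (E ≤ F)] {x : ℝ} (hx : x ^ 2 ∈ E) (hxF : x ∈ F)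
    (hle : F ≤ sqext E x hx) (hxE : x ∉ E) (σ : E ≃+* E) (y : F) (hy : (y : ℝ) ^ 2 = σ ⟨x ^ 2, hx⟩) :
    ∃ τ : F ≃+* F, (∀ a, τ (algebraMap E F a) = algebraMap E F (σ a)) ∧ τ ⟨x, hxF⟩ = y := by
  refine ext_aut _ ⟨x ^ 2, hx⟩ (Subtype.ext rfl) ?_ (sub_rep hx hxF hle) σ y (Subtype.ext hy)
  intro a h
  apply hxE
  have : x = (a : ℝ) := congrArg Subtype.val h
  rw [this]; exact a.2

/-- z square in E(x) implies z or z x^2 square in E -/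
theorem sq_descent {x z : ℝ} (hx : x ^ 2 ∈ E) (hxE : x ∉ E) (hz : z ∈ E) (h : ∃ w ∈ sqext E x hx, w ^ 2 = z) :
    (∃ w ∈ E, w ^ 2 = z) ∨ (∃ w ∈ E, x ^ 2 * w ^ 2 = z) := by
  obtain ⟨_, ⟨a, ha, b, hb, rfl⟩, h⟩ := h
  by_cases hab : a * b = 0
  · rcases mul_eq_zero.1 hab with h0 | h0
    · right; exact ⟨b, hb, by rw [← h, h0]; ring⟩
    · left; exact ⟨a, ha, by rw [← h, h0]; ring⟩
  · exfalso
    apply hxE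
    have : x = (z - a ^ 2 - b ^ 2 * x ^ 2) / (2 * (a * b)) := by
      rw [eq_div_iff (mul_ne_zero two_ne_zero hab)]
      linear_combination h
    rw [this]
    exact div_mem (sub_mem (sub_mem hz (pow_mem ha 2)) (mul_mem (pow_mem hb 2) hx))
      (mul_mem (by exact_mod_cast E.algebraMap_mem (2 : ℚ)) (mul_mem ha hb))
end sub

noncomputable def cc (n : ℕ) : ℝ := 2 * Real.cos (2 * Real.pi / 2 ^ (n + 2))

lemma cc_zero : cc 0 = 0 := by
  unfold cc
  rw [show 2 * Real.pi / 2 ^ (0 + 2) = Real.pi / 2 by ring, Real.cos_pi_div_two, mul_zero]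

lemma cc_succ (n : ℕ) : cc (n + 1) ^ 2 = 2 + cc n := by
  unfold cc
  rw [show 2 * Real.pi / 2 ^ (n + 2) = 2 * (2 * Real.pi / 2 ^ (n + 1 + 2)) by
    rw [show n + 1 + 2 = (n + 2) + 1 by ring, pow_succ (2 : ℝ) (n + 2)]; field_simp, Real.cos_two_mul]
  ring

lemma layer_eq (S : Set ℝ) (n : ℕ) : layer S n = IntermediateField.adjoin ℚ (S ∪ {cc n}) := rfl

lemma cc_mem_layer (S : Set ℝ) (n : ℕ) : cc n ∈ layer S n :=
  IntermediateField.subset_adjoin ℚ _ (Or.inr rfl)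

lemma subset_layer (S : Set ℝ) (n : ℕ) {x : ℝ} (hx : x ∈ S) : x ∈ layer S n :=
  IntermediateField.subset_adjoin ℚ _ (Or.inl hx)

lemma layer_le {S : Set ℝ} {n : ℕ} {F : IntermediateField ℚ ℝ} (h : ∀ x ∈ S, x ∈ F) (hc : cc n ∈ F) :
    layer S n ≤ F := by
  rw [layer_eq, IntermediateField.adjoin_le_iff]
  rintro x (hx | hx)
  · exact h x hx
  · rw [Set.mem_singleton_iff.1 hx]; exact hc

lemma two_mem (F : IntermediateField ℚ ℝ) : (2 : ℝ) ∈ F := by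
  exact_mod_cast F.algebraMap_mem (2 : ℚ)

lemma nat_mem (F : IntermediateField ℚ ℝ) (k : ℕ) : (k : ℝ) ∈ F := by
  exact_mod_cast F.algebraMap_mem (k : ℚ)

lemma cc_sq_mem (S : Set ℝ) (n : ℕ) : cc (n + 1) ^ 2 ∈ layer S n := by
  rw [cc_succ]; exact add_mem (two_mem _) (cc_mem_layer S n)

lemma layer_le_succ (S : Set ℝ) (n : ℕ) : layer S n ≤ layer S (n + 1) := by
  refine layer_le (fun x hx => subset_layer S _ hx) ?_
  have : cc n = cc (n + 1) ^ 2 - 2 := by rw [cc_succ]; ring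
  rw [this]; exact sub_mem (pow_mem (cc_mem_layer S _) 2) (two_mem _)

lemma layer_zero_le (S : Set ℝ) (n : ℕ) : layer S 0 ≤ layer S n := by
  refine layer_le (fun x hx => subset_layer S _ hx) ?_
  rw [cc_zero]; exact zero_mem _

lemma layer_mono {S T : Set ℝ} (h : S ⊆ T) (n : ℕ) : layer S n ≤ layer T n :=
  layer_le (fun _ hx => subset_layer T _ (h hx)) (cc_mem_layer T n)

lemma layer_succ_le (S : Set ℝ) (n : ℕ) : layer S (n + 1) ≤ sqext (layer S n) (cc (n + 1)) (cc_sq_mem S n) :=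
  layer_le (fun _ hx => le_sqext _ _ _ (subset_layer S n hx)) (mem_sqext _ _ _)

lemma layer_insert_le (S : Set ℝ) (n : ℕ) (x : ℝ) (hx : x ^ 2 ∈ layer S n) :
    layer (insert x S) n ≤ sqext (layer S n) x hx := by
  refine layer_le ?_ (le_sqext _ _ _ (cc_mem_layer S n))
  rintro y (rfl | hy)
  · exact mem_sqext _ _ _
  · exact le_sqext _ _ _ (subset_layer S n hy)

noncomputable def Qf (n : ℕ) : IntermediateField ℚ ℝ := layer ∅ n
noncomputable def Ef (a n : ℕ) : IntermediateField ℚ ℝ := layer {√(a : ℝ)} n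
noncomputable def Kf (a b n : ℕ) : IntermediateField ℚ ℝ := layer {√(a : ℝ), √(b : ℝ)} n

lemma sq_sqrt_nat (a : ℕ) : √(a : ℝ) ^ 2 = a := Real.sq_sqrt (Nat.cast_nonneg a)

lemma sqrt_sq_mem (F : IntermediateField ℚ ℝ) (a : ℕ) : √(a : ℝ) ^ 2 ∈ F := by
  rw [sq_sqrt_nat]; exact nat_mem F a

instance Qf_le_succ (n : ℕ) : Fact (Qf n ≤ Qf (n + 1)) := ⟨layer_le_succ _ _⟩
instance Ef_le_succ (a n : ℕ) : Fact (Ef a n ≤ Ef a (n + 1)) := ⟨layer_le_succ _ _⟩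
instance Ef_zero_le (a n : ℕ) : Fact (Ef a 0 ≤ Ef a n) := ⟨layer_zero_le _ _⟩
instance Qf_le_Ef (a n : ℕ) : Fact (Qf n ≤ Ef a n) := ⟨layer_mono (Set.empty_subset _) _⟩
instance Ef_le_Kf (a b n : ℕ) : Fact (Ef a n ≤ Kf a b n) := ⟨layer_mono (by simp) _⟩
instance Ef_le_Kf' (a b n : ℕ) : Fact (Ef b n ≤ Kf a b n) := ⟨layer_mono (by simp) _⟩
instance Ef_le_Kf_mul (a b n : ℕ) : Fact (Ef (a * b) n ≤ Kf a b n) := ⟨by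
  refine layer_le ?_ (cc_mem_layer _ n)
  rintro x hx
  rw [Set.mem_singleton_iff.1 hx, Nat.cast_mul, Real.sqrt_mul (Nat.cast_nonneg a)]
  exact mul_mem (subset_layer _ _ (by simp)) (subset_layer _ _ (by simp))⟩
instance Ef_le_Ef_two (a : ℕ) : Fact (Ef a 0 ≤ Ef (2 * a) 1) := ⟨by
  refine layer_le ?_ (by rw [cc_zero]; exact zero_mem _)
  rintro x hx
  rw [Set.mem_singleton_iff.1 hx]
  have h1 : cc 1 ∈ Ef (2 * a) 1 := cc_mem_layer _ 1
  have h2 : √((2 * a : ℕ) : ℝ) ∈ Ef (2 * a) 1 := subset_layer _ _ rfl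
  have h3 : cc 1 ^ 2 = 2 := by rw [cc_succ, cc_zero, add_zero]
  have h4 : |cc 1| = √2 := by rw [← Real.sqrt_sq_eq_abs, h3]
  have h5 : √2 ∈ Ef (2 * a) 1 := by
    rw [← h4]; rcases abs_choice (cc 1) with h | h <;> rw [h]
    · exact h1
    · exact neg_mem h1
  have : √(a : ℝ) = √((2 * a : ℕ) : ℝ) / √2 := by
    push_cast
    rw [Real.sqrt_mul zero_le_two, mul_div_cancel_left₀]
    positivity
  rw [this]; exact div_mem h2 h5⟩

lemma isInt_cc (n : ℕ) : IsIntegral ℤ (cc n) := by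
  induction n with
  | zero => rw [cc_zero]; exact isIntegral_zero
  | succ k ih =>
    refine IsIntegral.of_pow (n := 2) (by norm_num) ?_
    rw [cc_succ]
    exact (isIntegral_algebraMap (R := ℤ) (x := (2 : ℤ))).add ih

lemma isInt_sqrt (a : ℕ) : IsIntegral ℤ (√(a : ℝ)) := by
  refine IsIntegral.of_pow (n := 2) (by norm_num) ?_
  rw [sq_sqrt_nat]
  exact isIntegral_algebraMap (R := ℤ) (x := (a : ℤ))

lemma layer_nf (S : Set ℝ) (hS : ∀ x ∈ S, IsIntegral ℤ x) (hf : S.Finite) (n : ℕ) : NumberField (layer S n) := by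
  have hfin : Finite ((S ∪ {cc n} : Set ℝ)) := (hf.union (Set.finite_singleton _)).to_subtype
  have : FiniteDimensional ℚ (layer S n) := by
    rw [layer_eq]
    apply IntermediateField.finiteDimensional_adjoin
    rintro x (hx | hx)
    · exact (hS x hx).tower_top
    · rw [Set.mem_singleton_iff.1 hx]; exact (isInt_cc n).tower_top
  exact { to_charZero := inferInstance, to_finiteDimensional := this }

instance Qf_nf (n : ℕ) : NumberField (Qf n) := layer_nf _ (by simp) (by simp) n
instance Ef_nf (a n : ℕ) : NumberField (Ef a n) := layer_nf _ (by simp [isInt_sqrt]) (by simp) n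
instance Kf_nf (a b n : ℕ) : NumberField (Kf a b n) := layer_nf _ (by simp [isInt_sqrt]) (by simp) n

lemma cc_mem_of_le (S : Set ℝ) {j n : ℕ} (h : j ≤ n) : cc j ∈ layer S n := by
  induction n, h using Nat.le_induction with
  | base => exact cc_mem_layer S j
  | succ k _ ih => exact layer_le_succ S k ih

lemma layer_tr (S : Set ℝ) (hS : ∀ x ∈ S, ∃ a : ℕ, x = √(a : ℝ)) (n : ℕ) : IsTotallyReal (layer S n) := by
  have key : ∀ φ : layer S n →+* ℂ, NumberField.ComplexEmbedding.IsReal φ := by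
    intro φ
    have hcc : ∀ j ≤ n, ∃ x : ℝ, |x| ≤ 2 ∧ ∀ h : cc j ∈ layer S n, φ ⟨cc j, h⟩ = x := by
      intro j
      induction j with
      | zero =>
        intro _
        refine ⟨0, by simp, fun h => ?_⟩
        have : (⟨cc 0, h⟩ : layer S n) = 0 := Subtype.ext cc_zero
        rw [this, map_zero]; simp
      | succ k ih =>
        intro hk
        obtain ⟨x, hx, hu⟩ := ih (by omega)
        rw [abs_le] at hx
        have hm : cc k ∈ layer S n := cc_mem_of_le S (by omega)
        have hm' : cc (k + 1) ∈ layer S n := cc_mem_of_le S hk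
        have h1 : φ ⟨cc (k + 1), hm'⟩ ^ 2 = ((√(2 + x) : ℝ) : ℂ) ^ 2 := by
          have e : (⟨cc (k + 1), hm'⟩ : layer S n) ^ 2 = 2 + ⟨cc k, hm⟩ := Subtype.ext (cc_succ k)
          rw [← map_pow, e, map_add, hu hm, ← Complex.ofReal_pow, Real.sq_sqrt (by linarith)]
          push_cast; rw [map_ofNat]
        have h2 : √(2 + x) ≤ 2 := by
          rw [Real.sqrt_le_left (by norm_num)]; linarith
        rcases sq_eq_sq_iff_eq_or_eq_neg.1 h1 with h | h
        · exact ⟨√(2 + x), by rw [abs_of_nonneg (Real.sqrt_nonneg _)]; exact h2, fun _ => h⟩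
        · exact ⟨-√(2 + x), by rw [abs_neg, abs_of_nonneg (Real.sqrt_nonneg _)]; exact h2,
            fun _ => by rw [h]; push_cast; rfl⟩
    have hall : ∀ x (hx : x ∈ IntermediateField.adjoin ℚ (S ∪ {cc n})), (starRingEnd ℂ) (φ ⟨x, hx⟩) = φ ⟨x, hx⟩ := by
      intro x hx
      induction hx using IntermediateField.adjoin_induction with
      | mem x hx =>
        rcases hx with hx | hx
        · obtain ⟨a, ha⟩ := hS x hx
          have h1 : φ ⟨x, subset_layer S n hx⟩ ^ 2 = ((√(a : ℝ) : ℝ) : ℂ) ^ 2 := by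
            have e : (⟨x, subset_layer S n hx⟩ : layer S n) ^ 2 = (a : layer S n) := by
              apply Subtype.ext
              change x ^ 2 = _
              rw [ha, sq_sqrt_nat]; simp
            rw [← map_pow, e, map_natCast, ← Complex.ofReal_pow, sq_sqrt_nat]; simp
          rcases sq_eq_sq_iff_eq_or_eq_neg.1 h1 with h | h
          · erw [h]; simp
          · erw [h]; simp
        · have hx' : x = cc n := hx
          subst hx'
          obtain ⟨y, _, hy⟩ := hcc n le_rfl
          erw [hy (cc_mem_layer S n)]; simp
      | algebraMap r =>
        have : (⟨algebraMap ℚ ℝ r, (layer S n).algebraMap_mem r⟩ : layer S n) = (r : layer S n) := by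
          apply Subtype.ext; simp
        erw [this, map_ratCast]; simp
      | add x y hx hy ihx ihy =>
        have : (⟨x + y, add_mem hx hy⟩ : layer S n) = ⟨x, hx⟩ + ⟨y, hy⟩ := rfl
        erw [this, map_add, map_add, ihx, ihy]
      | inv x hx ih =>
        have : (⟨x⁻¹, inv_mem hx⟩ : layer S n) = (⟨x, hx⟩)⁻¹ := rfl
        erw [this, map_inv₀, map_inv₀, ih]
      | mul x y hx hy ihx ihy =>
        have : (⟨x * y, mul_mem hx hy⟩ : layer S n) = ⟨x, hx⟩ * ⟨y, hy⟩ := rfl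
        erw [this, map_mul, map_mul, ihx, ihy]
    ext x
    exact hall x.1 x.2
  refine ⟨fun v => ?_⟩
  rw [← NumberField.InfinitePlace.mk_embedding v, NumberField.InfinitePlace.isReal_mk_iff]
  exact key _

instance Qf_tr (n : ℕ) : IsTotallyReal (Qf n) := layer_tr _ (by simp) n
instance Ef_tr (a n : ℕ) : IsTotallyReal (Ef a n) := layer_tr _ (by simp) n
instance Kf_tr (a b n : ℕ) : IsTotallyReal (Kf a b n) := layer_tr _ (by simp) n

lemma cc_mem_Qf (n : ℕ) : cc n ∈ Qf n := cc_mem_layer _ n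
lemma cc_mem_Ef (a n : ℕ) : cc n ∈ Ef a n := cc_mem_layer _ n
lemma cc_mem_Kf (a b n : ℕ) : cc n ∈ Kf a b n := cc_mem_layer _ n
lemma sqrt_mem_Ef (a n : ℕ) : √(a : ℝ) ∈ Ef a n := subset_layer _ n rfl
lemma sqrt_mem_Kf (a b n : ℕ) : √(a : ℝ) ∈ Kf a b n := subset_layer _ n (by simp)
lemma sqrt_mem_Kf' (a b n : ℕ) : √(b : ℝ) ∈ Kf a b n := subset_layer _ n (by simp)

lemma Qf_zero : Qf 0 = ⊥ := by
  rw [eq_bot_iff]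
  exact layer_le (by simp) (by rw [cc_zero]; exact zero_mem _)

lemma mem_Qf_zero {x : ℝ} (hx : x ∈ Qf 0) : ∃ k : ℚ, (k : ℝ) = x := by
  rw [Qf_zero, IntermediateField.mem_bot] at hx
  obtain ⟨k, hk⟩ := hx
  exact ⟨k, by simpa using hk⟩

lemma rat_mem (F : IntermediateField ℚ ℝ) (k : ℚ) : (k : ℝ) ∈ F := by
  exact_mod_cast F.algebraMap_mem k

lemma two_nonsq (k : ℚ) : k ^ 2 ≠ 2 := by
  intro h
  have h1 : IsSquare ((2 : ℕ) : ℚ) := ⟨k, by rw [← sq, h]; norm_num⟩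
  rw [Rat.isSquare_natCast_iff] at h1
  obtain ⟨m, hm⟩ := h1
  have : m ≤ 1 := by nlinarith
  interval_cases m <;> omega

lemma Qf_succ_le (n : ℕ) : Qf (n + 1) ≤ sqext (Qf n) (cc (n + 1)) (cc_sq_mem _ n) := layer_succ_le _ n

/-- norm descent -/
lemma norm_desc (n : ℕ) (hc : cc (n + 1) ∉ Qf n) (hP : ∀ w ∈ Qf n, w ^ 2 ≠ 2 - cc n) (t : ℚ) (z : ℝ)
    (hz : z ∈ Qf (n + 1)) (e : ℝ) (he : e ∈ Qf 0) (he2 : e ^ 2 = 1) : (t : ℝ) * z ^ 2 ≠ 2 + e * cc (n + 1) := by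
  intro h
  obtain ⟨a, ha, b, hb, rfl⟩ := Qf_succ_le n hz
  have heQ : e ∈ Qf n := layer_zero_le _ n he
  have htQ := rat_mem (Qf n) t
  have h1 : 2 * t * a * b - e = 0 := by
    by_contra hne
    apply hc
    have : cc (n + 1) = (2 - t * (a ^ 2 + b ^ 2 * cc (n + 1) ^ 2)) / (2 * t * a * b - e) := by
      rw [eq_div_iff hne]; linear_combination h
    rw [this]
    exact div_mem (sub_mem (two_mem _) (mul_mem htQ (add_mem (pow_mem ha 2) (mul_mem (pow_mem hb 2) (cc_sq_mem _ n)))))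
      (sub_mem (mul_mem (mul_mem (mul_mem (two_mem _) htQ) ha) hb) heQ)
  have h2 : t * (a ^ 2 + b ^ 2 * cc (n + 1) ^ 2) = 2 := by linear_combination h - cc (n + 1) * h1
  refine hP (t * (a ^ 2 - b ^ 2 * cc (n + 1) ^ 2))
    (mul_mem htQ (sub_mem (pow_mem ha 2) (mul_mem (pow_mem hb 2) (cc_sq_mem _ n)))) ?_
  have h3 := cc_succ n
  have h1' : 2 * t * a * b = e := by linear_combination h1
  have h4 : (2 * t * a * b) ^ 2 = 1 := by rw [h1', he2]
  have h5 : (t * (a ^ 2 + b ^ 2 * cc (n + 1) ^ 2)) ^ 2 = 4 := by rw [h2]; norm_num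
  linear_combination h5 - cc (n + 1) ^ 2 * h4 - h3

lemma cc_nonsq (n : ℕ) : ∀ w ∈ Qf n, w ^ 2 ≠ 2 + cc n ∧ w ^ 2 ≠ 2 - cc n := by
  induction n with
  | zero =>
    intro w hw
    obtain ⟨k, rfl⟩ := mem_Qf_zero hw
    rw [cc_zero]
    constructor
    · intro h; apply two_nonsq k; rw [add_zero] at h; exact_mod_cast h
    · intro h; apply two_nonsq k; rw [sub_zero] at h; exact_mod_cast h
  | succ n ih =>
    have hc : cc (n + 1) ∉ Qf n := fun h => (ih _ h).1 (cc_succ n)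
    intro w hw
    constructor
    · intro h
      apply norm_desc n hc (fun w hw => (ih w hw).2) 1 w hw 1 (one_mem _) (by norm_num)
      rw [h]; simp [h]
    · intro h
      apply norm_desc n hc (fun w hw => (ih w hw).2) 1 w hw (-1) (neg_mem (one_mem _)) (by norm_num)
      rw [h]; push_cast; ring

lemma cc_notMem_Qf (n : ℕ) : cc (n + 1) ∉ Qf n := fun h => (cc_nonsq n _ h).1 (cc_succ n)

lemma cc_nonsq_rat (n : ℕ) (t : ℚ) (z : ℝ) (hz : z ∈ Qf (n + 1)) : (t : ℝ) * z ^ 2 ≠ 2 + cc (n + 1) := by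
  have := norm_desc n (cc_notMem_Qf n) (fun w hw => (cc_nonsq n w hw).2) t z hz 1 (one_mem _) (by norm_num)
  rwa [one_mul] at this

lemma rat_sq (a : ℚ) (ha : a ≠ 0) (n : ℕ) (h : ∃ w ∈ Qf n, w ^ 2 = a) : IsSquare a ∨ IsSquare (2 * a) := by
  induction n with
  | zero =>
    obtain ⟨w, hw, h⟩ := h
    obtain ⟨k, rfl⟩ := mem_Qf_zero hw
    left
    exact ⟨k, by rw [← sq]; exact_mod_cast h.symm⟩
  | succ n ih =>
    obtain ⟨w, hw, hwa⟩ := h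
    rcases sq_descent (cc_sq_mem _ n) (cc_notMem_Qf n) (rat_mem _ a) ⟨w, Qf_succ_le n hw, hwa⟩ with h | h
    · exact ih h
    · obtain ⟨v, hv, h⟩ := h
      rw [cc_succ] at h
      have ha' : (a : ℝ) ≠ 0 := by exact_mod_cast ha
      have hv0 : v ≠ 0 := by
        rintro rfl; apply ha'; rw [← h]; ring
      rcases n with _ | n
      · rw [cc_zero] at h
        obtain ⟨k, rfl⟩ := mem_Qf_zero hv
        right
        have h' : 2 * k ^ 2 = a := by rw [add_zero] at h; exact_mod_cast h
        exact ⟨2 * k, by rw [← h']; ring⟩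
      · exfalso
        apply cc_nonsq_rat n a v⁻¹ (inv_mem hv)
        rw [← h]; field_simp

/-- neither `a` nor `2a` is a square -/
def NS (a : ℕ) : Prop := ¬ IsSquare a ∧ ¬ IsSquare (2 * a)

lemma NS.ne {a : ℕ} (h : NS a) : a ≠ 0 := by
  rintro rfl; exact h.1 ⟨0, rfl⟩

lemma NS.two {a : ℕ} (h : NS a) : NS (2 * a) := by
  refine ⟨h.2, ?_⟩
  rintro ⟨k, hk⟩
  have : 2 ∣ k := by
    have : 2 ∣ k * k := ⟨2 * a, hk.symm⟩
    rcases (Nat.Prime.dvd_mul Nat.prime_two).1 this with h | h <;> exact h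
  obtain ⟨j, rfl⟩ := this
  exact h.1 ⟨j, by nlinarith⟩

lemma NS.sq {a : ℕ} (h : NS a) (n : ℕ) : ¬ ∃ w ∈ Qf n, w ^ 2 = (a : ℝ) := by
  rintro ⟨w, hw, hw2⟩
  rcases rat_sq (a : ℚ) (by exact_mod_cast h.ne) n ⟨w, hw, by simpa using hw2⟩ with h1 | h1
  · exact h.1 (Rat.isSquare_natCast_iff.1 h1)
  · exact h.2 (Rat.isSquare_natCast_iff.1 (by exact_mod_cast h1))

lemma NS.notMem {a : ℕ} (h : NS a) (n : ℕ) : √(a : ℝ) ∉ Qf n :=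
  fun hm => h.sq n ⟨_, hm, sq_sqrt_nat a⟩

lemma Ef_le_sqext (a n : ℕ) : Ef a n ≤ sqext (Qf n) (√(a : ℝ)) (sqrt_sq_mem _ a) := by
  have := layer_insert_le ∅ n (√(a : ℝ)) (sqrt_sq_mem _ a)
  exact (layer_mono (by simp) n).trans this

lemma Ef_succ_le (a n : ℕ) : Ef a (n + 1) ≤ sqext (Ef a n) (cc (n + 1)) (cc_sq_mem _ n) := layer_succ_le _ n

lemma cc_notMem_Ef {a : ℕ} (h : NS a) (n : ℕ) : cc (n + 1) ∉ Ef a n := by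
  intro hm
  rcases sq_descent (E := Qf n) (z := 2 + cc n) (sqrt_sq_mem _ a) (h.notMem n)
      (add_mem (two_mem _) (cc_mem_Qf n)) ⟨_, Ef_le_sqext a n hm, cc_succ n⟩ with h1 | h1
  · obtain ⟨w, hw, hw2⟩ := h1
    exact (cc_nonsq n w hw).1 hw2
  · obtain ⟨w, hw, hw2⟩ := h1
    rw [sq_sqrt_nat] at hw2
    rcases n with _ | n
    · obtain ⟨k, rfl⟩ := mem_Qf_zero hw
      rw [cc_zero, add_zero] at hw2
      apply h.2
      rw [← Rat.isSquare_natCast_iff]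
      have : (a : ℚ) * k ^ 2 = 2 := by exact_mod_cast hw2
      exact ⟨a * k, by push_cast; linear_combination (-a : ℚ) * this⟩
    · apply cc_nonsq_rat n a w hw
      exact_mod_cast hw2

lemma sqrt_notMem_Ef {a b : ℕ} (ha : NS a) (hb : NS b) (hab : NS (a * b)) (n : ℕ) : √(b : ℝ) ∉ Ef a n := by
  intro hm
  rcases sq_descent (E := Qf n) (z := b) (sqrt_sq_mem _ a) (ha.notMem n)
      (nat_mem _ _) ⟨_, Ef_le_sqext a n hm, sq_sqrt_nat b⟩ with h1 | h1
  · exact hb.sq n h1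
  · obtain ⟨w, hw, hw2⟩ := h1
    rw [sq_sqrt_nat] at hw2
    exact hab.sq n ⟨a * w, mul_mem (nat_mem _ _) hw, by push_cast; linear_combination a * hw2⟩

theorem quadQ (n : ℕ) : ∃ g, IsQuad (Qf n) (Qf (n + 1)) g ⟨cc (n + 1), cc_mem_Qf _⟩ :=
  sub_conj (E := Qf n) (F := Qf (n + 1)) (cc_sq_mem _ n) _ (Qf_succ_le n) (cc_notMem_Qf n)

theorem quadE {a : ℕ} (h : NS a) (n : ℕ) :
    ∃ g, IsQuad (Ef a n) (Ef a (n + 1)) g ⟨cc (n + 1), cc_mem_Ef _ _⟩ :=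
  sub_conj (E := Ef a n) (F := Ef a (n + 1)) (cc_sq_mem _ n) _ (Ef_succ_le a n) (cc_notMem_Ef h n)

theorem quadQE {a : ℕ} (h : NS a) (n : ℕ) :
    ∃ g, IsQuad (Qf n) (Ef a n) g ⟨√(a : ℝ), sqrt_mem_Ef _ _⟩ :=
  sub_conj (sqrt_sq_mem _ a) _ (Ef_le_sqext a n) (h.notMem n)

theorem quadK {a b : ℕ} (ha : NS a) (hb : NS b) (hab : NS (a * b)) (n : ℕ) :
    ∃ g, IsQuad (Ef a n) (Kf a b n) g ⟨√(b : ℝ), sqrt_mem_Kf' _ _ _⟩ := by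
  refine sub_conj (sqrt_sq_mem _ b) _ ?_ (sqrt_notMem_Ef ha hb hab n)
  have := layer_insert_le {√(a : ℝ)} n (√(b : ℝ)) (sqrt_sq_mem _ b)
  exact (layer_mono (by rw [Set.pair_comm]) n).trans this

theorem quadK' {a b : ℕ} (ha : NS a) (hb : NS b) (hab : NS (a * b)) (n : ℕ) :
    ∃ g, IsQuad (Ef b n) (Kf a b n) g ⟨√(a : ℝ), sqrt_mem_Kf _ _ _⟩ := by
  refine sub_conj (sqrt_sq_mem _ a) _ ?_ (sqrt_notMem_Ef hb ha (by rwa [mul_comm]) n)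
  exact layer_insert_le {√(b : ℝ)} n (√(a : ℝ)) (sqrt_sq_mem _ a)

lemma NS.of_mul_sq {a b : ℕ} (hb : b ≠ 0) (h : NS a) : NS (a * b * b) := by
  have hb' : (b : ℚ) ≠ 0 := by exact_mod_cast hb
  refine ⟨fun hs => h.1 ?_, fun hs => h.2 ?_⟩
  · rw [← Rat.isSquare_natCast_iff] at hs ⊢
    obtain ⟨k, hk⟩ := hs
    exact ⟨k / b, by push_cast at hk; field_simp; linear_combination hk⟩
  · rw [← Rat.isSquare_natCast_iff] at hs ⊢
    obtain ⟨k, hk⟩ := hs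
    exact ⟨k / b, by push_cast at hk ⊢; field_simp; linear_combination hk⟩

theorem quadKm {a b : ℕ} (ha : NS a) (hb : NS b) (hab : NS (a * b)) (n : ℕ) :
    ∃ g, IsQuad (Ef (a * b) n) (Kf a b n) g ⟨√(b : ℝ), sqrt_mem_Kf' _ _ _⟩ := by
  refine sub_conj (sqrt_sq_mem _ b) _ ?_ (sqrt_notMem_Ef hab hb (ha.of_mul_sq hb.ne) n)
  refine layer_le ?_ (le_sqext _ _ _ (cc_mem_Ef _ n))
  have h1 := mem_sqext (Ef (a * b) n) (√(b : ℝ)) (sqrt_sq_mem _ b)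
  rintro x (rfl | rfl)
  · have h2 := le_sqext (Ef (a * b) n) (√(b : ℝ)) (sqrt_sq_mem _ b) (sqrt_mem_Ef (a * b) n)
    have hb0 : √(b : ℝ) ≠ 0 := by
      rw [Real.sqrt_ne_zero']; exact_mod_cast Nat.pos_of_ne_zero hb.ne
    have : √(a : ℝ) = √((a * b : ℕ) : ℝ) / √(b : ℝ) := by
      rw [Nat.cast_mul, Real.sqrt_mul (Nat.cast_nonneg a)]; field_simp
    rw [this]
    exact div_mem h2 h1
  · exact h1

theorem quadF {a : ℕ} (h : NS a) : ∃ g, IsQuad (Ef a 0) (Ef (2 * a) 1) g ⟨cc 1, cc_mem_Ef _ _⟩ := by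
  refine sub_conj (E := Ef a 0) (F := Ef (2 * a) 1) (cc_sq_mem _ 0) _ ?_ (cc_notMem_Ef h 0)
  have h1 := mem_sqext (Ef a 0) (cc 1) (cc_sq_mem _ 0)
  refine layer_le ?_ h1
  rintro x hx
  rw [Set.mem_singleton_iff.1 hx]
  have h2 := le_sqext (Ef a 0) (cc 1) (cc_sq_mem _ 0) (sqrt_mem_Ef a 0)
  have h3 : cc 1 ^ 2 = 2 := by rw [cc_succ, cc_zero, add_zero]
  have h4 : |cc 1| = √2 := by rw [← Real.sqrt_sq_eq_abs, h3]
  have h5 : √2 ∈ sqext (Ef a 0) (cc 1) (cc_sq_mem _ 0) := by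
    rw [← h4]; rcases abs_choice (cc 1) with h | h <;> rw [h]
    · exact h1
    · exact neg_mem h1
  push_cast
  rw [Real.sqrt_mul zero_le_two]
  exact mul_mem h5 h2

lemma finrank_Qf (n : ℕ) : Module.finrank ℚ (Qf n) = 2 ^ n := by
  induction n with
  | zero => rw [Qf_zero]; simp
  | succ k ih =>
    obtain ⟨g, H⟩ := quadQ k
    rw [H.finrank_Q, ih, pow_succ, mul_comm]

/-- integers of a real field from real numbers -/
noncomputable def oR {F : IntermediateField ℚ ℝ} (x : ℝ) (hx : x ∈ F) (hi : IsIntegral ℤ x) : 𝓞 F :=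
  ⟨⟨x, hx⟩, (isIntegral_algebraMap_iff (algebraMap F ℝ).injective).1 (by exact hi)⟩

lemma oR_coe {F : IntermediateField ℚ ℝ} (x : ℝ) (hx : x ∈ F) (hi : IsIntegral ℤ x) :
    ((oR x hx hi : 𝓞 F) : F) = ⟨x, hx⟩ := rfl

lemma oR_ext {F : IntermediateField ℚ ℝ} {x y : 𝓞 F} (h : ((x : F) : ℝ) = ((y : F) : ℝ)) : x = y :=
  RingOfIntegers.ext (Subtype.ext h)

/-- the base field -/
noncomputable def Qf0_equiv : 𝓞 (Qf 0) ≃+* ℤ :=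
  (RingOfIntegers.mapRingEquiv ((IntermediateField.equivOfEq Qf_zero).trans (IntermediateField.botEquiv ℚ ℝ)).toRingEquiv).trans
    Rat.ringOfIntegersEquiv

lemma Qf0_card : Nat.card (ClassGroup (𝓞 (Qf 0))) = 1 := by
  have : IsPrincipalIdealRing (𝓞 (Qf 0)) :=
    IsPrincipalIdealRing.of_surjective Qf0_equiv.symm.toRingHom Qf0_equiv.symm.surjective
  have := (card_classGroup_eq_one_iff (R := 𝓞 (Qf 0))).2 this
  rw [Nat.card_eq_fintype_card]; exact this

lemma Qf0_int (x : 𝓞 (Qf 0)) : ∃ k : ℤ, x = k := by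
  refine ⟨Qf0_equiv x, ?_⟩
  apply Qf0_equiv.injective; simp

lemma Qf0_uniq (p : ℕ) (hp : p.Prime) : UniqAbove (Qf 0) p := by
  have key : ∀ P : Ideal (𝓞 (Qf 0)), P.IsPrime → (p : 𝓞 (Qf 0)) ∈ P → ∀ k : ℤ, (k : 𝓞 (Qf 0)) ∈ P ↔ (p : ℤ) ∣ k := by
    intro P hP hpP k
    constructor
    · intro hk
      by_contra hd
      have hc : IsCoprime (p : ℤ) k := (Nat.prime_iff_prime_int.1 hp).irreducible.coprime_iff_not_dvd.2 hd
      obtain ⟨u, v, huv⟩ := hc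
      apply hP.ne_top
      rw [Ideal.eq_top_iff_one]
      have : (1 : 𝓞 (Qf 0)) = (u : 𝓞 (Qf 0)) * p + v * k := by exact_mod_cast congrArg (Int.cast : ℤ → 𝓞 (Qf 0)) huv.symm
      rw [this]
      exact P.add_mem (P.mul_mem_left _ hpP) (P.mul_mem_left _ hk)
    · rintro ⟨j, rfl⟩
      push_cast
      exact P.mul_mem_right _ hpP
  intro P P' hP hP' h hh2
  ext x
  obtain ⟨k, rfl⟩ := Qf0_int x
  rw [key P hP h, key P' hP' hh2]

noncomputable def toR (F : IntermediateField ℚ ℝ) : 𝓞 F →+* ℝ :=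
  (algebraMap F ℝ).comp (algebraMap (𝓞 F) F)

lemma toR_inj {F : IntermediateField ℚ ℝ} {x y : 𝓞 F} (h : toR F x = toR F y) : x = y :=
  oR_ext h

lemma toR_def {F : IntermediateField ℚ ℝ} (x : 𝓞 F) : toR F x = ((x : F) : ℝ) := rfl

lemma toR_eq {F : IntermediateField ℚ ℝ} (x : F) (y : 𝓞 F) (h : (x : ℝ) = toR F y) : x = (y : F) :=
  Subtype.ext h

@[simp] lemma toR_oR {F : IntermediateField ℚ ℝ} (x : ℝ) (hx : x ∈ F) (hi : IsIntegral ℤ x) :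
    toR F (oR x hx hi) = x := rfl

@[simp] lemma toR_two (F : IntermediateField ℚ ℝ) : toR F 2 = 2 := map_ofNat (toR F) 2

@[simp] lemma toR_alg {E F : IntermediateField ℚ ℝ} [Fact (E ≤ F)] (x : 𝓞 E) :
    toR F (algebraMap (𝓞 E) (𝓞 F) x) = toR E x := rfl

section quad
variable {K L : Type*} [Field K] [NumberField K] [Field L] [NumberField L] [Algebra K L]
  {g : L ≃+* L} {β : L}

lemma oAct_coe (g : L ≃+* L) (x : 𝓞 L) : ((oAct g x : 𝓞 L) : L) = g (x : L) := rfl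

lemma IsQuad.oAct_beta (H : IsQuad K L g β) (o : 𝓞 L) (ho : (o : L) = β) : oAct g o = -o := by
  apply RingOfIntegers.ext
  rw [oAct_coe, ho, H.neg]; simp [ho]

lemma IsQuad.two_mul_mem (H : IsQuad K L g β) {P : Ideal (𝓞 L)} (hP : Inertial g P) (o : 𝓞 L) (ho : (o : L) = β) :
    2 * o ∈ P := by
  have h1 := hP o
  rw [H.oAct_beta o ho] at h1
  convert h1 using 1; ring

lemma IsQuad.tw_triv (H : IsQuad K L g β) (hK : Nat.card (tw (ClassGroup (𝓞 K))) = 1)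
    (h : Nat.card ↥(fixCl g ⊓ tw (ClassGroup (𝓞 L))) ≤ 1) : Nat.card (tw (ClassGroup (𝓞 L))) = 1 := by
  rw [Subgroup.card_eq_one] at hK ⊢
  have h : fixCl g ⊓ tw (ClassGroup (𝓞 L)) = ⊥ := Subgroup.card_eq_one.1 (le_antisymm h Nat.card_pos)
  have h1 : ∀ c ∈ tw (ClassGroup (𝓞 L)), clAct g c = c⁻¹ := by
    intro c hc
    have h2 := H.clExt_clNorm c
    have h3 : clNorm K L c ∈ (⊥ : Subgroup _) := hK ▸ map_tw _ hc
    rw [Subgroup.mem_bot.1 h3, map_one] at h2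
    exact (inv_eq_of_mul_eq_one_right h2.symm).symm
  rw [eq_bot_iff]
  rintro c ⟨k, hk⟩
  rw [Subgroup.mem_bot]
  revert c
  induction k with
  | zero => intro c hk; simpa using hk
  | succ k ih =>
    intro c hk
    have h2 : c ^ 2 = 1 := @ih (c ^ 2) (by rw [← pow_mul, ← pow_succ', hk])
    have h3 : c ∈ tw (ClassGroup (𝓞 L)) := ⟨1, by simpa using h2⟩
    have h4 : c ∈ fixCl g ⊓ tw (ClassGroup (𝓞 L)) := by
      refine ⟨?_, h3⟩
      change c ∈ fixCl g
      rw [mem_fixCl, h1 c h3, inv_eq_iff_mul_eq_one, ← sq, h2]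
    rw [h] at h4; exact h4

lemma IsQuad.neg_of_triv (H : IsQuad K L g β) (hK : Nat.card (tw (ClassGroup (𝓞 K))) = 1)
    {c : ClassGroup (𝓞 L)} (hc : c ∈ tw (ClassGroup (𝓞 L))) : clAct g c = c⁻¹ := by
  rw [Subgroup.card_eq_one] at hK
  have h2 := H.clExt_clNorm c
  have h3 : clNorm K L c ∈ (⊥ : Subgroup _) := hK ▸ map_tw _ hc
  rw [Subgroup.mem_bot.1 h3, map_one] at h2
  exact (inv_eq_of_mul_eq_one_right h2.symm).symm

lemma absNorm_eq {a b : ℕ} (h : a ^ 2 = b ^ 2) : a = b := by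
  exact Nat.pow_left_injective (n := 2) (by norm_num) h

/-- absolute norm of a principal ideal through a quadratic step -/
lemma IsQuad.absNorm_span (H : IsQuad K L g β) (x : 𝓞 L) (y : 𝓞 K)
    (h : (x : L) * g x = algebraMap K L (y : K)) :
    Ideal.absNorm (Ideal.span {x}) = Ideal.absNorm (Ideal.span {y}) := by
  rw [← absNorm_iNm K L, iNm_span]
  congr 3
  apply RingOfIntegers.ext
  apply (algebraMap K L).injective
  rw [intNorm_coe, H.norm_eq, h]
end quad

lemma IsQuad.mul_coe {K L : Type*} [Field K] [NumberField K] [Field L] [NumberField L] [Algebra K L]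
    {g : L ≃+* L} {x : 𝓞 L} {y : 𝓞 K} (x' : 𝓞 L) (hx' : oAct g x = x')
    (h : x * x' = algebraMap (𝓞 K) (𝓞 L) y) : (x : L) * g x = algebraMap K L (y : K) := by
  rw [← oAct_coe, hx', ← coe_algMap, ← h]; simp

section two
variable {F : IntermediateField ℚ ℝ}

noncomputable def occ (F : IntermediateField ℚ ℝ) (n : ℕ) (h : cc n ∈ F) : 𝓞 F := oR (cc n) h (isInt_cc n)

@[simp] lemma toR_occ (n : ℕ) (h : cc n ∈ F) : toR F (occ F n h) = cc n := rfl

lemma cc_desc (n : ℕ) : ∀ m, m ≤ n → cc n ∈ F → cc m ∈ F := by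
  induction n with
  | zero => intro m hm h; rwa [Nat.le_zero.1 hm]
  | succ k ih =>
    intro m hm h
    rcases hm.lt_or_eq with h1 | h1
    · apply ih m (by omega)
      have : cc k = cc (k + 1) ^ 2 - 2 := by rw [cc_succ]; ring
      rw [this]; exact sub_mem (pow_mem h 2) (two_mem F)
    · rwa [h1]

lemma two_of_sub (P : Ideal (𝓞 F)) [P.IsPrime] (n : ℕ) (h : cc n ∈ F) (hP : 2 - occ F n h ∈ P) : (2 : 𝓞 F) ∈ P := by
  induction n with
  | zero =>
    convert hP using 1
    apply toR_inj; simp [cc_zero]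
  | succ k ih =>
    apply ih (cc_desc _ _ (Nat.le_succ k) h)
    have := P.mul_mem_right (2 + occ F (k + 1) h) hP
    convert this using 1
    apply toR_inj; simp; linear_combination cc_succ k

lemma two_of_cc (P : Ideal (𝓞 F)) [hp : P.IsPrime] (n : ℕ) (h : cc (n + 1) ∈ F) (hP : occ F (n + 1) h ∈ P) :
    (2 : 𝓞 F) ∈ P := by
  have hn := cc_desc _ _ (Nat.le_succ n) h
  have h1 := P.mul_mem_left (occ F (n + 1) h * (2 - occ F n hn)) hP
  cases n with
  | zero =>
    have : (2 : 𝓞 F) * 2 ∈ P := by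
      convert h1 using 1
      apply toR_inj; simp [cc_zero]; linear_combination (-2 : ℝ) * cc_succ 0 - 2 * cc_zero
    exact (hp.mem_or_mem this).elim id id
  | succ k =>
    apply two_of_sub P k (cc_desc _ _ (by omega) h)
    convert h1 using 1
    apply toR_inj; simp
    linear_combination (-(2 - cc (k + 1))) * cc_succ (k + 1) + cc_succ k

lemma cc_of_two (P : Ideal (𝓞 F)) [hp : P.IsPrime] (n : ℕ) (h : cc n ∈ F) (hP : (2 : 𝓞 F) ∈ P) :
    occ F n h ∈ P := by
  induction n with
  | zero =>
    have : occ F 0 h = 0 := by apply toR_inj; simp [cc_zero]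
    rw [this]; exact P.zero_mem
  | succ k ih =>
    have hn := cc_desc _ _ (Nat.le_succ k) h
    apply hp.mem_of_pow_mem 2
    have := P.add_mem hP (ih hn)
    convert this using 1
    apply toR_inj; simp [cc_succ]

end two

lemma Qf_two_norm0 : Ideal.absNorm (Ideal.span {2 - occ (Qf 0) 0 (cc_mem_Qf 0)}) = 2 := by
  have : (2 : 𝓞 (Qf 0)) - occ (Qf 0) 0 (cc_mem_Qf 0) = ((2 : ℕ) : 𝓞 (Qf 0)) := by
    apply toR_inj; simp [cc_zero]
  rw [this, Ideal.absNorm_span_natCast, RingOfIntegers.rank, finrank_Qf, pow_zero, pow_one]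

lemma sub_cc_norm {K : IntermediateField ℚ ℝ} [NumberField K] {F : IntermediateField ℚ ℝ} [NumberField F] [Fact (K ≤ F)]
    {g : F ≃+* F} {n : ℕ} {h : cc (n + 1) ∈ F} (h' : cc n ∈ K) (H : IsQuad K F g ⟨cc (n + 1), h⟩) :
    Ideal.absNorm (Ideal.span {2 - occ F (n + 1) h}) = Ideal.absNorm (Ideal.span {2 - occ K n h'}) := by
  apply H.absNorm_span
  refine IsQuad.mul_coe (2 + occ F (n + 1) h) ?_ ?_
  · rw [map_sub, map_ofNat, H.oAct_beta _ rfl, sub_neg_eq_add]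
  · apply toR_inj
    rw [map_mul, toR_alg, map_sub, map_add, map_sub, toR_occ, toR_occ, toR_two, toR_two]
    linear_combination -cc_succ n

lemma Qf_two_norm (n : ℕ) : Ideal.absNorm (Ideal.span {2 - occ (Qf n) n (cc_mem_Qf n)}) = 2 := by
  induction n with
  | zero => exact Qf_two_norm0
  | succ k ih =>
    obtain ⟨g, H⟩ := quadQ k
    exact (sub_cc_norm _ H).trans ih

/-- an ideal of prime norm contained in every prime above 2 -/
lemma uniq_of_norm {K : Type*} [Field K] [NumberField K] {p : ℕ} (hp : p.Prime) (I : Ideal (𝓞 K))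
    (hI : Ideal.absNorm I = p) (h : ∀ P : Ideal (𝓞 K), P.IsPrime → (p : 𝓞 K) ∈ P → I ≤ P) : UniqAbove K p := by
  have hI2 : I.IsMaximal := by
    have h1 : Irreducible I := Ideal.irreducible_of_irreducible_absNorm (by rw [hI]; exact hp)
    have h2 : I ≠ ⊥ := h1.ne_zero
    have h3 : Prime I := h1.prime
    exact (Ideal.isPrime_of_prime h3).isMaximal h2
  intro P P' hP hP' h1 h2
  rw [← hI2.eq_of_le hP.ne_top (h P hP h1), ← hI2.eq_of_le hP'.ne_top (h P' hP' h2)]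

lemma Qf_uniq_two (n : ℕ) : UniqAbove (Qf n) 2 := by
  refine uniq_of_norm Nat.prime_two _ (Qf_two_norm n) ?_
  intro P hP h
  rw [Ideal.span_singleton_le_iff_mem]
  exact P.sub_mem (by exact_mod_cast h) (cc_of_two P n _ (by exact_mod_cast h))

/-- inertia in the cyclotomic tower -/
lemma inert_cc {K : Type*} [Field K] [NumberField K] {F : IntermediateField ℚ ℝ} [NumberField F] [Algebra K F]
    {g : F ≃+* F} {n : ℕ} {h : cc (n + 1) ∈ F} (H : IsQuad K F g ⟨cc (n + 1), h⟩) (P : Ideal (𝓞 F)) [hp : P.IsPrime]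
    (hP : Inertial g P) : ((2 : ℕ) : 𝓞 F) ∈ P := by
  have := H.two_mul_mem hP (occ F (n + 1) h) rfl
  rw [Nat.cast_ofNat]
  exact (hp.mem_or_mem this).elim id (two_of_cc P n h)

/-- cyclotomic step, unique prime above two -/
lemma step_cc {K : Type*} [Field K] [NumberField K] [IsTotallyReal K] {F : IntermediateField ℚ ℝ} [NumberField F] [IsTotallyReal F] [Algebra K F]
    {g : F ≃+* F} {n : ℕ} {h : cc (n + 1) ∈ F} (H : IsQuad K F g ⟨cc (n + 1), h⟩) (hu : UniqAbove K 2) :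
    Nat.card ↥(fixCl g ⊓ tw (ClassGroup (𝓞 F))) ≤ Nat.card (tw (ClassGroup (𝓞 K))) := by
  have := H.chev2a (algebraMap F ℝ) {2} (by simpa using hu)
    (fun P hP _ hI => ⟨2, by simp, inert_cc H P hI⟩)
  rw [Finset.card_singleton] at this; omega

lemma Qf_tw (n : ℕ) : Nat.card (tw (ClassGroup (𝓞 (Qf n)))) = 1 := by
  induction n with
  | zero =>
    have : Nat.card (tw (ClassGroup (𝓞 (Qf 0)))) ∣ 1 := by
      rw [← Qf0_card]; exact Subgroup.card_subgroup_dvd_card _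
    exact Nat.dvd_one.1 this
  | succ k ih =>
    obtain ⟨g, H⟩ := quadQ k
    apply H.tw_triv ih
    exact (step_cc H (Qf_uniq_two k)).trans ih.le

/-- a ramified prime of norm two -/
theorem IsQuad.uniq_two {K L : Type*} [Field K] [NumberField K] [Field L] [NumberField L] [Algebra K L]
    {g : L ≃+* L} {β : L} (H : IsQuad K L g β) (p t k : 𝓞 K) (θ : 𝓞 L)
    (hp : Ideal.absNorm (Ideal.span {p}) = 2)
    (hmem : ∀ P : Ideal (𝓞 L), P.IsPrime → (2 : 𝓞 L) ∈ P → algebraMap (𝓞 K) (𝓞 L) p ∈ P)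
    (ht : θ + oAct g θ = algebraMap (𝓞 K) (𝓞 L) (p * t))
    (hn : θ * oAct g θ = algebraMap (𝓞 K) (𝓞 L) (p + p ^ 2 * k)) :
    (∃ I : Ideal (𝓞 L), Ideal.absNorm I = 2 ∧ I * I = iExt K L (Ideal.span {p})) ∧ UniqAbove L 2 := by
  set f := algebraMap (𝓞 K) (𝓞 L) with hf
  set I : Ideal (𝓞 L) := Ideal.span {f p, θ} with hI
  have hθ : θ * θ = f p * (f t * θ - 1 - f p * f k) := by
    have h1 : oAct g θ = f (p * t) - θ := eq_sub_of_add_eq' ht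
    rw [h1] at hn
    simp only [map_mul, map_add, map_pow] at hn
    linear_combination -hn
  have hII : I * I = Ideal.span {f p} := by
    rw [hI, Ideal.span_mul_span]
    apply le_antisymm
    · rw [Ideal.span_le]
      intro x hx
      rw [SetLike.mem_coe, Ideal.mem_span_singleton]
      obtain ⟨u, hu, v, hv, rfl⟩ := Set.mem_mul.1 hx
      rcases hu with hu | hu <;> rcases hv with hv | hv
      · rw [hu, hv]; exact dvd_mul_right _ _
      · rw [hu, hv]; exact dvd_mul_right _ _
      · rw [hu, hv]; exact dvd_mul_left _ _
      · rw [hu, hv, hθ]; exact dvd_mul_right _ _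
    · rw [Ideal.span_singleton_le_iff_mem, ← Ideal.span_mul_span]
      have m1 : f p ∈ Ideal.span {f p, θ} := Ideal.subset_span (by simp)
      have m2 : θ ∈ Ideal.span {f p, θ} := Ideal.subset_span (by simp)
      have e : f p = f t * (f p * θ) - θ * θ - f k * (f p * f p) := by rw [hθ]; ring
      suffices h : f t * (f p * θ) - θ * θ - f k * (f p * f p) ∈ Ideal.span {f p, θ} * Ideal.span {f p, θ} by
        rwa [← e] at h
      exact Ideal.sub_mem _ (Ideal.sub_mem _ (Ideal.mul_mem_left _ _ (Ideal.mul_mem_mul m1 m2))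
        (Ideal.mul_mem_mul m2 m2)) (Ideal.mul_mem_left _ _ (Ideal.mul_mem_mul m1 m1))
  have hnorm : Ideal.absNorm I = 2 := by
    apply absNorm_eq
    rw [sq, ← map_mul, hII, hf, ← iExt_span, ← absNorm_iNm K L, iNm_iExt, H.finrank, map_pow, hp]
  refine ⟨⟨I, hnorm, by rw [iExt_span]; exact hII⟩, uniq_of_norm Nat.prime_two I hnorm ?_⟩
  intro P hP h2
  have h1 := hmem P hP (by exact_mod_cast h2)
  rw [hI, Ideal.span_le]
  rintro x (rfl | rfl)
  · exact h1
  · have h3 : x * x ∈ P := by rw [hθ]; exact P.mul_mem_right _ h1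
    exact (hP.mem_or_mem h3).elim id id

/-- values `s_{k+1}` -/
noncomputable def ss : ℕ → ℝ
  | 0 => cc 1
  | k + 1 => ss k / cc (k + 2)

lemma cc_ne (n : ℕ) : cc (n + 1) ≠ 0 := fun h => cc_notMem_Qf n (h ▸ zero_mem _)

lemma ss_succ (k : ℕ) : ss (k + 1) * cc (k + 2) = ss k := by
  rw [ss, div_mul_cancel₀ _ (cc_ne _)]

lemma ss_sq (k : ℕ) : ss k ^ 2 = 2 - cc k := by
  induction k with
  | zero => rw [ss, cc_succ, cc_zero]; ring
  | succ k ih =>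
    have h1 := cc_succ (k + 1)
    have h2 := cc_succ k
    have h3 := ss_succ k
    have h4 := pow_ne_zero 2 (cc_ne (k + 1))
    apply mul_right_cancel₀ h4
    rw [← mul_pow, h3, ih, h1]
    linear_combination h2

lemma ss_mem (S : Set ℝ) (k : ℕ) : ss k ∈ layer S (k + 1) := by
  induction k with
  | zero => exact cc_mem_layer _ _
  | succ k ih => exact div_mem (layer_le_succ _ _ ih) (cc_mem_layer _ _)

lemma isInt_quad {t m x : ℝ} (ht : IsIntegral ℤ t) (hm : IsIntegral ℤ m) (h : x ^ 2 - t * x + m = 0) : IsIntegral ℤ x := by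
  have : IsIntegral (integralClosure ℤ ℝ) x := by
    let t' : integralClosure ℤ ℝ := ⟨t, ht⟩
    let m' : integralClosure ℤ ℝ := ⟨m, hm⟩
    refine ⟨Polynomial.X ^ 2 - Polynomial.C t' * Polynomial.X + Polynomial.C m', ?_, ?_⟩
    · monicity!
    · simp only [Polynomial.eval₂_add, Polynomial.eval₂_sub, Polynomial.eval₂_mul, Polynomial.eval₂_pow, Polynomial.eval₂_X, Polynomial.eval₂_C]
      exact h
  exact isIntegral_trans x this

lemma quad_g {E F : IntermediateField ℚ ℝ} [Fact (E ≤ F)] {g : F ≃+* F} {b : ℝ} {hb : b ∈ F}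
    (H : IsQuad E F g ⟨b, hb⟩) {x y z : ℝ} (hx : x ∈ E) (hy : y ∈ E) (hz : z ∈ F) (h : z = x + y * b) :
    ((g ⟨z, hz⟩ : F) : ℝ) = x - y * b := by
  have : (⟨z, hz⟩ : F) = algebraMap E F ⟨x, hx⟩ + algebraMap E F ⟨y, hy⟩ * ⟨b, hb⟩ := by
    apply Subtype.ext; exact h
  rw [this, map_add, map_mul, H.fix, H.fix, H.neg]
  change x + y * (-b) = _
  ring

lemma toR_oAct {F : IntermediateField ℚ ℝ} (g : F ≃+* F) (x : 𝓞 F) : toR F (oAct g x) = ((g (x : F) : F) : ℝ) := rfl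

lemma dvd_two {F : IntermediateField ℚ ℝ} (n : ℕ) (h : cc n ∈ F) : 2 - occ F n h ∣ 2 := by
  induction n with
  | zero =>
    have : 2 - occ F 0 h = 2 := by apply toR_inj; simp [cc_zero]
    rw [this]
  | succ k ih =>
    refine dvd_trans ⟨2 + occ F (k + 1) h, ?_⟩ (ih (cc_desc _ _ (Nat.le_succ k) h))
    apply toR_inj; simp; linear_combination cc_succ k

lemma Ef_two_zero (a : ℕ) (ha : a % 16 = 14) (hNS : NS a) :
    (∃ I : Ideal (𝓞 (Ef a 0)), Ideal.absNorm I = 2 ∧ I * I = Ideal.span {2}) ∧ UniqAbove (Ef a 0) 2 := by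
  obtain ⟨g, H⟩ := quadQE hNS 0
  obtain ⟨k, hk⟩ : ∃ k : ℕ, a = 2 + 4 * k := ⟨(a - 2) / 4, by omega⟩
  have := H.uniq_two 2 0 (-((k + 1 : ℕ) : 𝓞 (Qf 0))) (oR _ (sqrt_mem_Ef a 0) (isInt_sqrt a)) ?_ ?_ ?_ ?_
  · rw [iExt_span, map_ofNat] at this; exact this
  · have h := Qf_two_norm 0
    have : (2 : 𝓞 (Qf 0)) - occ (Qf 0) 0 (cc_mem_Qf 0) = 2 := by
      apply toR_inj; simp [cc_zero]
    rwa [this] at h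
  · intro P hP h; rwa [map_ofNat]
  · rw [H.oAct_beta _ rfl]; simp
  · rw [H.oAct_beta _ rfl]
    apply toR_inj
    rw [toR_alg, map_mul, map_neg, toR_oR, map_add, map_mul, map_pow, map_neg, map_natCast, toR_two]
    have := sq_sqrt_nat a
    rw [hk] at this ⊢
    push_cast at this ⊢
    linear_combination -this

lemma exists_z {N : ℕ} (h : N % 8 = 7) : ∃ z j : ℕ, z ^ 2 * N + 1 = 16 * j := by
  have : N % 16 = 7 ∨ N % 16 = 15 := by omega
  rcases this with h | h
  · exact ⟨3, (9 * N + 1) / 16, by omega⟩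
  · exact ⟨1, (N + 1) / 16, by omega⟩

lemma Ef_uniq_two_succ (N n : ℕ) (hN : N % 8 = 7) (hNS : NS (2 * N)) : UniqAbove (Ef (2 * N) (n + 1)) 2 := by
  obtain ⟨g, H⟩ := quadQE hNS (n + 1)
  obtain ⟨z, j, hz⟩ := exists_z hN
  have hzR : (z : ℝ) ^ 2 * N = 16 * j - 1 := by
    have : ((z ^ 2 * N + 1 : ℕ) : ℝ) = (16 * j : ℕ) := by rw [hz]
    push_cast at this; linear_combination this
  set c := cc (n + 1) with hc
  set s := ss n with hs
  have h1 : cc 1 ^ 2 = 2 := by rw [cc_succ, cc_zero, add_zero]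
  have hc1 : cc 1 ≠ 0 := cc_ne 0
  have hc1m : cc 1 ∈ Qf (n + 1) := cc_mem_of_le _ (by omega)
  have hcm : c ∈ Qf (n + 1) := cc_mem_Qf _
  have hsm : s ∈ Qf (n + 1) := ss_mem _ _
  have hs2 : s ^ 2 = 4 - c ^ 2 := by rw [hs, hc, ss_sq, cc_succ]; ring
  set b := √((2 * N : ℕ) : ℝ) with hb
  have hb2 : b ^ 2 = 2 * N := by rw [hb, sq_sqrt_nat]; push_cast; ring
  set y : ℝ := - (z * s / (2 * cc 1)) with hy
  set x : ℝ := 1 - c / 2 with hx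
  have hym : y ∈ Qf (n + 1) := neg_mem (div_mem (mul_mem (nat_mem _ _) hsm) (mul_mem (two_mem _) hc1m))
  have hxm : x ∈ Qf (n + 1) := sub_mem (one_mem _) (div_mem hcm (two_mem _))
  have hy2 : y ^ 2 * b ^ 2 = (16 * j - 1) * s ^ 2 / 4 := by
    rw [← hzR, hb2, hy, neg_sq, div_pow, mul_pow, mul_pow, h1]; ring
  have hle : Qf (n + 1) ≤ Ef (2 * N) (n + 1) := Fact.out
  have hbm : b ∈ Ef (2 * N) (n + 1) := sqrt_mem_Ef _ _
  have hθm : x + y * b ∈ Ef (2 * N) (n + 1) := add_mem (hle hxm) (mul_mem (hle hym) hbm)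
  have hprod : (x + y * b) * (x - y * b) = (2 - c) - 4 * j * (4 - c ^ 2) := by
    have : (x + y * b) * (x - y * b) = x ^ 2 - y ^ 2 * b ^ 2 := by ring
    rw [this, hy2, hs2, hx]; ring
  have hInt0 : IsIntegral ℤ (x + y * b) := by
    have i2 : IsIntegral ℤ (2 : ℝ) := by exact_mod_cast isIntegral_algebraMap (R := ℤ) (A := ℝ) (x := 2)
    have i4 : IsIntegral ℤ (4 : ℝ) := by exact_mod_cast isIntegral_algebraMap (R := ℤ) (A := ℝ) (x := 4)
    have ij : IsIntegral ℤ (j : ℝ) := by exact_mod_cast isIntegral_algebraMap (R := ℤ) (A := ℝ) (x := j)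
    have ic : IsIntegral ℤ c := isInt_cc _
    refine isInt_quad (t := 2 - c) (m := (2 - c) - 4 * j * (4 - c ^ 2)) (i2.sub ic)
      ((i2.sub ic).sub ((i4.mul ij).mul (i4.sub (ic.pow 2)))) ?_
    rw [← hprod, hx]; ring
  obtain ⟨u, hu⟩ := dvd_two (F := Qf (n + 1)) (n + 1) (cc_mem_Qf _)
  have hu' : 2 = (2 - c) * toR _ u := by
    have := congrArg (toR _) hu
    simpa using this
  have hg : toR _ (oAct g (oR _ hθm hInt0)) = x - y * b := by
    rw [toR_oAct]; exact quad_g H hxm hym hθm rfl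
  refine (H.uniq_two (2 - occ (Qf (n + 1)) (n + 1) (cc_mem_Qf _)) 1 (-(2 * u * (j : 𝓞 (Qf (n + 1))) * (2 + occ (Qf (n + 1)) (n + 1) (cc_mem_Qf _))))
    (oR _ hθm hInt0) (Qf_two_norm _) ?_ ?_ ?_).2
  · intro P hP h
    have e : algebraMap (𝓞 (Qf (n + 1))) (𝓞 (Ef (2 * N) (n + 1))) (2 - occ (Qf (n + 1)) (n + 1) (cc_mem_Qf _)) = 2 - occ (Ef (2 * N) (n + 1)) (n + 1) (cc_mem_Ef _ _) := by
      rw [map_sub, map_ofNat]; rfl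
    rw [e]
    exact P.sub_mem h (cc_of_two P _ _ h)
  · apply toR_inj
    rw [map_add, hg, toR_alg, toR_oR, mul_one, map_sub, toR_occ, toR_two, hx, ← hc]; ring
  · apply toR_inj
    rw [map_mul, hg, toR_alg, toR_oR, hprod]
    rw [map_add, map_mul, map_pow, map_neg, map_mul, map_mul, map_mul, map_add, map_sub, toR_occ, toR_two, map_natCast, ← hc]
    linear_combination (-2 * j * (4 - c^2)) * hu'

lemma Ef_uniq_two (N n : ℕ) (hN : N % 8 = 7) (hNS : NS (2 * N)) : UniqAbove (Ef (2 * N) n) 2 := by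
  cases n with
  | zero => exact (Ef_two_zero (2 * N) (by omega) hNS).2
  | succ k => exact Ef_uniq_two_succ N k hN hNS

lemma leg_two {r : ℕ} [Fact r.Prime] (hr8 : r % 8 = 3) : legendreSym r 2 = -1 := by
  rw [legendreSym.at_two (by rintro rfl; omega)]
  have : (r : ZMod 8) = 3 := by
    have : ((r : ℕ) : ZMod 8) = ((3 : ℕ) : ZMod 8) := by
      rw [ZMod.natCast_eq_natCast_iff]; exact hr8
    exact_mod_cast this
  rw [this]; decide

lemma two_pow_char {k : Type*} [Field k] {r : ℕ} [Fact r.Prime] [CharP k r] (hr8 : r % 8 = 3) :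
    (2 : k) ^ (r / 2) = -1 := by
  have h1 := legendreSym.eq_pow r 2
  rw [leg_two hr8] at h1
  have h2 := congrArg (ZMod.castHom (dvd_refl r) k) h1
  rw [map_pow, map_intCast, map_intCast] at h2
  push_cast at h2
  exact h2.symm

lemma inert_field {k : Type*} [Field k] {r : ℕ} [hr : Fact r.Prime] [CharP k r] (hr8 : r % 8 = 3)
    (u : ℕ → k) (n : ℕ) (h0 : u 0 = 0) (hu : ∀ j < n, u (j + 1) ^ 2 = 2 + u j) (j : ℕ) (hj : j ≤ n) :
    (2 + u j) ^ (r ^ 2 ^ j / 2) = -1 ∧ (2 - u j) ^ (r ^ 2 ^ j / 2) = -1 ∧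
      (j < n → u (j + 1) ^ (r ^ 2 ^ j) = - u (j + 1)) := by
  have hodd : ∀ i, Odd (r ^ 2 ^ i) := fun i => Odd.pow (by rw [Nat.odd_iff]; omega)
  have key : ∀ j, j < n → (2 + u j) ^ (r ^ 2 ^ j / 2) = -1 → u (j + 1) ^ (r ^ 2 ^ j) = - u (j + 1) := by
    intro j hj h
    have h1 : r ^ 2 ^ j = 2 * (r ^ 2 ^ j / 2) + 1 := (Nat.two_mul_div_two_add_one_of_odd (hodd j)).symm
    rw [h1, pow_succ, pow_mul, hu j hj, h]; ring
  induction j with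
  | zero =>
    have h2 := two_pow_char (k := k) hr8
    refine ⟨by simpa [h0] using h2, by simpa [h0] using h2, fun h => key 0 h (by simpa [h0] using h2)⟩
  | succ j ih =>
    obtain ⟨i1, i2, i3⟩ := ih (by omega)
    have i3 := i3 (by omega)
    set Q := r ^ 2 ^ j with hQ
    have hQ2 : r ^ 2 ^ (j + 1) / 2 = (Q + 1) * (Q / 2) := by
      have h1 := Nat.two_mul_div_two_add_one_of_odd (hodd j)
      rw [← hQ] at h1
      have : r ^ 2 ^ (j + 1) = 2 * ((Q + 1) * (Q / 2)) + 1 := by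
        rw [pow_succ 2 j, pow_mul, ← hQ]
        nlinarith
      omega
    have frob : ∀ x y : k, (x + y) ^ Q = x ^ Q + y ^ Q := fun x y => add_pow_char_pow x y r (2 ^ j)
    have frob' : ∀ x y : k, (x - y) ^ Q = x ^ Q - y ^ Q := fun x y => sub_pow_char_pow (p := r) (n := 2 ^ j) x y
    have two : (2 : k) ^ Q = 2 := by
      have h1 : (2 : k) = ((1 : k) + 1) := by norm_num
      rw [h1, frob, one_pow]
    have e := hu j (by omega)
    have p1 : (2 + u (j + 1)) ^ (r ^ 2 ^ (j + 1) / 2) = -1 := by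
      rw [hQ2, pow_mul, pow_succ, frob, two, i3]
      have : (2 + -u (j + 1)) * (2 + u (j + 1)) = 2 - u j := by linear_combination -e
      rw [this, i2]
    have p2 : (2 - u (j + 1)) ^ (r ^ 2 ^ (j + 1) / 2) = -1 := by
      rw [hQ2, pow_mul, pow_succ, frob', two, i3]
      have : (2 - -u (j + 1)) * (2 - u (j + 1)) = 2 - u j := by linear_combination -e
      rw [this, i2]
    exact ⟨p1, p2, fun h => key _ h p1⟩

lemma inert_card {k : Type*} [Field k] [Finite k] {r : ℕ} [hr : Fact r.Prime] [CharP k r] (hr8 : r % 8 = 3)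
    (u : ℕ → k) (n : ℕ) (h0 : u 0 = 0) (hu : ∀ j < n, u (j + 1) ^ 2 = 2 + u j) : r ^ 2 ^ n ≤ Nat.card k := by
  have := Fintype.ofFinite k
  obtain ⟨f, -, hf⟩ := FiniteField.card k r
  rw [Nat.card_eq_fintype_card, hf]
  apply Nat.pow_le_pow_right hr.out.pos
  cases n with
  | zero => rw [pow_zero]; exact f.one_le
  | succ n =>
    obtain ⟨i1, i2, i3⟩ := inert_field hr8 u (n + 1) h0 hu n (by omega)
    have i3 := i3 (by omega)
    have hne : u (n + 1) ≠ 0 := by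
      intro h
      have h4 := hu n (by omega)
      rw [h, zero_pow (by norm_num)] at h4
      rw [← h4, zero_pow] at i1
      · exact one_ne_zero (neg_eq_zero.1 i1.symm)
      · have : r ≤ r ^ 2 ^ n := Nat.le_self_pow (by positivity) r
        omega
    have h2 : (2 : k) ≠ 0 := by
      have := two_pow_char (k := k) hr8
      intro h
      rw [h, zero_pow (by omega)] at this
      exact one_ne_zero (neg_eq_zero.1 this.symm)
    have it : ∀ m, (fun x : k => x ^ r)^[m] = fun x => x ^ r ^ m := fun m => pow_iterate r m
    have hmin : Function.minimalPeriod (fun x : k => x ^ r) (u (n + 1)) = 2 ^ (n + 1) := by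
      apply Function.minimalPeriod_eq_prime_pow
      · intro h
        have : u (n + 1) ^ r ^ 2 ^ n = u (n + 1) := by
          have h' := h
          rw [Function.IsPeriodicPt, Function.IsFixedPt, it] at h'
          exact h'
        rw [i3] at this
        have : 2 * u (n + 1) = 0 := by linear_combination -this
        exact (mul_ne_zero h2 hne) this
      · rw [Function.IsPeriodicPt, Function.IsFixedPt, it]
        change u (n + 1) ^ r ^ 2 ^ (n + 1) = _
        rw [pow_succ 2 n, pow_mul, pow_two (r ^ 2 ^ n), pow_mul, i3, Odd.neg_pow, i3, neg_neg]
        exact Odd.pow (by rw [Nat.odd_iff]; omega)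
    rw [← hmin]
    apply Nat.le_of_dvd f.2
    apply Function.IsPeriodicPt.minimalPeriod_dvd
    rw [Function.IsPeriodicPt, Function.IsFixedPt, it]
    change u (n + 1) ^ r ^ (f : ℕ) = _
    rw [← hf, FiniteField.pow_card]

lemma cc_mem_Qf_le {j n : ℕ} (h : j ≤ n) : cc j ∈ Qf n := cc_mem_of_le _ h

lemma Qf_uniq_r (n r : ℕ) (hr : r.Prime) (hr8 : r % 8 = 3) : UniqAbove (Qf n) r := by
  have : Fact r.Prime := ⟨hr⟩
  have key : ∀ P : Ideal (𝓞 (Qf n)), P.IsPrime → (r : 𝓞 (Qf n)) ∈ P → P = Ideal.span {(r : 𝓞 (Qf n))} := by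
    intro P hP hrP
    have hP0 : P ≠ ⊥ := by
      rintro rfl
      rw [Ideal.mem_bot] at hrP
      exact hr.ne_zero (by exact_mod_cast hrP)
    have hm : P.IsMaximal := hP.isMaximal hP0
    let _ := Ideal.Quotient.field P
    have hfin : Finite (𝓞 (Qf n) ⧸ P) := Ideal.finiteQuotientOfFreeOfNeBot P hP0
    have : CharP (𝓞 (Qf n) ⧸ P) r := by
      rw [CharP.charP_iff_prime_eq_zero hr, ← map_natCast (Ideal.Quotient.mk P)]
      exact Ideal.Quotient.eq_zero_iff_mem.2 hrP
    let u : ℕ → 𝓞 (Qf n) ⧸ P := fun j => if h : j ≤ n then Ideal.Quotient.mk P (occ (Qf n) j (cc_mem_Qf_le h)) else 0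
    have h1 := inert_card (k := 𝓞 (Qf n) ⧸ P) hr8 u n ?_ ?_
    · have h2 : Nat.card (𝓞 (Qf n) ⧸ P) = Ideal.absNorm P := by
        rw [Ideal.absNorm_apply]; rfl
      rw [h2] at h1
      have h3 : Ideal.absNorm (Ideal.span {(r : 𝓞 (Qf n))}) = r ^ 2 ^ n := by
        rw [Ideal.absNorm_span_natCast, RingOfIntegers.rank, finrank_Qf]
      obtain ⟨J, hJ⟩ := Ideal.dvd_iff_le.2 ((Ideal.span_singleton_le_iff_mem _).2 hrP)
      have h4 : Ideal.absNorm P * Ideal.absNorm J = r ^ 2 ^ n := by rw [← map_mul, ← hJ, h3]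
      have h5 : 0 < r ^ 2 ^ n := pow_pos hr.pos _
      have h6 : Ideal.absNorm J = 1 := by
        have : Ideal.absNorm J ≠ 0 := by rintro h; rw [h] at h4; omega
        by_contra hne
        have : 2 ≤ Ideal.absNorm J := by omega
        nlinarith
      rw [hJ, Ideal.absNorm_eq_one_iff.1 h6, Ideal.mul_top]
    · simp only [u, Nat.zero_le, dite_true]
      have : occ (Qf n) 0 (cc_mem_Qf_le (Nat.zero_le n)) = 0 := by apply toR_inj; simp [cc_zero]
      rw [this, map_zero]
    · intro j hj
      simp only [u, hj.le, Nat.succ_le_of_lt hj, dite_true]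
      have : occ (Qf n) (j + 1) (cc_mem_Qf_le hj) ^ 2 = 2 + occ (Qf n) j (cc_mem_Qf_le hj.le) := by
        apply toR_inj; simp [cc_succ]
      rw [← map_pow, this, map_add, map_ofNat]
  intro P P' hP hP' h h'
  rw [key P hP h, key P' hP' h']

lemma genus_int {p : ℕ} [hp : Fact p.Prime] (A D : ℤ) (hA : ¬ (p : ℤ) ∣ A) (hD : (p : ℤ) ∣ D) (hD2 : ¬ (p : ℤ) ^ 2 ∣ D)
    (u v t : ℤ) (ht : t ≠ 0) (h : A * (u ^ 2 - D * v ^ 2) = t ^ 2) : legendreSym p A = 1 := by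
  have hpp : Prime (p : ℤ) := Nat.prime_iff_prime_int.1 hp.out
  induction hn : t.natAbs using Nat.strong_induction_on generalizing u v t with
  | _ n ih =>
    by_cases hpt : (p : ℤ) ∣ t
    · obtain ⟨D0, rfl⟩ := hD
      obtain ⟨t', rfl⟩ := hpt
      have h1 : (p : ℤ) ∣ A * (u ^ 2 - p * D0 * v ^ 2) := by rw [h]; exact ⟨p * t' ^ 2, by ring⟩
      have h2 : (p : ℤ) ∣ u ^ 2 := by
        have := (hpp.dvd_or_dvd h1).resolve_left hA
        have h3 : (p : ℤ) ∣ p * D0 * v ^ 2 := ⟨D0 * v ^ 2, by ring⟩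
        have := dvd_add this h3
        rwa [sub_add_cancel] at this
      obtain ⟨u', rfl⟩ := hpp.dvd_of_dvd_pow h2
      have hp0 : (p : ℤ) ≠ 0 := hpp.ne_zero
      have h4 : A * (p * u' ^ 2 - D0 * v ^ 2) = p * t' ^ 2 := by
        apply mul_left_cancel₀ hp0; linear_combination h
      have h5 : (p : ℤ) ∣ A * D0 * v ^ 2 := ⟨A * u' ^ 2 - t' ^ 2, by linear_combination -h4⟩
      have hD0 : ¬ (p : ℤ) ∣ D0 := by
        rintro ⟨k, rfl⟩; exact hD2 ⟨k, by ring⟩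
      have h6 : (p : ℤ) ∣ v ^ 2 := (hpp.dvd_or_dvd h5).resolve_left
        (fun h => (hpp.dvd_or_dvd h).elim hA hD0)
      obtain ⟨v', rfl⟩ := hpp.dvd_of_dvd_pow h6
      have ht' : t' ≠ 0 := right_ne_zero_of_mul ht
      refine ih t'.natAbs ?_ u' v' t' ht' ?_ rfl
      · rw [← hn, Int.natAbs_mul, Int.natAbs_natCast]
        have := Int.natAbs_pos.2 ht'
        have := hp.out.two_le
        nlinarith
      · have : (p : ℤ) ^ 2 ≠ 0 := pow_ne_zero 2 hp0
        apply mul_left_cancel₀ this; linear_combination h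
    · have hA' : ((A : ℤ) : ZMod p) ≠ 0 := by rwa [Ne, ZMod.intCast_zmod_eq_zero_iff_dvd]
      rw [legendreSym.eq_one_iff p hA']
      have h1 := congrArg (Int.cast : ℤ → ZMod p) h
      have h2 : ((D : ℤ) : ZMod p) = 0 := by rwa [ZMod.intCast_zmod_eq_zero_iff_dvd]
      have h3 : ((t : ℤ) : ZMod p) ≠ 0 := by rwa [Ne, ZMod.intCast_zmod_eq_zero_iff_dvd]
      push_cast at h1
      rw [h2, zero_mul, sub_zero] at h1
      have h4 : ((u : ℤ) : ZMod p) ≠ 0 := by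
        intro h0; rw [h0] at h1; simp at h1; exact h3 (pow_eq_zero_iff (n := 2) (by norm_num) |>.1 h1.symm)
      exact ⟨t / u, by field_simp; exact h1⟩

lemma genus_rat {p : ℕ} [hp : Fact p.Prime] (A D : ℤ) (hA : ¬ (p : ℤ) ∣ A) (hD : (p : ℤ) ∣ D) (hD2 : ¬ (p : ℤ) ^ 2 ∣ D)
    (u v t : ℚ) (ht : t ≠ 0) (h : A * (u ^ 2 - D * v ^ 2) = t ^ 2) : legendreSym p A = 1 := by
  have hu := u.mul_den_eq_num
  have hv := v.mul_den_eq_num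
  have htt := t.mul_den_eq_num
  refine genus_int A D hA hD hD2 (u.num * (v.den * t.den)) (v.num * (u.den * t.den)) (t.num * (u.den * v.den)) ?_ ?_
  · have := u.den_ne_zero; have := v.den_ne_zero
    have := Rat.num_ne_zero.2 ht
    positivity
  · have : ((A * ((u.num * (v.den * t.den)) ^ 2 - D * (v.num * (u.den * t.den)) ^ 2) : ℤ) : ℚ) = ((t.num * (u.den * v.den)) ^ 2 : ℤ) := by
      push_cast
      rw [← hu, ← hv, ← htt]
      linear_combination (u.den * v.den * t.den : ℚ) ^ 2 * h
    exact_mod_cast this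

lemma genus_rat' {p : ℕ} [hp : Fact p.Prime] (A0 D0 : ℤ) (hA : ¬ (p : ℤ) ∣ A0) (hD : ¬ (p : ℤ) ∣ D0)
    (u v t : ℚ) (ht : t ≠ 0) (h : (p * A0 : ℤ) * (u ^ 2 - (p * D0 : ℤ) * v ^ 2) = t ^ 2) : legendreSym p (-A0 * D0) = 1 := by
  have hpp : Prime (p : ℤ) := Nat.prime_iff_prime_int.1 hp.out
  have hp0 : (p : ℚ) ≠ 0 := by exact_mod_cast hp.out.ne_zero
  have hD0 : (D0 : ℚ) ≠ 0 := by
    intro h0; apply hD; have : D0 = 0 := by exact_mod_cast h0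
    rw [this]; exact dvd_zero _
  refine genus_rat (-A0 * D0) (p * D0) ?_ ⟨D0, rfl⟩ ?_ (D0 * v) (u / p) (D0 * t / p) ?_ ?_
  · intro h1; rcases hpp.dvd_or_dvd h1 with h1 | h1
    · exact hA ((dvd_neg).1 h1)
    · exact hD h1
  · rintro ⟨k, hk⟩
    apply hD; refine ⟨k, mul_left_cancel₀ hpp.ne_zero ?_⟩; linear_combination hk
  · positivity
  · push_cast at h ⊢
    field_simp
    linear_combination h

lemma leg_neg_one {p : ℕ} [Fact p.Prime] (h : p % 4 = 3) : legendreSym p (-1) = -1 := by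
  rw [legendreSym.at_neg_one (by rintro rfl; omega), ZMod.χ₄_nat_three_mod_four h]

lemma nonnorm_rat {p : ℕ} [hp : Fact p.Prime] (h4 : p % 4 = 3) (D : ℤ) (hD : (p : ℤ) ∣ D) (hD2 : ¬ (p : ℤ) ^ 2 ∣ D)
    (u v : ℚ) : u ^ 2 - D * v ^ 2 ≠ -1 := by
  intro h
  have h1 := genus_rat (p := p) (-1) D ?_ hD hD2 u v 1 one_ne_zero (by push_cast; linear_combination -h)
  · rw [leg_neg_one h4] at h1; norm_num at h1
  · rw [dvd_neg]; exact (Nat.prime_iff_prime_int.1 hp.out).not_dvd_one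

lemma NS_of {p a b : ℕ} (hp : p.Prime) (hp2 : p ≠ 2) (h : a = p * b) (hb : ¬ p ∣ b) : NS a := by
  have key : ∀ c, ¬ p ∣ c → ¬ IsSquare (p * c) := by
    rintro c hc ⟨k, hk⟩
    have h1 : p ∣ k := by
      have : p ∣ k * k := ⟨c, hk.symm⟩
      exact (hp.dvd_mul.1 this).elim id id
    obtain ⟨j, rfl⟩ := h1
    exact hc ⟨j * j, Nat.eq_of_mul_eq_mul_left hp.pos (by linear_combination hk)⟩
  refine ⟨h ▸ key b hb, ?_⟩
  have : 2 * a = p * (2 * b) := by rw [h]; ring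
  rw [this]
  exact key _ (fun h => (hp.dvd_mul.1 h).elim (fun h => hp2 ((Nat.prime_dvd_prime_iff_eq hp Nat.prime_two).1 h)) hb)

lemma prime_factor_mem {R : Type*} [CommRing R] (P : Ideal R) [hP : P.IsPrime] (N : ℕ) (hN : N ≠ 0) (h : (N : R) ∈ P) :
    ∃ p ∈ N.primeFactors, (p : R) ∈ P := by
  induction N using Nat.strong_induction_on with
  | _ N ih =>
    by_cases h1 : N = 1
    · subst h1; exact absurd ((Ideal.eq_top_iff_one P).2 (by simpa using h)) hP.ne_top
    · have hp := Nat.minFac_prime h1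
      obtain ⟨m, hm⟩ := Nat.minFac_dvd N
      have hm0 : m ≠ 0 := by rintro rfl; omega
      rw [hm, Nat.cast_mul] at h
      rcases hP.mem_or_mem h with h2 | h2
      · exact ⟨_, Nat.mem_primeFactors.2 ⟨hp, Nat.minFac_dvd N, hN⟩, h2⟩
      · obtain ⟨p, hp', h3⟩ := ih m (by have := hp.two_le; rw [hm]; have := Nat.pos_of_ne_zero hm0; nlinarith) hm0 h2
        exact ⟨p, Nat.primeFactors_mono ⟨_, by rw [mul_comm]; exact hm⟩ hN hp', h3⟩

lemma Qf0_coe (x : Qf 0) : ∃ k : ℚ, ((x : Qf 0) : ℝ) = k := by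
  obtain ⟨k, hk⟩ := mem_Qf_zero x.2
  exact ⟨k, hk.symm⟩

/-- the ambiguous class number bound for a real quadratic field -/
lemma chev_base {a p : ℕ} (hNS : NS a) (hp : p.Prime) (hp4 : p % 4 = 3) (hpa : p ∣ a) (hpa2 : ¬ p ^ 2 ∣ a)
    {g : Ef a 0 ≃+* Ef a 0} (H : IsQuad (Qf 0) (Ef a 0) g ⟨√(a : ℝ), sqrt_mem_Ef _ _⟩) :
    4 * Nat.card ↥(fixCl g ⊓ tw (ClassGroup (𝓞 (Ef a 0)))) ≤ 2 ^ (2 * a).primeFactors.card := by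
  have : Fact p.Prime := ⟨hp⟩
  have ha0 := hNS.ne
  have := H.chev2b (algebraMap (Ef a 0) ℝ) (2 * a).primeFactors (fun p hp => Qf0_uniq p (Nat.prime_of_mem_primeFactors hp)) ?_ (-1) ?_
  · rwa [Qf_tw, one_mul] at this
  · intro P hP _ hI
    apply prime_factor_mem P _ (by omega)
    have h1 := H.two_mul_mem hI (oR _ (sqrt_mem_Ef a 0) (isInt_sqrt a)) rfl
    have h2 := P.mul_mem_right (oR _ (sqrt_mem_Ef a 0) (isInt_sqrt a)) h1
    convert h2 using 1
    apply toR_inj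
    have := sq_sqrt_nat a
    rw [map_mul, map_mul, toR_oR, map_natCast, toR_two]
    push_cast; linear_combination -2 * this
  · intro y hy
    obtain ⟨u, v, rfl⟩ := H.rep y
    rw [map_add, map_mul, H.fix, H.fix, H.neg] at hy
    obtain ⟨u', hu⟩ := Qf0_coe u
    obtain ⟨v', hv⟩ := Qf0_coe v
    have h1 := congrArg (fun x : Ef a 0 => (x : ℝ)) hy
    have h2 : ((u : ℝ) + v * √(a : ℝ)) * (u + v * (-√(a : ℝ))) = -1 := by
      have h4 : algebraMap (Qf 0) (Ef a 0) (((-1 : (𝓞 (Qf 0))ˣ) : 𝓞 (Qf 0)) : Qf 0) = -1 := by simp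
      rw [h4] at h1
      exact h1
    rw [hu, hv] at h2
    have h3 : ((u' ^ 2 - (a : ℤ) * v' ^ 2 : ℚ) : ℝ) = ((-1 : ℚ) : ℝ) := by
      push_cast; linear_combination h2 + v' ^ 2 * sq_sqrt_nat a
    refine nonnorm_rat (p := p) hp4 a (by exact_mod_cast hpa) (by exact_mod_cast hpa2) u' v' ?_
    exact_mod_cast h3

lemma unit_cc {F : IntermediateField ℚ ℝ} (n : ℕ) (h : cc n ∈ F) : IsUnit (1 + occ F n h) := by
  induction n with
  | zero =>
    have : 1 + occ F 0 h = 1 := by apply toR_inj; simp [cc_zero]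
    rw [this]; exact isUnit_one
  | succ k ih =>
    have h1 := (ih (cc_desc _ _ (Nat.le_succ k) h)).neg
    refine isUnit_of_mul_isUnit_left (y := 1 - occ F (k + 1) h) ?_
    convert h1 using 1
    apply toR_inj
    simp only [map_mul, map_add, map_sub, map_one, map_neg, toR_occ]
    linear_combination -cc_succ k

lemma nonnorm_step {E F : IntermediateField ℚ ℝ} [Fact (E ≤ F)] {g : F ≃+* F} {b : ℝ} {hb : b ∈ F}
    (H : IsQuad E F g ⟨b, hb⟩) (d : ℕ) (x y : F) (t : ℝ) (t2 : ℝ) (ht : t ∈ E) (ht2 : t2 ∈ E)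
    (h : (x : ℝ) ^ 2 - d * (y : ℝ) ^ 2 = t + t2 * b) :
    ∃ X Y : E, (X : ℝ) ^ 2 - d * (Y : ℝ) ^ 2 = t ^ 2 - t2 ^ 2 * b ^ 2 := by
  obtain ⟨x1, x2, rfl⟩ := H.rep x
  obtain ⟨y1, y2, rfl⟩ := H.rep y
  have e1 : ((x1 : ℝ) + x2 * b) ^ 2 - d * ((y1 : ℝ) + y2 * b) ^ 2 = t + t2 * b := h
  obtain ⟨B, hB⟩ : ∃ B : E, (B : ℝ) = b ^ 2 := by
    obtain ⟨u, v, huv⟩ := H.rep (⟨b, hb⟩ ^ 2)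
    have h1 := congrArg g huv
    rw [map_pow, H.neg, map_add, map_mul, H.fix, H.fix, H.neg, neg_sq, huv] at h1
    have h2 : (u : ℝ) + v * b = u + v * (-b) := congrArg (fun z : F => (z : ℝ)) h1
    have h3 : b ^ 2 = (u : ℝ) + v * b := congrArg (fun z : F => (z : ℝ)) huv
    exact ⟨u, by linear_combination -h3 - h2 / 2⟩
  -- conjugate equation
  have e2 : ((x1 : ℝ) - x2 * b) ^ 2 - d * ((y1 : ℝ) - y2 * b) ^ 2 = t - t2 * b := by
    have e3 : (algebraMap E F x1 + algebraMap E F x2 * ⟨b, hb⟩) ^ 2 - (d : F) * (algebraMap E F y1 + algebraMap E F y2 * ⟨b, hb⟩) ^ 2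
      = algebraMap E F ⟨t, ht⟩ + algebraMap E F ⟨t2, ht2⟩ * ⟨b, hb⟩ := Subtype.ext (by simpa [algOfFact_coe] using e1)
    have e4 := congrArg g e3
    simp only [map_sub, map_add, map_mul, map_pow, map_natCast, H.fix, H.neg] at e4
    have e5 := congrArg (fun z : F => (z : ℝ)) e4
    have e6 : ((x1 : ℝ) + x2 * (-b)) ^ 2 - d * ((y1 : ℝ) + y2 * (-b)) ^ 2 = t + t2 * (-b) := by simpa [algOfFact_coe] using e5
    linear_combination e6
  refine ⟨x1 ^ 2 - B * x2 ^ 2 + d * (y1 ^ 2 - B * y2 ^ 2), (x1 * y1 - B * x2 * y2) + (x1 * y1 - B * x2 * y2), ?_⟩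
  push_cast
  rw [hB]
  linear_combination e1 * (((x1 : ℝ) - x2 * b) ^ 2 - d * ((y1 : ℝ) - y2 * b) ^ 2) + (t + t2 * b) * e2

lemma nonnorm_cc {p : ℕ} [hp : Fact p.Prime] (h4 : p % 4 = 3) (d : ℕ) (hD : p ∣ d) (hD2 : ¬ p ^ 2 ∣ d) (n : ℕ) :
    ∀ x y : Qf n, (x : ℝ) ^ 2 - d * (y : ℝ) ^ 2 ≠ -(1 + cc n) := by
  induction n with
  | zero =>
    intro x y h
    obtain ⟨u, hu⟩ := Qf0_coe x
    obtain ⟨v, hv⟩ := Qf0_coe y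
    refine nonnorm_rat (p := p) h4 d (by exact_mod_cast hD) (by exact_mod_cast hD2) u v ?_
    rw [hu, hv, cc_zero] at h
    have : ((u ^ 2 - (d : ℤ) * v ^ 2 : ℚ) : ℝ) = ((-1 : ℚ) : ℝ) := by push_cast; linear_combination h
    exact_mod_cast this
  | succ k ih =>
    intro x y h
    obtain ⟨g, H⟩ := quadQ k
    obtain ⟨X, Y, h1⟩ := nonnorm_step H d x y (-1) (-1) (neg_mem (one_mem _)) (neg_mem (one_mem _)) (by linear_combination h)
    apply ih X Y
    linear_combination h1 - cc_succ k

structure Hyp (q r s : ℕ) : Prop where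
  hq : q.Prime
  hr : r.Prime
  hs : s.Prime
  hqr : q ≠ r
  hqs : q ≠ s
  hrs : r ≠ s
  hq8 : q % 8 = 7
  hr8 : r % 8 = 3
  hs8 : s % 8 = 3
  h1 : @legendreSym r ⟨hr⟩ (q : ℤ) = -1
  h2 : @legendreSym s ⟨hs⟩ (q : ℤ) = -1
  h3 : @legendreSym r ⟨hr⟩ (s : ℤ) = 1

namespace Hyp
variable {q r s : ℕ} (h : Hyp q r s)
include h

lemma nd {p p' : ℕ} (hp : p.Prime) (hp' : p'.Prime) (hne : p ≠ p') : ¬ p ∣ p' := fun hd => hne ((Nat.prime_dvd_prime_iff_eq hp hp').1 hd)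
lemma q2 : q ≠ 2 := by have := h.hq8; omega
lemma r2 : r ≠ 2 := by have := h.hr8; omega
lemma s2 : s ≠ 2 := by have := h.hs8; omega
lemma q_r : ¬ q ∣ r := h.nd h.hq h.hr h.hqr
lemma q_s : ¬ q ∣ s := h.nd h.hq h.hs h.hqs
lemma r_q : ¬ r ∣ q := h.nd h.hr h.hq h.hqr.symm
lemma r_s : ¬ r ∣ s := h.nd h.hr h.hs h.hrs
lemma s_q : ¬ s ∣ q := h.nd h.hs h.hq h.hqs.symm
lemma s_r : ¬ s ∣ r := h.nd h.hs h.hr h.hrs.symm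
lemma q_2 : ¬ q ∣ 2 := h.nd h.hq Nat.prime_two h.q2
lemma r_2 : ¬ r ∣ 2 := h.nd h.hr Nat.prime_two h.r2
lemma s_2 : ¬ s ∣ 2 := h.nd h.hs Nat.prime_two h.s2

lemma NSk : NS (2 * q) := NS_of h.hq h.q2 (mul_comm _ _) h.q_2
lemma NSM : NS (r * s) := NS_of h.hr h.r2 rfl h.r_s
lemma NSD : NS (2 * q * (r * s)) := by
  refine NS_of h.hr h.r2 (b := 2 * q * s) (by ring) ?_
  rw [h.hr.dvd_mul, h.hr.dvd_mul]
  have := h.r_2; have := h.r_q; have := h.r_s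
  tauto
lemma NSD' : NS (q * (r * s)) := by
  refine NS_of h.hr h.r2 (b := q * s) (by ring) ?_
  rw [h.hr.dvd_mul]
  have := h.r_q; have := h.r_s
  tauto

lemma k_tw0 : Nat.card (tw (ClassGroup (𝓞 (Ef (2 * q) 0)))) = 1 := by
  obtain ⟨g, H⟩ := quadQE h.NSk 0
  refine H.tw_triv (Qf_tw 0) ?_
  have h1 := chev_base h.NSk h.hq (by have := h.hq8; omega) ⟨2, mul_comm _ _⟩ ?_ H
  · have h2 : (2 * (2 * q)).primeFactors = {2, q} := by
      rw [Nat.primeFactors_mul (by norm_num) (by have := h.hq.pos; omega), Nat.primeFactors_mul (by norm_num) h.hq.ne_zero,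
        Nat.prime_two.primeFactors, h.hq.primeFactors]
      ext; simp
    rw [h2, Finset.card_pair h.q2.symm] at h1
    omega
  · rw [sq, mul_comm 2 q]; intro hd
    exact h.q_2 (Nat.dvd_of_mul_dvd_mul_left h.hq.pos hd)

lemma k_tw (n : ℕ) : Nat.card (tw (ClassGroup (𝓞 (Ef (2 * q) n)))) = 1 := by
  induction n with
  | zero => exact h.k_tw0
  | succ k ih =>
    obtain ⟨g, H⟩ := quadE h.NSk k
    refine H.tw_triv ih ?_
    exact (step_cc H (Ef_uniq_two q k h.hq8 h.NSk)).trans ih.le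

lemma rs4 : (r * s) % 8 = 1 := by
  rw [Nat.mul_mod, h.hr8, h.hs8]

lemma isInt_half : IsIntegral ℤ ((1 + √((r * s : ℕ) : ℝ)) / 2) := by
  obtain ⟨k, hk⟩ : ∃ k : ℕ, r * s = 4 * k + 1 := ⟨r * s / 4, by have := h.rs4; omega⟩
  have h1 := sq_sqrt_nat (r * s)
  have h2 : ((r * s : ℕ) : ℝ) = 4 * k + 1 := by rw [hk]; push_cast; ring
  refine isInt_quad (t := 1) (m := -k) isIntegral_one ((isIntegral_algebraMap (R := ℤ) (A := ℝ) (x := (k : ℤ))).neg) ?_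
  linear_combination h1 / 4 + h2 / 4

lemma half_inert {F : IntermediateField ℚ ℝ} [NumberField F] {g : F ≃+* F} {hm : √((r * s : ℕ) : ℝ) ∈ F}
    (hg : g ⟨_, hm⟩ = -⟨_, hm⟩) (P : Ideal (𝓞 F)) [hP : P.IsPrime] (hI : Inertial g P) : (r : 𝓞 F) ∈ P ∨ (s : 𝓞 F) ∈ P := by
  have hz : (1 + √((r * s : ℕ) : ℝ)) / 2 ∈ F := div_mem (add_mem (one_mem _) hm) (two_mem _)
  have h1 := hI (oR _ hz h.isInt_half)
  have h2 : oR _ hz h.isInt_half - oAct g (oR _ hz h.isInt_half) = oR _ hm (isInt_sqrt _) := by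
    apply toR_inj
    rw [map_sub, toR_oAct, toR_oR, toR_oR, oR_coe]
    have h3 : (⟨_, hz⟩ : F) = (1 + ⟨_, hm⟩) / 2 := Subtype.ext rfl
    have h4 : g ⟨_, hz⟩ = (1 - ⟨_, hm⟩) / 2 := by
      rw [h3, map_div₀, map_add, hg, map_one, map_ofNat]; ring
    rw [h4]
    have h5 : (((1 - ⟨_, hm⟩) / 2 : F) : ℝ) = (1 - √((r * s : ℕ) : ℝ)) / 2 := rfl
    rw [h5]; ring
  rw [h2] at h1
  have h6 := P.mul_mem_left (oR _ hm (isInt_sqrt _)) h1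
  have h7 : oR _ hm (isInt_sqrt _) * oR _ hm (isInt_sqrt _) = (r : 𝓞 F) * s := by
    apply toR_inj
    rw [map_mul, map_mul, toR_oR, map_natCast, map_natCast, ← sq, sq_sqrt_nat, Nat.cast_mul]
  rw [h7] at h6
  exact hP.mem_or_mem h6

lemma M_tw (n : ℕ) : Nat.card (tw (ClassGroup (𝓞 (Ef (r * s) n)))) = 1 := by
  obtain ⟨g, H⟩ := quadQE h.NSM n
  refine H.tw_triv (Qf_tw n) ?_
  have hu := (unit_cc n (cc_mem_Qf n)).neg
  have h1 := H.chev2b (algebraMap (Ef (r * s) n) ℝ) {r, s} ?_ ?_ hu.unit ?_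
  · rw [Qf_tw, Finset.card_pair h.hrs] at h1
    omega
  · intro p hp
    rcases Finset.mem_insert.1 hp with rfl | hp
    · exact Qf_uniq_r n _ h.hr h.hr8
    · rw [Finset.mem_singleton.1 hp]; exact Qf_uniq_r n _ h.hs h.hs8
  · intro P hP _ hI
    rcases h.half_inert H.neg P hI with h1 | h1
    · exact ⟨r, by simp, h1⟩
    · exact ⟨s, by simp, h1⟩
  · intro y hy
    obtain ⟨u, v, rfl⟩ := H.rep y
    rw [map_add, map_mul, H.fix, H.fix, H.neg] at hy
    have h1 := congrArg (fun x : Ef (r * s) n => (x : ℝ)) hy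
    have h2 : ((u : ℝ) + v * √((r * s : ℕ) : ℝ)) * (u + v * (-√((r * s : ℕ) : ℝ))) = -(1 + cc n) := h1
    have : Fact r.Prime := ⟨h.hr⟩
    refine nonnorm_cc (p := r) (by have := h.hr8; omega) (r * s) ⟨s, rfl⟩ ?_ n u v ?_
    · rw [sq]; intro hd; exact h.r_s (Nat.dvd_of_mul_dvd_mul_left h.hr.pos hd)
    · linear_combination h2 + (v : ℝ) ^ 2 * sq_sqrt_nat (r * s)

end Hyp

lemma absNorm_int0 (k : ℤ) : Ideal.absNorm (Ideal.span {(k : 𝓞 (Qf 0))}) = k.natAbs := by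
  have h : ∀ m : ℕ, Ideal.absNorm (Ideal.span {(m : 𝓞 (Qf 0))}) = m := fun m => by
    rw [Ideal.absNorm_span_natCast, RingOfIntegers.rank, finrank_Qf, pow_zero, pow_one]
  rcases Int.natAbs_eq k with hk | hk
  · have := h k.natAbs
    rwa [← Int.cast_natCast, ← hk] at this
  · have := h k.natAbs
    rwa [← Int.cast_natCast, ← Ideal.span_singleton_neg, ← Int.cast_neg, ← hk] at this

lemma finrank_Ef0 {a : ℕ} (hNS : NS a) : Module.finrank ℚ (Ef a 0) = 2 := by
  obtain ⟨g, H⟩ := quadQE hNS 0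
  rw [H.finrank_Q, finrank_Qf, pow_zero, mul_one]

lemma norm_form {a : ℕ} (hNS : NS a) (z : 𝓞 (Ef a 0)) :
    ∃ u v : ℚ, ∃ k : ℤ, u ^ 2 - a * v ^ 2 = k ∧ Ideal.absNorm (Ideal.span {z}) = k.natAbs := by
  obtain ⟨g, H⟩ := quadQE hNS 0
  obtain ⟨k, hk⟩ := Qf0_int (Algebra.intNorm (𝓞 (Qf 0)) (𝓞 (Ef a 0)) z)
  have h0 : (z : Ef a 0) * g z = algebraMap (Qf 0) (Ef a 0) ((k : 𝓞 (Qf 0)) : Qf 0) := by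
    rw [← H.norm_eq, ← hk, intNorm_coe]
  have h1 := H.absNorm_span z (k : 𝓞 (Qf 0)) h0
  obtain ⟨u, v, huv⟩ := H.rep (z : Ef a 0)
  obtain ⟨u', hu⟩ := Qf0_coe u
  obtain ⟨v', hv⟩ := Qf0_coe v
  rw [huv, map_add, map_mul, H.fix, H.fix, H.neg] at h0
  have h4 : algebraMap (Qf 0) (Ef a 0) ((k : 𝓞 (Qf 0)) : Qf 0) = (k : Ef a 0) := by simp
  rw [h4] at h0
  have h5 := congrArg (fun x : Ef a 0 => (x : ℝ)) h0
  have h2 : ((u : ℝ) + v * √(a : ℝ)) * (u + v * (-√(a : ℝ))) = ((k : Ef a 0) : ℝ) := h5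
  rw [hu, hv] at h2
  refine ⟨u', v', k, ?_, by rw [h1, absNorm_int0]⟩
  have h3 : ((u' ^ 2 - (a : ℤ) * v' ^ 2 : ℚ) : ℝ) = ((k : ℚ) : ℝ) := by
    push_cast at h2 ⊢; linear_combination h2 + v' ^ 2 * sq_sqrt_nat a
  exact_mod_cast h3

lemma genus_form {a : ℕ} (hNS : NS a) (I : Ideal (𝓞 (Ef a 0))) (hI : I ≠ ⊥) (hc : IsSquare (cls I)) :
    ∃ e : ℤ, (e = 1 ∨ e = -1) ∧ ∃ u v t : ℚ, t ≠ 0 ∧ (e * Ideal.absNorm I : ℤ) * (u ^ 2 - a * v ^ 2) = t ^ 2 := by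
  obtain ⟨c, hc⟩ := hc
  obtain ⟨J, hJ, rfl⟩ := cls_surj c
  rw [← cls_mul hJ hJ, cls_eq_iff hI (mul_ne_zero hJ hJ)] at hc
  obtain ⟨x, y, hx, hy, h⟩ := hc
  have h1 := congrArg Ideal.absNorm h
  simp only [map_mul] at h1
  obtain ⟨u, v, k, hk, hk2⟩ := norm_form hNS (x * y)
  have h2 : Ideal.absNorm (Ideal.span {x * y}) = Ideal.absNorm (Ideal.span {x}) * Ideal.absNorm (Ideal.span {y}) := by
    rw [← Ideal.span_singleton_mul_span_singleton, map_mul]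
  set X := Ideal.absNorm (Ideal.span {x})
  set Y := Ideal.absNorm (Ideal.span {y})
  set N := Ideal.absNorm I
  set T := Ideal.absNorm J
  have hY : Y ≠ 0 := by
    intro h0; rw [Ideal.absNorm_eq_zero_iff] at h0; exact hy (Ideal.span_singleton_eq_bot.1 h0)
  have hT : T ≠ 0 := fun h0 => hJ (Ideal.absNorm_eq_zero_iff.1 h0)
  have key : ∃ e : ℤ, (e = 1 ∨ e = -1) ∧ e * k = k.natAbs := by
    rcases Int.natAbs_eq k with hk | hk
    · exact ⟨1, Or.inl rfl, by omega⟩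
    · exact ⟨-1, Or.inr rfl, by omega⟩
  obtain ⟨e, he, hek⟩ := key
  refine ⟨e, he, u, v, Y * T, mul_ne_zero (by exact_mod_cast hY) (by exact_mod_cast hT), ?_⟩
  rw [hk]
  have h3 : (e * N : ℤ) * k = (Y * T) ^ 2 := by
    have : (e * N : ℤ) * k = N * (X * Y : ℕ) := by rw [← h2, hk2, ← hek]; ring
    rw [this]
    have : ((N * (X * Y) : ℕ) : ℤ) = ((Y * T) ^ 2 : ℕ) := by
      congr 1; calc N * (X * Y) = X * N * Y := by ring
        _ = _ := by rw [h1]; ring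
    push_cast at this ⊢; exact this
  exact_mod_cast h3

theorem genus {a : ℕ} (hNS : NS a) (I : Ideal (𝓞 (Ef a 0))) (hI : I ≠ ⊥) (hc : IsSquare (cls I)) :
    ∃ e : ℤ, (e = 1 ∨ e = -1) ∧ ∀ (p : ℕ) (hp : p.Prime), p ∣ a → ¬ p ^ 2 ∣ a →
      (¬ p ∣ Ideal.absNorm I → @legendreSym p ⟨hp⟩ (e * Ideal.absNorm I) = 1) ∧
      ∀ A0 D0 : ℕ, Ideal.absNorm I = p * A0 → ¬ p ∣ A0 → a = p * D0 → @legendreSym p ⟨hp⟩ (-(e * A0) * D0) = 1 := by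
  obtain ⟨e, he, u, v, t, ht, h⟩ := genus_form hNS I hI hc
  refine ⟨e, he, fun p hp hpa hpa2 => ?_⟩
  have := Fact.mk hp
  have hdvd : ∀ m : ℕ, ¬ p ∣ m → ¬ (p : ℤ) ∣ e * m := by
    intro m hm hd
    apply hm
    rcases he with rfl | rfl
    · rw [one_mul] at hd; exact_mod_cast hd
    · rw [neg_one_mul, dvd_neg] at hd; exact_mod_cast hd
  constructor
  · intro hN
    exact genus_rat (p := p) (e * Ideal.absNorm I) a (hdvd _ hN) (by exact_mod_cast hpa) (by exact_mod_cast hpa2) u v t ht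
      (by push_cast at h ⊢; exact h)
  · intro A0 D0 hA hA0 hD
    refine genus_rat' (p := p) (e * A0) D0 (hdvd _ hA0) ?_ u v t ht ?_
    · intro hd; apply hpa2; rw [hD, sq]; exact mul_dvd_mul_left _ (by exact_mod_cast hd)
    · rw [hA] at h; rw [← h, hD]; push_cast; ring

lemma span_pair_sq {R : Type*} [CommRing R] (p x y α β γ : R) (h : x ^ 2 = p * y) (h1 : α * p + β * x + γ * y = 1) :
    Ideal.span {p, x} * Ideal.span {p, x} = Ideal.span {p} := by
  apply le_antisymm
  · rw [Ideal.span_pair_mul_span_pair, Ideal.span_le]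
    intro z hz
    rw [SetLike.mem_coe, Ideal.mem_span_singleton]
    simp only [Set.mem_insert_iff, Set.mem_singleton_iff] at hz
    rcases hz with rfl | rfl | rfl | rfl
    · exact ⟨_, rfl⟩
    · exact ⟨_, rfl⟩
    · exact ⟨x, by ring⟩
    · exact ⟨y, by rw [← h]; ring⟩
  · rw [Ideal.span_singleton_le_iff_mem]
    have : p = α * (p * p) + β * (p * x) + γ * (x * x) := by
      linear_combination -p * h1 - γ * h
    have hp : p ∈ Ideal.span {p, x} := Ideal.subset_span (by simp)
    have hx : x ∈ Ideal.span {p, x} := Ideal.subset_span (by simp)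
    have h9 := add_mem (add_mem (Ideal.mul_mem_left _ α (Ideal.mul_mem_mul hp hp)) (Ideal.mul_mem_left _ β (Ideal.mul_mem_mul hp hx)))
      (Ideal.mul_mem_left _ γ (Ideal.mul_mem_mul hx hx))
    rwa [← this] at h9

lemma norm_of_sq {a : ℕ} (hNS : NS a) {p : ℕ} (I : Ideal (𝓞 (Ef a 0))) (h : I * I = Ideal.span {(p : 𝓞 (Ef a 0))}) :
    Ideal.absNorm I = p := by
  have := congrArg Ideal.absNorm h
  rw [map_mul, Ideal.absNorm_span_natCast, RingOfIntegers.rank, finrank_Ef0 hNS, ← sq] at this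
  exact absNorm_eq this

lemma ram_ideal {a p D0 : ℕ} (hNS : NS a) (ha : a = p * D0) (hc : p.Coprime D0) :
    ∃ I : Ideal (𝓞 (Ef a 0)), I * I = Ideal.span {(p : 𝓞 (Ef a 0))} ∧ Ideal.absNorm I = p := by
  have h1 : Ideal.span {(p : 𝓞 (Ef a 0)), oR _ (sqrt_mem_Ef a 0) (isInt_sqrt a)} * Ideal.span {(p : 𝓞 (Ef a 0)), oR _ (sqrt_mem_Ef a 0) (isInt_sqrt a)} = Ideal.span {(p : 𝓞 (Ef a 0))} := by
    obtain ⟨α, γ, h⟩ := Nat.isCoprime_iff_coprime.2 hc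
    refine span_pair_sq _ _ (D0 : 𝓞 (Ef a 0)) (α : 𝓞 (Ef a 0)) 0 γ ?_ ?_
    · apply toR_inj
      rw [map_pow, toR_oR, sq_sqrt_nat, map_mul, map_natCast, map_natCast, ha, Nat.cast_mul]
    · rw [zero_mul, add_zero]; exact_mod_cast h
  exact ⟨_, h1, norm_of_sq hNS _ h1⟩

lemma ram_ideal_two {a : ℕ} (hNS : NS a) (ha : a % 4 = 3) :
    ∃ I : Ideal (𝓞 (Ef a 0)), I * I = Ideal.span {((2 : ℕ) : 𝓞 (Ef a 0))} ∧ Ideal.absNorm I = 2 := by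
  obtain ⟨k, hk⟩ : ∃ k, a = 4 * k + 3 := ⟨a / 4, by omega⟩
  let w : 𝓞 (Ef a 0) := oR _ (sqrt_mem_Ef a 0) (isInt_sqrt a)
  have hw : w ^ 2 = 4 * k + 3 := by
    apply toR_inj
    rw [map_pow, toR_oR, sq_sqrt_nat, map_add, map_mul, map_natCast, map_ofNat, map_ofNat]
    exact_mod_cast hk
  have h1 : Ideal.span {((2 : ℕ) : 𝓞 (Ef a 0)), 1 + w} * Ideal.span {((2 : ℕ) : 𝓞 (Ef a 0)), 1 + w} = Ideal.span {((2 : ℕ) : 𝓞 (Ef a 0))} := by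
    refine span_pair_sq _ _ (2 * k + 2 + w) (-k : 𝓞 (Ef a 0)) (-1) 1 ?_ ?_
    · push_cast; linear_combination hw
    · push_cast; ring
  exact ⟨_, h1, norm_of_sq hNS _ h1⟩

lemma gen_of_nonsq {G : Type*} [CommGroup G] [Finite G] (h : Nat.card {x : G // x ^ 2 = 1} ≤ 4) (x y : G)
    (hx : ¬ IsSquare x) (hy : ¬ IsSquare y) (hxy : ¬ IsSquare (x * y)) (g : G) :
    IsSquare g ∨ IsSquare (g * x) ∨ IsSquare (g * y) ∨ IsSquare (g * (x * y)) := by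
  by_contra! hg
  obtain ⟨g1, g2, g3, g4⟩ := hg
  have hidx : (powMonoidHom 2 : G →* G).range.index ≤ 4 := by
    rw [Subgroup.index_range]
    exact h
  have hmem : ∀ z : G, z ∈ (powMonoidHom 2 : G →* G).range ↔ IsSquare z := by
    intro z
    rw [MonoidHom.mem_range, isSquare_iff_exists_sq]
    simp only [powMonoidHom_apply]
    exact ⟨fun ⟨a, b⟩ => ⟨a, b.symm⟩, fun ⟨a, b⟩ => ⟨a, b.symm⟩⟩
  let f : Fin 5 → G ⧸ (powMonoidHom 2 : G →* G).range := ![((1 : G) : G ⧸ _), x, y, ((x * y : G) : G ⧸ _), g]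
  have hinv : ∀ z : G, IsSquare z⁻¹ → IsSquare z := fun z hz => by simpa using hz.inv
  have hf : Function.Injective f := by
    have key : ∀ u v : G, ¬ IsSquare (u * v) → (u : G ⧸ (powMonoidHom 2 : G →* G).range) ≠ v := by
      intro u v huv he
      rw [QuotientGroup.eq, hmem] at he
      apply huv
      have := he.mul (IsSquare.mul_self u)
      rwa [show u⁻¹ * v * (u * u) = u * v by rw [mul_assoc, mul_comm v, ← mul_assoc, ← mul_assoc, inv_mul_cancel, one_mul]] at this
    have k1 := key 1 x (by rwa [one_mul])
    have k2 := key 1 y (by rwa [one_mul])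
    have k3 := key 1 (x * y) (by rwa [one_mul])
    have k4 := key 1 g (by rwa [one_mul])
    have k5 := key x y hxy
    have k6 := key x (x * y) (fun hh => hy (by
      have := hh.mul (IsSquare.mul_self x⁻¹)
      rwa [show x * (x * y) * (x⁻¹ * x⁻¹) = y by rw [mul_comm]; group] at this))
    have k7 := key x g (by rwa [mul_comm])
    have k8 := key y (x * y) (fun hh => hx (by
      have := hh.mul (IsSquare.mul_self y⁻¹)
      rwa [show y * (x * y) * (y⁻¹ * y⁻¹) = x by rw [mul_comm x y, mul_comm]; group] at this))
    have k9 := key y g (by rwa [mul_comm])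
    have k10 := key (x * y) g (by rwa [mul_comm])
    intro i j hij
    fin_cases i <;> fin_cases j <;> first | rfl | (exfalso; simp only [f] at hij; first | exact k1 hij | exact k2 hij | exact k3 hij | exact k4 hij | exact k5 hij | exact k6 hij | exact k7 hij | exact k8 hij | exact k9 hij | exact k10 hij | exact k1 hij.symm | exact k2 hij.symm | exact k3 hij.symm | exact k4 hij.symm | exact k5 hij.symm | exact k6 hij.symm | exact k7 hij.symm | exact k8 hij.symm | exact k9 hij.symm | exact k10 hij.symm)
  have := Nat.card_le_card_of_injective f hf
  rw [Nat.card_fin] at this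
  have h6 : Nat.card (G ⧸ (powMonoidHom 2 : G →* G).range) = (powMonoidHom 2 : G →* G).range.index := rfl
  omega

lemma tors_of_nonsq {G : Type*} [CommGroup G] [Finite G] (h : Nat.card {x : G // x ^ 2 = 1} ≤ 4) (x y : G)
    (hx2 : x ^ 2 = 1) (hy2 : y ^ 2 = 1)
    (hx : ¬ IsSquare x) (hy : ¬ IsSquare y) (hxy : ¬ IsSquare (x * y)) (g : G) (hg : g ^ 2 = 1) :
    g = 1 ∨ g = x ∨ g = y ∨ g = x * y := by
  by_contra! hgn
  obtain ⟨g1, g2, g3, g4⟩ := hgn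
  have hxy2 : (x * y) ^ 2 = 1 := by rw [mul_pow, hx2, hy2, one_mul]
  let f : Fin 5 → {x : G // x ^ 2 = 1} := ![⟨1, one_pow _⟩, ⟨x, hx2⟩, ⟨y, hy2⟩, ⟨x * y, hxy2⟩, ⟨g, hg⟩]
  have k1 : (1 : G) ≠ x := fun e => hx (e ▸ IsSquare.one)
  have k2 : (1 : G) ≠ y := fun e => hy (e ▸ IsSquare.one)
  have k3 : (1 : G) ≠ x * y := fun e => hxy (e ▸ IsSquare.one)
  have k5 : x ≠ y := fun e => hxy (e ▸ IsSquare.mul_self x)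
  have k6 : x ≠ x * y := fun e => k2 (by simpa [eq_comm] using e)
  have k8 : y ≠ x * y := fun e => k1 (by simpa [eq_comm] using e)
  have hf : Function.Injective f := by
    intro i j hij
    have hij : (f i : G) = f j := congrArg Subtype.val hij
    fin_cases i <;> fin_cases j <;> first | rfl | (exfalso; simp only [f] at hij; first | exact k1 hij | exact k2 hij | exact k3 hij | exact g1 hij | exact k5 hij | exact k6 hij | exact g2 hij | exact k8 hij | exact g3 hij | exact g4 hij | exact k1 hij.symm | exact k2 hij.symm | exact k3 hij.symm | exact g1 hij.symm | exact k5 hij.symm | exact k6 hij.symm | exact g2 hij.symm | exact k8 hij.symm | exact g3 hij.symm | exact g4 hij.symm)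
  have := Nat.card_le_card_of_injective f hf
  rw [Nat.card_fin] at this
  omega

lemma tw_of_nonsq {G : Type*} [CommGroup G] [Finite G] (h : Nat.card {x : G // x ^ 2 = 1} ≤ 4) (x y : G)
    (hx2 : x ^ 2 = 1) (hy2 : y ^ 2 = 1)
    (hx : ¬ IsSquare x) (hy : ¬ IsSquare y) (hxy : ¬ IsSquare (x * y)) (g : G) (hg : g ∈ tw G) :
    g = 1 ∨ g = x ∨ g = y ∨ g = x * y := by
  apply tors_of_nonsq h x y hx2 hy2 hx hy hxy
  obtain ⟨k, hk⟩ := mem_tw.1 hg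
  induction k with
  | zero => rw [pow_zero, pow_one] at hk; rw [hk, one_pow]
  | succ k ih =>
    cases k with
    | zero => simpa using hk
    | succ j =>
      apply ih
      have h1 : IsSquare (g ^ 2 ^ (j + 1)) := ⟨g ^ 2 ^ j, by rw [← pow_add]; congr 1; ring⟩
      rcases tors_of_nonsq h x y hx2 hy2 hx hy hxy (g ^ 2 ^ (j + 1)) (by rw [← pow_mul, ← pow_succ]; exact hk) with h2 | h2 | h2 | h2
      · exact h2
      · rw [h2] at h1; exact absurd h1 hx
      · rw [h2] at h1; exact absurd h1 hy
      · rw [h2] at h1; exact absurd h1 hxy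

lemma two_tors {a p : ℕ} (hNS : NS a) (hp : p.Prime) (hp4 : p % 4 = 3) (hpa : p ∣ a) (hpa2 : ¬ p ^ 2 ∣ a)
    (hc : (2 * a).primeFactors.card ≤ 4) : Nat.card {x : ClassGroup (𝓞 (Ef a 0)) // x ^ 2 = 1} ≤ 4 := by
  obtain ⟨g, H⟩ := quadQE hNS 0
  have h1 := chev_base hNS hp hp4 hpa hpa2 H
  have h2 : 2 ^ (2 * a).primeFactors.card ≤ 2 ^ 4 := Nat.pow_le_pow_right (by norm_num) hc
  have h3 : ∀ x : ClassGroup (𝓞 (Ef a 0)), x ^ 2 = 1 → x ∈ fixCl g ⊓ tw (ClassGroup (𝓞 (Ef a 0))) := by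
    intro x hx
    have hx' : x ∈ tw (ClassGroup (𝓞 (Ef a 0))) := mem_tw.2 ⟨1, by simpa using hx⟩
    refine ⟨?_, hx'⟩
    change x ∈ fixCl g
    rw [mem_fixCl, H.neg_of_triv (Qf_tw 0) hx']
    exact inv_eq_of_mul_eq_one_left (by rw [← sq, hx])
  have h4 := Nat.card_le_card_of_injective (fun x : {x : ClassGroup (𝓞 (Ef a 0)) // x ^ 2 = 1} =>
    (⟨x.1, h3 x.1 x.2⟩ : ↥(fixCl g ⊓ tw (ClassGroup (𝓞 (Ef a 0)))))) (fun x y h => Subtype.ext (congrArg (fun z => z.1) h))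
  omega

lemma leg_neg {p : ℕ} [Fact p.Prime] (h : p % 4 = 3) (a : ℤ) : legendreSym p (-a) = -legendreSym p a := by
  rw [neg_eq_neg_one_mul, legendreSym.mul, leg_neg_one h, neg_one_mul]

lemma recip {p q : ℕ} [Fact p.Prime] [Fact q.Prime] (hp : p % 4 = 3) (hq : q % 4 = 3) (_hne : p ≠ q) :
    legendreSym q p = -legendreSym p q := by
  exact legendreSym.quadratic_reciprocity_three_mod_four hp hq

namespace Hyp
variable {q r s : ℕ} (h : Hyp q r s)
include h

lemma q4 : q % 4 = 3 := by have := h.hq8; omega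
lemma r4 : r % 4 = 3 := by have := h.hr8; omega
lemma s4 : s % 4 = 3 := by have := h.hs8; omega

lemma leg_q_r [Fact q.Prime] : legendreSym q r = 1 := by
  have := Fact.mk h.hr
  rw [recip h.r4 h.q4 h.hqr.symm, h.h1, neg_neg]
lemma leg_q_s [Fact q.Prime] : legendreSym q s = 1 := by
  have := Fact.mk h.hs
  rw [recip h.s4 h.q4 h.hqs.symm, h.h2, neg_neg]
lemma leg_q_2 [Fact q.Prime] : legendreSym q 2 = 1 := by
  rw [legendreSym.at_two h.q2]
  have : (q : ZMod 8) = 7 := by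
    have : ((q : ℕ) : ZMod 8) = ((7 : ℕ) : ZMod 8) := by
      rw [ZMod.natCast_eq_natCast_iff]; exact h.hq8
    simpa using this
  rw [this]; decide
lemma leg_r_q [Fact r.Prime] : legendreSym r q = -1 := h.h1
lemma leg_r_s [Fact r.Prime] : legendreSym r s = 1 := h.h3
lemma leg_r_2 [Fact r.Prime] : legendreSym r 2 = -1 := leg_two h.hr8
lemma leg_s_q [Fact s.Prime] : legendreSym s q = -1 := h.h2
lemma leg_s_r [Fact s.Prime] : legendreSym s r = -1 := by
  have := Fact.mk h.hr
  rw [recip h.r4 h.s4 h.hrs, h.h3]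
lemma leg_s_2 [Fact s.Prime] : legendreSym s 2 = -1 := leg_two h.hs8

lemma pf {k : ℕ} (hk : k = 1 ∨ k = 2) : (2 * (k * (q * (r * s)))).primeFactors.card ≤ 4 := by
  have hq0 := h.hq.ne_zero
  have hr0 := h.hr.ne_zero
  have hs0 := h.hs.ne_zero
  have : (2 * (k * (q * (r * s)))).primeFactors ⊆ {2, q, r, s} := by
    intro p hp
    have hpp := Nat.prime_of_mem_primeFactors hp
    have hd := Nat.dvd_of_mem_primeFactors hp
    rw [hpp.dvd_mul, hpp.dvd_mul, hpp.dvd_mul, hpp.dvd_mul] at hd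
    simp only [Finset.mem_insert, Finset.mem_singleton]
    rcases hd with hd | hd | hd | hd | hd
    · exact Or.inl ((Nat.prime_dvd_prime_iff_eq hpp Nat.prime_two).1 hd)
    · rcases hk with rfl | rfl
      · exact absurd (Nat.dvd_one.1 hd) hpp.one_lt.ne'
      · exact Or.inl ((Nat.prime_dvd_prime_iff_eq hpp Nat.prime_two).1 hd)
    · exact Or.inr (Or.inl ((Nat.prime_dvd_prime_iff_eq hpp h.hq).1 hd))
    · exact Or.inr (Or.inr (Or.inl ((Nat.prime_dvd_prime_iff_eq hpp h.hr).1 hd)))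
    · exact Or.inr (Or.inr (Or.inr ((Nat.prime_dvd_prime_iff_eq hpp h.hs).1 hd)))
  exact (Finset.card_le_card this).trans Finset.card_le_four

lemma mul2 {p A B : ℕ} (hp : p.Prime) (hA : ¬ p ∣ A) (hB : ¬ p ∣ B) : ¬ p ∣ A * B := by
  rw [hp.dvd_mul]; tauto

lemma psq {p A B : ℕ} (hp : p.Prime) (hB : ¬ p ∣ B) (hA : A = p * B) : ¬ p ^ 2 ∣ A := by
  rw [hA, sq]; intro hd; exact hB (Nat.dvd_of_mul_dvd_mul_left hp.pos hd)

/-- shape of the two quadratic fields -/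
lemma dq (k : ℕ) (hk : k = 1 ∨ k = 2) : q ∣ k * (q * (r * s)) ∧ ¬ q ^ 2 ∣ k * (q * (r * s)) := by
  refine ⟨⟨k * (r * s), by ring⟩, h.psq h.hq (B := k * (r * s)) ?_ (by ring)⟩
  refine h.mul2 h.hq ?_ (h.mul2 h.hq h.q_r h.q_s)
  rcases hk with rfl | rfl
  · exact h.hq.not_dvd_one
  · exact h.q_2
lemma dr (k : ℕ) (hk : k = 1 ∨ k = 2) : r ∣ k * (q * (r * s)) ∧ ¬ r ^ 2 ∣ k * (q * (r * s)) := by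
  refine ⟨⟨k * (q * s), by ring⟩, h.psq h.hr (B := k * (q * s)) ?_ (by ring)⟩
  refine h.mul2 h.hr ?_ (h.mul2 h.hr h.r_q h.r_s)
  rcases hk with rfl | rfl
  · exact h.hr.not_dvd_one
  · exact h.r_2
lemma ds (k : ℕ) (hk : k = 1 ∨ k = 2) : s ∣ k * (q * (r * s)) ∧ ¬ s ^ 2 ∣ k * (q * (r * s)) := by
  refine ⟨⟨k * (q * r), by ring⟩, h.psq h.hs (B := k * (q * r)) ?_ (by ring)⟩
  refine h.mul2 h.hs ?_ (h.mul2 h.hs h.s_q h.s_r)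
  rcases hk with rfl | rfl
  · exact h.hs.not_dvd_one
  · exact h.s_2

lemma tors0 : Nat.card {x : ClassGroup (𝓞 (Ef (2 * q * (r * s)) 0)) // x ^ 2 = 1} ≤ 4 := by
  have e : 2 * q * (r * s) = 2 * (q * (r * s)) := by ring
  have := h.dq 2 (Or.inr rfl)
  exact two_tors h.NSD h.hq h.q4 (e ▸ this.1) (e ▸ this.2) (e ▸ h.pf (Or.inr rfl))

lemma tors' : Nat.card {x : ClassGroup (𝓞 (Ef (q * (r * s)) 0)) // x ^ 2 = 1} ≤ 4 := by
  have e : 1 * (q * (r * s)) = q * (r * s) := one_mul _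
  have := h.dq 1 (Or.inl rfl)
  exact two_tors h.NSD' h.hq h.q4 (e ▸ this.1) (e ▸ this.2) (e ▸ h.pf (Or.inl rfl))

lemma genus2 {a k : ℕ} (hk : k = 1 ∨ k = 2) (ha : a = k * (q * (r * s))) (hNS : NS a) (I : Ideal (𝓞 (Ef a 0))) (hI : I ≠ ⊥) (hc : IsSquare (cls I)) :
    ∃ e : ℤ, (e = 1 ∨ e = -1) ∧
     (¬ q ∣ Ideal.absNorm I → @legendreSym q ⟨h.hq⟩ (Ideal.absNorm I) = e) ∧
     (¬ r ∣ Ideal.absNorm I → @legendreSym r ⟨h.hr⟩ (Ideal.absNorm I) = e) ∧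
     (¬ s ∣ Ideal.absNorm I → @legendreSym s ⟨h.hs⟩ (Ideal.absNorm I) = e) ∧
     (∀ A0, Ideal.absNorm I = r * A0 → ¬ r ∣ A0 → @legendreSym r ⟨h.hr⟩ (-(e * A0) * (k * (q * s) : ℕ)) = 1) ∧
     (∀ A0, Ideal.absNorm I = s * A0 → ¬ s ∣ A0 → @legendreSym s ⟨h.hs⟩ (-(e * A0) * (k * (q * r) : ℕ)) = 1) := by
  subst ha
  obtain ⟨e, he, H⟩ := genus hNS I hI hc
  have key : ∀ (p : ℕ) [Fact p.Prime] (N : ℕ), p % 4 = 3 → legendreSym p (e * N) = 1 → legendreSym p N = e := by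
    intro p _ N hp4 hl
    rcases he with rfl | rfl
    · rwa [one_mul] at hl
    · rw [neg_one_mul, leg_neg hp4] at hl
      omega
  refine ⟨e, he, fun h1 => ?_, fun h1 => ?_, fun h1 => ?_, fun A0 h1 h2 => ?_, fun A0 h1 h2 => ?_⟩
  · have := Fact.mk h.hq
    exact key q _ h.q4 ((H q h.hq (h.dq k hk).1 (h.dq k hk).2).1 h1)
  · have := Fact.mk h.hr
    exact key r _ h.r4 ((H r h.hr (h.dr k hk).1 (h.dr k hk).2).1 h1)
  · have := Fact.mk h.hs
    exact key s _ h.s4 ((H s h.hs (h.ds k hk).1 (h.ds k hk).2).1 h1)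
  · exact (H r h.hr (h.dr k hk).1 (h.dr k hk).2).2 A0 _ h1 h2 (by ring)
  · exact (H s h.hs (h.ds k hk).1 (h.ds k hk).2).2 A0 _ h1 h2 (by ring)

lemma ne_of_norm {F : Type*} [Field F] [NumberField F] {I : Ideal (𝓞 F)} {N : ℕ} (hN : N ≠ 0) (hI : Ideal.absNorm I = N) : I ≠ ⊥ := by
  rintro rfl; rw [Ideal.absNorm_bot] at hI; exact hN hI.symm

/-- generation of the 2-class group of the auxiliary field -/
theorem A' : ∃ I2 Ir Is : Ideal (𝓞 (Ef (q * (r * s)) 0)), I2 * I2 = Ideal.span {((2 : ℕ) : 𝓞 (Ef (q * (r * s)) 0))} ∧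
    Ir * Ir = Ideal.span {(r : 𝓞 (Ef (q * (r * s)) 0))} ∧ Is * Is = Ideal.span {(s : 𝓞 (Ef (q * (r * s)) 0))} ∧
    (∀ c ∈ tw (ClassGroup (𝓞 (Ef (q * (r * s)) 0))), c = 1 ∨ c = cls I2 ∨ c = cls Ir ∨ c = cls I2 * cls Ir) ∧
    (∀ c ∈ tw (ClassGroup (𝓞 (Ef (q * (r * s)) 0))), c = 1 ∨ c = cls I2 ∨ c = cls Is ∨ c = cls I2 * cls Is) := by
  have fq := Fact.mk h.hq
  have fr := Fact.mk h.hr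
  have fs := Fact.mk h.hs
  have hmod : (q * (r * s)) % 4 = 3 := by
    rw [Nat.mul_mod, h.q4, Nat.mul_mod r s, h.r4, h.s4]
  obtain ⟨I2, h2, n2⟩ := ram_ideal_two h.NSD' hmod
  obtain ⟨Ir, hr, nr⟩ := ram_ideal (p := r) (D0 := q * s) h.NSD' (by ring) ((h.hr.coprime_iff_not_dvd).2 (h.mul2 h.hr h.r_q h.r_s))
  obtain ⟨Is, hs, ns⟩ := ram_ideal (p := s) (D0 := q * r) h.NSD' (by ring) ((h.hs.coprime_iff_not_dvd).2 (h.mul2 h.hs h.s_q h.s_r))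
  have b2 := h.ne_of_norm two_ne_zero n2
  have br := h.ne_of_norm h.hr.ne_zero nr
  have bs := h.ne_of_norm h.hs.ne_zero ns
  have sq1 : ∀ (I : Ideal (𝓞 (Ef (q * (r * s)) 0))) (x : ℕ), x ≠ 0 → I ≠ ⊥ → I * I = Ideal.span {(x : 𝓞 (Ef (q * (r * s)) 0))} → cls I ^ 2 = 1 := by
    intro I x hx hI hh
    rw [sq, ← cls_mul hI hI, hh]
    exact cls_span (by exact_mod_cast hx)
  have G := fun I hI hc => h.genus2 (a := q * (r * s)) (k := 1) (Or.inl rfl) (one_mul _).symm h.NSD' I hI hc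
  have e2 : ¬ IsSquare (cls I2) := by
    intro hc
    obtain ⟨e, he, Gq, Gr, Gs, Hr, Hs⟩ := G I2 b2 hc
    rw [n2] at Gq Gr
    have h1 := Gq h.q_2
    have h2 := Gr h.r_2
    rw [show ((2 : ℕ) : ℤ) = 2 from rfl] at h1 h2
    rw [h.leg_q_2] at h1; rw [h.leg_r_2] at h2; omega
  have er : ¬ IsSquare (cls Ir) := by
    intro hc
    obtain ⟨e, he, Gq, Gr, Gs, Hr, Hs⟩ := G Ir br hc
    rw [nr] at Gq Gs
    have h1 := Gq h.q_r
    have h2 := Gs h.s_r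
    rw [h.leg_q_r] at h1; rw [h.leg_s_r] at h2; omega
  have es : ¬ IsSquare (cls Is) := by
    intro hc
    obtain ⟨e, he, Gq, Gr, Gs, Hr, Hs⟩ := G Is bs hc
    rw [ns] at Gq
    have h1 := Gq h.q_s
    rw [h.leg_q_s] at h1
    have h2 := Hs 1 (by rw [ns, mul_one]) h.hs.not_dvd_one
    rw [← h1] at h2
    push_cast at h2
    rw [legendreSym.mul, legendreSym.mul, legendreSym.mul, leg_neg h.s4, h.leg_s_q, h.leg_s_r, legendreSym.at_one] at h2
    norm_num at h2
  have e2r : ¬ IsSquare (cls I2 * cls Ir) := by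
    rw [← cls_mul b2 br]
    intro hc
    obtain ⟨e, he, Gq, Gr, Gs, Hr, Hs⟩ := G _ (mul_ne_zero b2 br) hc
    rw [map_mul, n2, nr] at Gq Hr
    have h1 := Gq (h.mul2 h.hq h.q_2 h.q_r)
    push_cast at h1
    rw [legendreSym.mul, h.leg_q_2, h.leg_q_r] at h1
    have h2 := Hr 2 (mul_comm _ _) h.r_2
    rw [← h1] at h2
    push_cast at h2
    rw [legendreSym.mul, legendreSym.mul, legendreSym.mul, leg_neg h.r4, h.leg_r_q, h.leg_r_s, h.leg_r_2, legendreSym.at_one] at h2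
    norm_num at h2
  have e2s : ¬ IsSquare (cls I2 * cls Is) := by
    rw [← cls_mul b2 bs]
    intro hc
    obtain ⟨e, he, Gq, Gr, Gs, Hr, Hs⟩ := G _ (mul_ne_zero b2 bs) hc
    rw [map_mul, n2, ns] at Gq Gr
    have h1 := Gq (h.mul2 h.hq h.q_2 h.q_s)
    have h2 := Gr (h.mul2 h.hr h.r_2 h.r_s)
    push_cast at h1 h2
    rw [legendreSym.mul, h.leg_q_2, h.leg_q_s] at h1
    rw [legendreSym.mul, h.leg_r_2, h.leg_r_s] at h2
    omega
  refine ⟨I2, Ir, Is, h2, hr, hs, fun c hc => ?_, fun c hc => ?_⟩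
  · exact tw_of_nonsq h.tors' _ _ (sq1 I2 2 two_ne_zero b2 h2) (sq1 Ir r h.hr.ne_zero br hr) e2 er e2r c hc
  · exact tw_of_nonsq h.tors' _ _ (sq1 I2 2 two_ne_zero b2 h2) (sq1 Is s h.hs.ne_zero bs hs) e2 es e2s c hc

end Hyp

lemma leg_left {p : ℕ} [Fact p.Prime] (d1 d2 x y : ℤ) (hp : (p : ℤ) ∣ d1) (h : d1 * x ^ 2 - d2 * y ^ 2 = 1) :
    legendreSym p (-d2) = 1 := by
  have h1 : legendreSym p (-d2 * (y * y)) = legendreSym p 1 := by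
    obtain ⟨k, rfl⟩ := hp
    rw [legendreSym.mod, show -d2 * (y * y) = 1 + p * (- (k * x ^ 2)) by linear_combination h, Int.add_mul_emod_self_left,
      ← legendreSym.mod]
  rw [legendreSym.mul, legendreSym.mul, legendreSym.at_one] at h1
  have h2 : legendreSym p y * legendreSym p y = 1 := by
    have h3 : legendreSym p y * legendreSym p y ∣ 1 := ⟨_, by rw [mul_comm]; exact h1.symm⟩
    exact Int.eq_one_of_dvd_one (mul_self_nonneg _) h3
  rwa [h2, mul_one] at h1

lemma pell_split {D a b : ℕ} (hD : D % 4 = 2) (hb : 0 < b) (h : a ^ 2 = 1 + D * b ^ 2) :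
    ∃ d1 d2 x y : ℕ, d1 * d2 = D ∧ d1 * x ^ 2 = d2 * y ^ 2 + 1 ∧ a = 2 * (d2 * y ^ 2) + 1 ∧ 0 < y := by
  obtain ⟨k, hk⟩ : ∃ k, D = 4 * k + 2 := ⟨D / 4, by omega⟩
  have ha : a % 2 = 1 := by
    rcases Nat.mod_two_eq_zero_or_one a with h0 | h0
    · exfalso
      obtain ⟨c, rfl⟩ : ∃ c, a = 2 * c := ⟨a / 2, by omega⟩
      have : (2 * c) ^ 2 = 2 * (2 * c ^ 2) := by ring
      have : 1 + D * b ^ 2 = 1 + 2 * ((2 * k + 1) * b ^ 2) := by rw [hk]; ring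
      omega
    · exact h0
  obtain ⟨m, rfl⟩ : ∃ m, a = 2 * m + 1 := ⟨a / 2, by omega⟩
  have hb2 : b % 2 = 0 := by
    rcases Nat.mod_two_eq_zero_or_one b with h0 | h0
    · exact h0
    · exfalso
      obtain ⟨c, rfl⟩ : ∃ c, b = 2 * c + 1 := ⟨b / 2, by omega⟩
      have e1 : (2 * m + 1) ^ 2 = 4 * (m ^ 2 + m) + 1 := by ring
      have e2 : 1 + D * (2 * c + 1) ^ 2 = 4 * (D * (c ^ 2 + c) + k) + 3 := by rw [hk]; ring
      omega
  obtain ⟨c, rfl⟩ : ∃ c, b = 2 * c := ⟨b / 2, by omega⟩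
  have hm : (m + 1) * m = D * c ^ 2 := by nlinarith
  have hcop : Nat.Coprime (m + 1) m := by simp
  have hg : D.gcd (m + 1) * D.gcd m = D := by
    rw [← Nat.Coprime.gcd_mul _ hcop, hm]; simp
  have hc : 0 < c := by omega
  have hm0 : 0 < m := by
    rcases Nat.eq_zero_or_pos m with h0 | h0
    · subst h0; exfalso
      have : 0 < D * c ^ 2 := by have : 0 < D := by omega
                                 positivity
      omega
    · exact h0
  obtain ⟨u, hu⟩ := Nat.gcd_dvd_right D (m + 1)
  obtain ⟨v, hv⟩ := Nat.gcd_dvd_right D m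
  set d1 := D.gcd (m + 1)
  set d2 := D.gcd m
  have huv : u * v = c ^ 2 := by
    have : D * (u * v) = D * c ^ 2 := by
      rw [← hm]; conv_lhs => rw [← hg]
      conv_rhs => rw [hu, hv]
      ring
    exact Nat.eq_of_mul_eq_mul_left (by omega) this
  have hcop2 : IsUnit (gcd u v) := by
    rw [Nat.isUnit_iff]
    exact Nat.Coprime.coprime_dvd_left ⟨d1, by rw [hu]; ring⟩ (Nat.Coprime.coprime_dvd_right ⟨d2, by rw [mul_comm]; exact hv⟩ hcop)
  obtain ⟨x, hx⟩ := exists_eq_pow_of_mul_eq_pow hcop2 huv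
  obtain ⟨y, hy⟩ := exists_eq_pow_of_mul_eq_pow (by rwa [gcd_comm] at hcop2) ((mul_comm _ _).trans huv)
  refine ⟨d1, d2, x, y, hg, ?_, ?_, ?_⟩
  · rw [← hx, ← hy, ← hu, ← hv]
  · rw [← hy, ← hv]
  · rcases Nat.eq_zero_or_pos y with h0 | h0
    · subst h0; rw [hy] at hv; simp at hv; omega
    · exact h0

namespace Hyp
variable {q r s : ℕ} (h : Hyp q r s)
include h

lemma pell {a b : ℕ} (hb : 0 < b) (hP : a ^ 2 = 1 + 2 * q * (r * s) * b ^ 2)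
    (hf : ∀ a' b' : ℕ, 0 < a' → 0 < b' → a' ^ 2 = 1 + 2 * q * (r * s) * b' ^ 2 → a ≤ a')
    (hn : ∀ m y : ℕ, a = 2 * m + 1 → m ≠ q * y ^ 2) :
    (∃ x y : ℕ, s * x ^ 2 = 2 * q * r * y ^ 2 + 1) ∨ (∃ x y : ℕ, 2 * r * x ^ 2 = q * s * y ^ 2 + 1) := by
  have fq := Fact.mk h.hq
  have fr := Fact.mk h.hr
  have fs := Fact.mk h.hs
  have hD4 : (2 * q * (r * s)) % 4 = 2 := by
    rw [Nat.mul_mod, show r * s % 4 = 1 by have := h.rs4; omega, show 2 * q % 4 = 2 by have := h.hq8; omega]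
  obtain ⟨d1, d2, x, y, hd, hxy, ha, hy⟩ := pell_split hD4 hb hP
  have hxyZ : (d1 : ℤ) * x ^ 2 - d2 * y ^ 2 = 1 := by
    have : ((d1 * x ^ 2 : ℕ) : ℤ) = (d2 * y ^ 2 + 1 : ℕ) := by rw [hxy]
    push_cast at this; linarith
  have L1 : ∀ p [Fact p.Prime], p ∣ d1 → legendreSym p (-d2) = 1 := fun p _ hp =>
    leg_left d1 d2 x y (by exact_mod_cast hp) hxyZ
  have L2 : ∀ p [Fact p.Prime], p ∣ d2 → legendreSym p d1 = 1 := fun p _ hp => by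
    have := leg_left (p := p) (-d2) (-d1) y x ((dvd_neg).2 (by exact_mod_cast hp)) (by linarith)
    rwa [neg_neg] at this
  have split : ∀ p c c' : ℕ, p.Prime → c * c' = p → (c = 1 ∧ c' = p) ∨ (c = p ∧ c' = 1) := by
    intro p c c' hp hcc
    rcases (Nat.dvd_prime hp).1 ⟨c', hcc.symm⟩ with rfl | rfl
    · exact Or.inl ⟨rfl, by simpa using hcc⟩
    · exact Or.inr ⟨rfl, Nat.eq_of_mul_eq_mul_left hp.pos (by rw [hcc, mul_one])⟩
  have hd1 : d1 ∣ 2 * q * (r * s) := ⟨d2, hd.symm⟩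
  obtain ⟨A, B, hA, hB, hAB⟩ := Nat.dvd_mul.1 hd1
  obtain ⟨i, j, ⟨i', hi⟩, ⟨j', hj⟩, rfl⟩ := Nat.dvd_mul.1 hA
  obtain ⟨k, l, ⟨k', hk⟩, ⟨l', hl⟩, rfl⟩ := Nat.dvd_mul.1 hB
  subst hAB
  have hd2 : d2 = i' * j' * (k' * l') := by
    have h0 : 0 < i * j * (k * l) := Nat.pos_of_dvd_of_pos hd1 (by have := h.hq.pos; have := h.hr.pos; have := h.hs.pos; positivity)
    apply Nat.eq_of_mul_eq_mul_left h0
    calc _ = _ := hd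
      _ = (i * i') * (j * j') * ((k * k') * (l * l')) := by rw [← hi, ← hj, ← hk, ← hl]
      _ = _ := by ring
  subst hd2
  have sj := split q j j' h.hq hj.symm
  have si := split 2 i i' Nat.prime_two hi.symm
  have sk := split r k k' h.hr hk.symm
  have sl := split s l l' h.hs hl.symm
  clear hd hd1 hA hB hi hj hk hl split
  have nq := leg_neg (p := q) h.q4
  have nr := leg_neg (p := r) h.r4
  have ns := leg_neg (p := s) h.s4
  have t1 := h.leg_q_2
  have t2 := h.leg_q_r
  have t3 := h.leg_q_s
  have t4 := h.leg_r_2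
  have t5 := h.leg_r_q
  have t6 := h.leg_r_s
  have t7 := h.leg_s_2
  have t8 := h.leg_s_q
  have t9 := h.leg_s_r
  rcases sj with ⟨rfl, rfl⟩ | ⟨rfl, rfl⟩
  · rcases sk with ⟨rfl, rfl⟩ | ⟨rfl, rfl⟩
    · -- r divides d2, so 2 divides d2
      have m1 := L2 k' ⟨i' * j' * l', by ring⟩
      rcases si with ⟨rfl, rfl⟩ | ⟨rfl, rfl⟩
      · rcases sl with ⟨rfl, rfl⟩ | ⟨rfl, rfl⟩
        · exfalso
          have hx : 0 < x := by
            rcases Nat.eq_zero_or_pos x with h0 | h0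
            · subst h0; simp at hxy
            · exact h0
          have h7 := hf x y hx hy (by linarith)
          have hT : 0 < 2 * j' * (k' * l') * y ^ 2 := by
            have := h.hq.pos; have := h.hr.pos; have := h.hs.pos; positivity
          generalize hTT : 2 * j' * (k' * l') * y ^ 2 = T at *
          have h8 : T + T + 1 ≤ x := by linarith
          have h9 := Nat.mul_le_mul h8 h8
          nlinarith
        · exact Or.inl ⟨x, y, by linarith⟩
      · exfalso
        rcases sl with ⟨rfl, rfl⟩ | ⟨rfl, rfl⟩ <;> push_cast at m1 <;> simp [legendreSym.mul, *] at m1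
    · have m1 := L1 k ⟨i * 1 * l, by ring⟩
      rcases si with ⟨rfl, rfl⟩ | ⟨rfl, rfl⟩
      · exfalso
        rcases sl with ⟨rfl, rfl⟩ | ⟨rfl, rfl⟩ <;> push_cast at m1 <;> simp [legendreSym.mul, *] at m1
      · rcases sl with ⟨rfl, rfl⟩ | ⟨rfl, rfl⟩
        · exact Or.inr ⟨x, y, by linarith⟩
        · exact absurd (by ring) (hn _ y ha)
  · exfalso
    have m1 := L1 j ⟨i * (k * l), by ring⟩
    rcases si with ⟨rfl, rfl⟩ | ⟨rfl, rfl⟩ <;> rcases sk with ⟨rfl, rfl⟩ | ⟨rfl, rfl⟩ <;> rcases sl with ⟨rfl, rfl⟩ | ⟨rfl, rfl⟩ <;>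
      push_cast at m1 <;> simp [legendreSym.mul, *] at m1

end Hyp

lemma layer_aut_ext {S : Set ℝ} {n : ℕ} (g1 g2 : layer S n ≃+* layer S n)
    (h : ∀ x (hx : x ∈ layer S n), x ∈ S ∪ {cc n} → g1 ⟨x, hx⟩ = g2 ⟨x, hx⟩) : g1 = g2 := by
  have key : ∀ x (hx : x ∈ IntermediateField.adjoin ℚ (S ∪ {cc n})),
      (g1 : layer S n →+* layer S n) ⟨x, hx⟩ = (g2 : layer S n →+* layer S n) ⟨x, hx⟩ := by
    intro x hx
    induction hx using IntermediateField.adjoin_induction with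
    | mem x hx => exact h x _ hx
    | algebraMap x =>
      exact (map_ratCast (g1 : layer S n →+* layer S n) x).trans (map_ratCast (g2 : layer S n →+* layer S n) x).symm
    | add x y hx hy ihx ihy =>
      have := congrArg₂ (· + ·) ihx ihy
      simp only [← map_add] at this
      exact this
    | inv x hx ih =>
      have := congrArg (·⁻¹) ih
      simp only [← map_inv₀] at this
      exact this
    | mul x y hx hy ihx ihy =>
      have := congrArg₂ (· * ·) ihx ihy
      simp only [← map_mul] at this
      exact this
  ext ⟨x, hx⟩
  exact congrArg _ (key x hx)

lemma Ef_aut_ext {a n : ℕ} (g1 g2 : Ef a n ≃+* Ef a n)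
    (hs : g1 ⟨√(a : ℝ), sqrt_mem_Ef a n⟩ = g2 ⟨√(a : ℝ), sqrt_mem_Ef a n⟩)
    (hc : g1 ⟨cc n, cc_mem_Ef a n⟩ = g2 ⟨cc n, cc_mem_Ef a n⟩) : g1 = g2 := by
  refine layer_aut_ext (S := {√(a : ℝ)}) (n := n) g1 g2 ?_
  rintro x hx (rfl | rfl)
  · exact hs
  · exact hc

lemma Kf_aut_ext {a b n : ℕ} (g1 g2 : Kf a b n ≃+* Kf a b n)
    (hs : g1 ⟨√(a : ℝ), sqrt_mem_Kf a b n⟩ = g2 ⟨√(a : ℝ), sqrt_mem_Kf a b n⟩)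
    (hs' : g1 ⟨√(b : ℝ), sqrt_mem_Kf' a b n⟩ = g2 ⟨√(b : ℝ), sqrt_mem_Kf' a b n⟩)
    (hc : g1 ⟨cc n, cc_mem_Kf a b n⟩ = g2 ⟨cc n, cc_mem_Kf a b n⟩) : g1 = g2 := by
  refine layer_aut_ext (S := {√(a : ℝ), √(b : ℝ)}) (n := n) g1 g2 ?_
  rintro x hx ((rfl | rfl) | rfl)
  · exact hs
  · exact hs'
  · exact hc

lemma ideal_sq_inj {R : Type*} [CommRing R] [IsDedekindDomain R] {I J : Ideal R} (h : I * I = J * J) : I = J := by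
  rw [← sq, ← sq] at h
  apply le_antisymm
  · exact Ideal.dvd_iff_le.1 ((UniqueFactorizationMonoid.pow_dvd_pow_iff_dvd two_ne_zero).1 h.symm.dvd)
  · exact Ideal.dvd_iff_le.1 ((UniqueFactorizationMonoid.pow_dvd_pow_iff_dvd two_ne_zero).1 h.dvd)

lemma capit_of {E L : Type*} [Field E] [NumberField E] [Field L] [NumberField L] [Algebra E L]
    {I : Ideal (𝓞 E)} {k : ℕ} (hk : k ≠ 0) (hI : I * I = Ideal.span {(k : 𝓞 E)}) (α u v : 𝓞 L)
    (h : α ^ 2 = k * u) (huv : u * v = 1) : clExt E L (cls I) = 1 := by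
  have hk' : ((k : ℕ) : 𝓞 E) ≠ 0 := by exact_mod_cast hk
  have hk2 : ((k : ℕ) : 𝓞 L) ≠ 0 := by exact_mod_cast hk
  have hI0 : I ≠ ⊥ := by
    rintro rfl
    rw [Ideal.mul_bot, eq_comm, Ideal.span_singleton_eq_bot] at hI
    exact hk' hI
  have hu : IsUnit u := IsUnit.of_mul_eq_one v huv
  have hα : α ≠ 0 := by
    rintro rfl
    rw [zero_pow two_ne_zero] at h
    exact mul_ne_zero hk2 hu.ne_zero h.symm
  rw [clExt_cls E L hI0]
  rw [cls_eq_one_iff (iExt_ne E L hI0)]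
  refine ⟨α, hα, ideal_sq_inj ?_⟩
  rw [← map_mul, hI, iExt_span, map_natCast, Ideal.span_singleton_mul_span_singleton, ← sq, h]
  rw [Ideal.span_singleton_mul_right_unit hu]

namespace Hyp
variable {q r s : ℕ} (h : Hyp q r s)
include h

lemma capit (hp : (∃ x y : ℕ, s * x ^ 2 = 2 * q * r * y ^ 2 + 1) ∨ (∃ x y : ℕ, 2 * r * x ^ 2 = q * s * y ^ 2 + 1))
    (c : ClassGroup (𝓞 (Ef (q * (r * s)) 0))) (hc : c ∈ tw (ClassGroup (𝓞 (Ef (q * (r * s)) 0)))) :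
    clExt (Ef (q * (r * s)) 0) (Ef (2 * (q * (r * s))) 1) c = 1 := by
  obtain ⟨I2, Ir, Is, h2, hr, hs, G1, G2⟩ := h.A'
  set L := Ef (2 * (q * (r * s))) 1 with hL
  let W : 𝓞 L := oR (√((2 * (q * (r * s)) : ℕ) : ℝ)) (sqrt_mem_Ef _ _) (isInt_sqrt _)
  have hW : W ^ 2 = 2 * (q * (r * s)) := by
    apply toR_inj
    rw [map_pow, toR_oR, sq_sqrt_nat]
    simp
  have c2 : clExt (Ef (q * (r * s)) 0) L (cls I2) = 1 := by
    refine capit_of two_ne_zero h2 (occ L 1 (cc_mem_Ef _ _)) 1 1 ?_ (mul_one 1)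
    apply toR_inj
    rw [map_pow, toR_occ, cc_succ, cc_zero]
    simp
  rcases hp with ⟨x, y, hxy⟩ | ⟨x, y, hxy⟩
  · have e : (s : 𝓞 L) * x ^ 2 = 2 * q * r * y ^ 2 + 1 := by exact_mod_cast congrArg (Nat.cast (R := 𝓞 L)) hxy
    have cs : clExt (Ef (q * (r * s)) 0) L (cls Is) = 1 := by
      refine capit_of h.hs.ne_zero hs (s * x + y * W) (s * x ^ 2 + 2 * q * r * y ^ 2 + 2 * x * y * W)
        (s * x ^ 2 + 2 * q * r * y ^ 2 - 2 * x * y * W) ?_ ?_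
      · linear_combination (y : 𝓞 L) ^ 2 * hW
      · linear_combination (-4 * (x : 𝓞 L) ^ 2 * y ^ 2) * hW + ((s : 𝓞 L) * x ^ 2 - 2 * q * r * y ^ 2 + 1) * e
    rcases G2 c hc with rfl | rfl | rfl | rfl
    · exact map_one _
    · exact c2
    · exact cs
    · exact (map_mul _ _ _).trans ((congrArg₂ (· * ·) c2 cs).trans (mul_one 1))
  · have e : 2 * (r : 𝓞 L) * x ^ 2 = q * s * y ^ 2 + 1 := by exact_mod_cast congrArg (Nat.cast (R := 𝓞 L)) hxy
    have cr : clExt (Ef (q * (r * s)) 0) L (cls (I2 * Ir)) = 1 := by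
      refine capit_of (k := 2 * r) (by simp [h.hr.ne_zero]) ?_ (2 * r * x + y * W) (2 * r * x ^ 2 + q * s * y ^ 2 + 2 * x * y * W)
        (2 * r * x ^ 2 + q * s * y ^ 2 - 2 * x * y * W) ?_ ?_
      · rw [mul_mul_mul_comm, h2, hr, Ideal.span_singleton_mul_span_singleton]; push_cast; rfl
      · push_cast; linear_combination (y : 𝓞 L) ^ 2 * hW
      · linear_combination (-4 * (x : 𝓞 L) ^ 2 * y ^ 2) * hW + (2 * (r : 𝓞 L) * x ^ 2 - q * s * y ^ 2 + 1) * e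
    have n2 : I2 ≠ ⊥ := by
      rintro rfl
      rw [Ideal.mul_bot, eq_comm, Ideal.span_singleton_eq_bot] at h2
      exact two_ne_zero (by exact_mod_cast h2 : (2 : 𝓞 (Ef (q * (r * s)) 0)) = 0)
    have nr : Ir ≠ ⊥ := by
      rintro rfl
      rw [Ideal.mul_bot, eq_comm, Ideal.span_singleton_eq_bot] at hr
      exact h.hr.ne_zero (by exact_mod_cast hr)
    rw [cls_mul n2 nr, map_mul, c2, one_mul] at cr
    rcases G1 c hc with rfl | rfl | rfl | rfl
    · exact map_one _
    · exact c2
    · exact cr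
    · exact (map_mul _ _ _).trans ((congrArg₂ (· * ·) c2 cr).trans (mul_one 1))

lemma first (hp : (∃ x y : ℕ, s * x ^ 2 = 2 * q * r * y ^ 2 + 1) ∨ (∃ x y : ℕ, 2 * r * x ^ 2 = q * s * y ^ 2 + 1))
    {d : ℕ} (hd : d = 2 * (q * (r * s))) {γ} (Hγ : IsQuad (Ef d 0) (Ef d 1) γ ⟨cc 1, cc_mem_Ef _ _⟩)
    {c : ClassGroup (𝓞 (Ef d 1))} (hc : c ∈ tw (ClassGroup (𝓞 (Ef d 1)))) : clAct γ c = c := by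
  subst hd
  obtain ⟨g, Hg⟩ := quadF h.NSD'
  have hNS : NS (2 * (q * (r * s))) := by have := h.NSD; rwa [mul_assoc] at this
  obtain ⟨τ, Hτ⟩ := quadQE hNS 1
  have e1 : clAct g c = c⁻¹ := by
    have := Hg.clExt_clNorm c
    rw [h.capit hp _ (map_tw _ hc)] at this
    exact (inv_eq_of_mul_eq_one_right this.symm).symm
  have e2 := Hτ.neg_of_triv (Qf_tw 1) hc
  have e3 : γ = τ.trans g := by
    apply Ef_aut_ext
    · have hx := sqrt_mem_Ef (2 * (q * (r * s))) 1
      have a1 : γ ⟨√((2 * (q * (r * s)) : ℕ) : ℝ), hx⟩ = ⟨√((2 * (q * (r * s)) : ℕ) : ℝ), hx⟩ :=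
        Hγ.fix ⟨√((2 * (q * (r * s)) : ℕ) : ℝ), sqrt_mem_Ef _ _⟩
      have a2 : τ ⟨√((2 * (q * (r * s)) : ℕ) : ℝ), hx⟩ = -⟨√((2 * (q * (r * s)) : ℕ) : ℝ), hx⟩ := Hτ.neg
      have a3 : √((2 * (q * (r * s)) : ℕ) : ℝ) * cc 1 ∈ Ef (q * (r * s)) 0 := by
        have : (√((2 * (q * (r * s)) : ℕ) : ℝ) * cc 1) ^ 2 = (2 * √((q * (r * s) : ℕ) : ℝ)) ^ 2 := by
          rw [mul_pow, mul_pow, sq_sqrt_nat, sq_sqrt_nat, cc_succ, cc_zero]; push_cast; ring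
        have a4 : 2 * √((q * (r * s) : ℕ) : ℝ) ∈ Ef (q * (r * s)) 0 := mul_mem (two_mem _) (sqrt_mem_Ef _ _)
        rcases sq_eq_sq_iff_eq_or_eq_neg.1 this with h | h <;> rw [h]
        · exact a4
        · exact neg_mem a4
      have a5 := Hg.fix ⟨_, a3⟩
      have a6 : algebraMap (Ef (q * (r * s)) 0) (Ef (2 * (q * (r * s))) 1) ⟨_, a3⟩ =
        ⟨√((2 * (q * (r * s)) : ℕ) : ℝ), hx⟩ * ⟨cc 1, cc_mem_Ef _ _⟩ := rfl
      rw [a6, map_mul, Hg.neg, mul_neg, ← neg_mul] at a5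
      have a7 := mul_right_cancel₀ Hg.ne a5
      refine a1.trans ?_
      refine Eq.trans ?_ (congrArg g a2.symm)
      rw [map_neg]; exact a7.symm
    · have hx := cc_mem_Ef (2 * (q * (r * s))) 1
      have a1 : γ ⟨cc 1, hx⟩ = -⟨cc 1, hx⟩ := Hγ.neg
      have a2 : τ ⟨cc 1, hx⟩ = ⟨cc 1, hx⟩ := Hτ.fix ⟨cc 1, cc_mem_Qf _⟩
      have a3 : g ⟨cc 1, hx⟩ = -⟨cc 1, hx⟩ := Hg.neg
      exact a1.trans (a3.symm.trans (congrArg g a2.symm))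
  rw [e3, ← clAct_clAct, e2, map_inv, e1, inv_inv]

end Hyp

lemma int_mem_iff {K : Type*} [Field K] [NumberField K] {I : Ideal (𝓞 K)} {l : ℕ} (hl : l.Prime) (hI : Ideal.absNorm I = l) (m : ℤ) :
    (m : 𝓞 K) ∈ I ↔ (l : ℤ) ∣ m := by
  have hlI : ((l : ℤ) : 𝓞 K) ∈ I := by
    have := Ideal.absNorm_mem I
    rw [hI] at this; exact_mod_cast this
  constructor
  · intro hm
    by_contra hd
    obtain ⟨u, v, huv⟩ := (Nat.prime_iff_prime_int.1 hl).coprime_iff_not_dvd.2 hd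
    have : (1 : 𝓞 K) ∈ I := by
      have h2 := I.add_mem (I.mul_mem_left (u : 𝓞 K) hlI) (I.mul_mem_left (v : 𝓞 K) hm)
      have h3 : (u : 𝓞 K) * ((l : ℤ) : 𝓞 K) + v * m = 1 := by exact_mod_cast congrArg (Int.cast (R := 𝓞 K)) huv
      rwa [h3] at h2
    rw [(Ideal.eq_top_iff_one I).2 this, Ideal.absNorm_top] at hI
    exact hl.one_lt.ne hI
  · rintro ⟨k, rfl⟩
    rw [Int.cast_mul]
    exact I.mul_mem_right _ hlI

lemma ideal_prod_aux {R : Type*} [CommRing R] {T : Ideal R} {u v w : R} (huv : u * v ∈ T) (hw : w = -(u + v))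
    (hT : T ≤ T * (Ideal.span {w} ⊔ T)) : (Ideal.span {u} ⊔ T) * (Ideal.span {v} ⊔ T) = T := by
  apply le_antisymm
  · rw [Ideal.sup_mul, Ideal.mul_sup]
    refine sup_le (sup_le ?_ (Ideal.mul_le_inf.trans inf_le_right)) (Ideal.mul_le_inf.trans inf_le_left)
    rw [Ideal.span_singleton_mul_span_singleton, Ideal.span_singleton_le_iff_mem]
    exact huv
  · refine hT.trans ?_
    have hu : u ∈ Ideal.span {u} ⊔ T := Ideal.mem_sup_left (Ideal.mem_span_singleton_self _)
    have hv : v ∈ Ideal.span {v} ⊔ T := Ideal.mem_sup_left (Ideal.mem_span_singleton_self _)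
    rw [Ideal.mul_sup]
    refine sup_le ?_ (Ideal.mul_mono le_sup_right le_sup_right)
    rw [Ideal.mul_le]
    intro x hx y hy
    obtain ⟨a, rfl⟩ := Ideal.mem_span_singleton'.1 hy
    have e : x * (a * w) = u * (-(a * x)) + (-(a * x)) * v := by rw [hw]; ring
    rw [e]
    exact add_mem (Ideal.mul_mem_mul hu (neg_mem (Ideal.mul_mem_left _ _ (Ideal.mem_sup_right hx))))
      (Ideal.mul_mem_mul (neg_mem (Ideal.mul_mem_left _ _ (Ideal.mem_sup_right hx))) hv)

lemma IsQuad.lift_ideal {K L : Type*} [Field K] [NumberField K] [Field L] [NumberField L] [Algebra K L] {g : L ≃+* L} {β : L}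
    (H : IsQuad K L g β) (o : 𝓞 L) (ho : (o : L) = β) (δ z : 𝓞 K) (hδ : o ^ 2 = algebraMap (𝓞 K) (𝓞 L) δ)
    {I : Ideal (𝓞 K)} {l : ℕ} (hl : l.Prime) (hI : Ideal.absNorm I = l) (h1 : δ - z ^ 2 ∈ I) (h2 : 2 * z ∉ I) :
    ∃ J : Ideal (𝓞 L), Ideal.absNorm J = l ∧ o - algebraMap (𝓞 K) (𝓞 L) z ∈ J ∧ iExt K L I ≤ J := by
  set f := algebraMap (𝓞 K) (𝓞 L) with hf
  have hI0 : I ≠ ⊥ := by rintro rfl; rw [Ideal.absNorm_bot] at hI; exact hl.ne_zero hI.symm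
  have hmax : I.IsMaximal := by
    have := Ideal.isPrime_of_irreducible_absNorm (hI ▸ hl : (Ideal.absNorm I).Prime)
    exact this.isMaximal hI0
  have hsup : Ideal.span {2 * z} ⊔ I = ⊤ := by
    refine hmax.out.2 _ (lt_of_le_of_ne le_sup_right ?_)
    intro he
    exact h2 (he ▸ Ideal.mem_sup_left (Ideal.mem_span_singleton_self _))
  have hoβ : oAct g o = -o := H.oAct_beta o ho
  have hfz : ∀ x, oAct g (f x) = f x := fun x => by
    apply RingOfIntegers.ext
    exact H.fix x
  set J := Ideal.span {o - f z} ⊔ iExt K L I with hJ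
  have hgJ : iAct g J = Ideal.span {-o - f z} ⊔ iExt K L I := by
    have e1 : iAct g J = iAct g (Ideal.span {o - f z}) ⊔ iAct g (iExt K L I) := by
      rw [iAct_apply, iAct_apply, iAct_apply, hJ, Ideal.map_sup]
    rw [e1, H.iAct_iExt, iAct_span, map_sub, hoβ, hfz]
  have hprod : J * iAct g J = iExt K L I := by
    rw [hgJ, hJ]
    refine ideal_prod_aux (w := f (2 * z)) ?_ ?_ ?_
    · have : (o - f z) * (-o - f z) = f (-(δ - z ^ 2)) := by
        rw [map_neg, map_sub, map_pow, ← hδ]; ring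
      rw [this, iExt_apply]
      exact Ideal.mem_map_of_mem _ (I.neg_mem h1)
    · rw [map_mul, map_ofNat]; ring
    · have e1 : iExt K L (Ideal.span {2 * z} ⊔ I) = iExt K L (Ideal.span {2 * z}) ⊔ iExt K L I := by
        rw [iExt_apply, iExt_apply, iExt_apply, Ideal.map_sup]
      have e2 : Ideal.span {f (2 * z)} ⊔ iExt K L I = ⊤ := by
        rw [← iExt_span, ← e1, hsup, iExt_apply, Ideal.map_top]
      rw [e2, Ideal.mul_top]
  have hJ0 : J ≠ ⊥ := fun h0 => iExt_ne K L hI0 (le_bot_iff.1 (h0 ▸ le_sup_right))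
  refine ⟨J, ?_, Ideal.mem_sup_left (Ideal.mem_span_singleton_self _), le_sup_right⟩
  have e := H.iExt_iNm hJ0
  rw [hprod] at e
  have e2 := congrArg (iNm K L) e
  rw [iNm_iExt, iNm_iExt, H.finrank, sq, sq] at e2
  rw [← absNorm_iNm K L, ideal_sq_inj e2, hI]

lemma exists_l (A B : ℕ) (hA : A ≠ 0) (hB : B ≠ 0) (hAB : A.Coprime B) :
    ∃ l : ℕ, l.Prime ∧ l ≡ 1 [MOD A] ∧ B ∣ l + 1 := by
  obtain ⟨k, hk1, hk2⟩ := Nat.chineseRemainder hAB 1 (B - 1)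
  have e : B - 1 + 1 = B := by omega
  have hc : k.Coprime (A * B) := by
    apply Nat.Coprime.mul_right
    · rw [Nat.coprime_iff_gcd_eq_one, hk1.gcd_eq, Nat.gcd_one_left]
    · rw [Nat.coprime_iff_gcd_eq_one, hk2.gcd_eq, ← Nat.coprime_iff_gcd_eq_one]
      conv_rhs => rw [← e]
      simp
  obtain ⟨l, -, hl, hlk⟩ := Nat.forall_exists_prime_gt_and_modEq 0 (mul_ne_zero hA hB) hc
  refine ⟨l, hl, (hlk.of_mul_right B).trans hk1, ?_⟩
  have h1 := ((hlk.of_mul_left A).trans hk2).add_right 1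
  rw [e] at h1
  exact (Nat.modEq_zero_iff_dvd).1 (h1.trans (by simp [Nat.ModEq]))

lemma exists_zseq {l : ℕ} [Fact l.Prime] (n : ℕ) (h : l ≡ 1 [MOD 2 ^ (n + 3)]) :
    ∃ z : ℕ → ℤ, z 0 = 0 ∧ ∀ k < n, (l : ℤ) ∣ 2 + z k - z (k + 1) ^ 2 ∧ ¬ (l : ℤ) ∣ 2 * z (k + 1) := by
  have hl : l.Prime := Fact.out
  obtain ⟨g, hg⟩ := IsCyclic.exists_ofOrder_eq_natCard (α := (ZMod l)ˣ)
  rw [Nat.card_eq_fintype_card, ZMod.card_units] at hg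
  have hd : 2 ^ (n + 2) ∣ l - 1 := (pow_dvd_pow 2 (by omega)).trans ((Nat.modEq_iff_dvd' hl.one_le).1 h.symm)
  obtain ⟨t, ht⟩ := hd
  have ht0 : t ≠ 0 := by rintro rfl; have := hl.two_le; omega
  have hζ : orderOf (g ^ t) = 2 ^ (n + 2) := by
    rw [orderOf_pow_of_dvd ht0 (by rw [hg, ht]; exact dvd_mul_left _ _), hg, ht, Nat.mul_div_cancel _ (Nat.pos_of_ne_zero ht0)]
  set ζ := g ^ t with hζd
  have two : (2 : ZMod l) ≠ 0 := by
    intro h0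
    have : (l : ℕ) ∣ 2 := by
      rw [← ZMod.natCast_eq_zero_iff]; exact_mod_cast h0
    have h2 := (Nat.prime_dvd_prime_iff_eq hl Nat.prime_two).1 this
    have : l ≡ 1 [MOD 2] := h.of_dvd (dvd_pow_self 2 (by omega))
    rw [h2] at this; exact absurd this (by decide)
  let w : ℕ → (ZMod l)ˣ := fun k => ζ ^ 2 ^ (n - k)
  have hw : ∀ k < n, w (k + 1) ^ 2 = w k := by
    intro k hk
    simp only [w]
    rw [← pow_mul, ← pow_succ]; congr 2; omega
  have hwo : ∀ k ≤ n, orderOf (w k) = 2 ^ (k + 2) := by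
    intro k hk
    have e : 2 ^ (n + 2) = 2 ^ (k + 2) * 2 ^ (n - k) := by rw [← pow_add]; congr 1; omega
    simp only [w]
    rw [orderOf_pow_of_dvd (by positivity) (by rw [hζ, e]; exact dvd_mul_left _ _), hζ, e, Nat.mul_div_cancel _ (by positivity)]
  let u : ℕ → ZMod l := fun k => (w k : ZMod l) + ((w k)⁻¹ : (ZMod l)ˣ)
  have hmul : ∀ k, (w k : ZMod l) * ((w k)⁻¹ : (ZMod l)ˣ) = 1 := fun k => Units.mul_inv _
  have hz : ∀ k, u k = 0 → w k ^ 2 = -1 := by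
    intro k hk
    apply Units.ext
    push_cast
    have := hmul k
    have h2 : ((w k)⁻¹ : (ZMod l)ˣ) = -(w k : ZMod l) := by linear_combination hk
    rw [h2] at this; linear_combination -this
  have h0 : u 0 = 0 := by
    have o4 := hwo 0 (by omega)
    have e4 : (w 0 : ZMod l) ^ 4 = 1 := by
      have := pow_orderOf_eq_one (w 0)
      rw [o4] at this
      rw [← Units.val_pow_eq_pow_val, show w 0 ^ 4 = 1 from this]; rfl
    have e2 : (w 0 : ZMod l) ^ 2 ≠ 1 := by
      intro h2
      have : w 0 ^ 2 = 1 := Units.ext (by push_cast; exact h2)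
      have := orderOf_dvd_of_pow_eq_one this
      rw [o4] at this; exact absurd this (by decide)
    have e3 : (w 0 : ZMod l) ^ 2 = -1 := by
      have : ((w 0 : ZMod l) ^ 2 - 1) * ((w 0 : ZMod l) ^ 2 + 1) = 0 := by linear_combination e4
      rcases mul_eq_zero.1 this with h | h
      · exact absurd (sub_eq_zero.1 h) e2
      · linear_combination h
    have h3 : (w 0 : ZMod l) * u 0 = 0 := by
      simp only [u]; linear_combination e3 + hmul 0
    exact (mul_eq_zero.1 h3).resolve_left (Units.ne_zero _)
  have hu : ∀ k < n, 2 + u k - u (k + 1) ^ 2 = 0 := by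
    intro k hk
    have a1 : (w k : ZMod l) = (w (k + 1) : ZMod l) ^ 2 := by rw [← hw k hk]; push_cast; rfl
    have a2 : (((w k)⁻¹ : (ZMod l)ˣ) : ZMod l) = (((w (k + 1))⁻¹ : (ZMod l)ˣ) : ZMod l) ^ 2 := by
      rw [← hw k hk, ← inv_pow]; push_cast; rfl
    simp only [u]
    rw [a1, a2]
    linear_combination (-2) * hmul (k + 1)
  have hne : ∀ k < n, u (k + 1) ≠ 0 := by
    intro k hk h
    have h2 := hz _ h
    have h4 : w (k + 1) ^ 4 = 1 := by rw [show 4 = 2 * 2 from rfl, pow_mul, h2]; simp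
    have := orderOf_dvd_of_pow_eq_one h4
    rw [hwo _ (by omega)] at this
    have := Nat.le_of_dvd (by norm_num) this
    have h8 : 2 ^ 3 ≤ 2 ^ (k + 1 + 2) := Nat.pow_le_pow_right (by norm_num) (by omega)
    omega
  have hcast : ∀ k, (((u k).val : ℤ) : ZMod l) = u k := fun k => by simp
  refine ⟨fun k => ((u k).val : ℤ), by simp [h0], fun k hk => ⟨?_, ?_⟩⟩
  · rw [← ZMod.intCast_zmod_eq_zero_iff_dvd]
    push_cast
    simpa using hu k hk
  · rw [← ZMod.intCast_zmod_eq_zero_iff_dvd]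
    push_cast
    simpa using ⟨two, hne k hk⟩

lemma Qf_ideal {l : ℕ} [Fact l.Prime] (z : ℕ → ℤ) (n : ℕ) (hz0 : z 0 = 0)
    (hz : ∀ k < n, (l : ℤ) ∣ 2 + z k - z (k + 1) ^ 2 ∧ ¬ (l : ℤ) ∣ 2 * z (k + 1)) :
    ∀ k ≤ n, ∃ I : Ideal (𝓞 (Qf k)), Ideal.absNorm I = l ∧ occ (Qf k) k (cc_mem_Qf k) - (z k : 𝓞 (Qf k)) ∈ I := by
  have hl : l.Prime := Fact.out
  intro k
  induction k with
  | zero =>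
    intro _
    refine ⟨Ideal.span {((l : ℤ) : 𝓞 (Qf 0))}, absNorm_int0 l, ?_⟩
    have : occ (Qf 0) 0 (cc_mem_Qf 0) = 0 := toR_inj (by rw [toR_occ, cc_zero, map_zero])
    rw [this, hz0]; simp
  | succ k ih =>
    intro hk
    obtain ⟨I, hI, hI2⟩ := ih (by omega)
    obtain ⟨hz1, hz2⟩ := hz k (by omega)
    obtain ⟨g, H⟩ := quadQ k
    obtain ⟨J, hJ, hJ2, -⟩ := H.lift_ideal (occ (Qf (k + 1)) (k + 1) (cc_mem_Qf _)) rfl (2 + occ (Qf k) k (cc_mem_Qf k)) (z (k + 1) : 𝓞 (Qf k))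
      (by apply toR_inj; rw [map_pow, toR_occ, toR_alg, map_add, toR_two, toR_occ, cc_succ]) hl hI
      (by
        have h1 := (int_mem_iff hl hI _).2 hz1
        have := I.add_mem hI2 h1
        convert this using 1
        push_cast; ring)
      (by
        intro hmem
        apply hz2
        rw [← int_mem_iff hl hI]
        push_cast; exact hmem)
    refine ⟨J, hJ, ?_⟩
    rwa [map_intCast] at hJ2

lemma lift_sqrt {E F : IntermediateField ℚ ℝ} [NumberField E] [NumberField F] [Fact (E ≤ F)] {a : ℕ} {ha : √(a : ℝ) ∈ F} {g}
    (H : IsQuad E F g ⟨√(a : ℝ), ha⟩) {l : ℕ} [Fact l.Prime] (hl2 : l ≠ 2) (hal : legendreSym l a = 1)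
    (h : ∃ I : Ideal (𝓞 E), Ideal.absNorm I = l) : ∃ J : Ideal (𝓞 F), Ideal.absNorm J = l := by
  have hl : l.Prime := Fact.out
  obtain ⟨I, hI⟩ := h
  have ha0 : ((a : ℤ) : ZMod l) ≠ 0 := by
    intro h0
    rw [(legendreSym.eq_zero_iff l a).2 h0] at hal; omega
  obtain ⟨x, hx⟩ := (legendreSym.eq_one_iff l ha0).1 hal
  have hdvd : (l : ℤ) ∣ a - (x.val : ℤ) ^ 2 := by
    rw [← ZMod.intCast_zmod_eq_zero_iff_dvd]
    push_cast
    push_cast at hx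
    rw [hx]; simp; ring
  have hnd : ¬ (l : ℤ) ∣ 2 * x.val := by
    intro hd
    have hp := Nat.prime_iff_prime_int.1 hl
    rcases hp.dvd_or_dvd hd with h2 | h2
    · exact hl2 ((Nat.prime_dvd_prime_iff_eq hl Nat.prime_two).1 (by exact_mod_cast h2))
    · apply ha0
      rw [ZMod.intCast_zmod_eq_zero_iff_dvd]
      have := dvd_add hdvd (dvd_pow h2 two_ne_zero)
      simpa using this
  obtain ⟨J, hJ, -⟩ := H.lift_ideal (oR _ ha (isInt_sqrt a)) rfl (a : 𝓞 E) ((x.val : ℤ) : 𝓞 E)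
    (by apply toR_inj; rw [map_pow, toR_oR, sq_sqrt_nat]; simp) hl hI
    (by
      rw [← int_mem_iff hl hI] at hdvd
      push_cast at hdvd ⊢; exact hdvd)
    (by
      rw [← int_mem_iff hl hI] at hnd
      push_cast at hnd ⊢; exact hnd)
  exact ⟨J, hJ⟩

lemma tw_le_of_gen {G : Type*} [CommGroup G] [Finite G] (B : Subgroup G) (h : ∀ g, ∃ b ∈ B, IsSquare (g * b)) : tw G ≤ B := by
  have hs : Function.Surjective (fun x : G ⧸ B => x * x) := by
    intro x
    obtain ⟨g, rfl⟩ := QuotientGroup.mk_surjective x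
    obtain ⟨b, hb, y, hy⟩ := h g
    refine ⟨(y : G ⧸ B), ?_⟩
    have : (g : G ⧸ B) = ((g * b : G) : G ⧸ B) := by
      rw [QuotientGroup.mk_mul, (QuotientGroup.eq_one_iff b).2 hb, mul_one]
    rw [this, hy]; rfl
  have hi := Finite.injective_iff_surjective.2 hs
  have key : ∀ k : ℕ, ∀ x : G ⧸ B, x ^ 2 ^ k = 1 → x = 1 := by
    intro k
    induction k with
    | zero => intro x hx; simpa using hx
    | succ k ih =>
      intro x hx
      rw [pow_succ, pow_mul, sq] at hx
      apply ih
      exact hi (by simpa using hx)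
  rintro c ⟨k, hk⟩
  rw [← QuotientGroup.eq_one_iff]
  apply key k
  rw [← QuotientGroup.mk_pow, hk]; rfl

lemma tw_lift {G H : Type*} [CommGroup G] [Finite G] [CommGroup H] (f : G →* H) {c : H} (hc : c ∈ tw H) {b : G} (hb : f b = c) :
    ∃ b' ∈ tw G, f b' = c := by
  obtain ⟨j, hj⟩ := hc
  obtain ⟨k, m, hm, h⟩ := Nat.exists_eq_two_pow_mul_odd (n := Nat.card G) Nat.card_pos.ne'
  have hcop : Nat.Coprime m (2 ^ j) := ((Nat.coprime_two_left.2 hm).pow_left j).symm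
  obtain ⟨u, hu⟩ : ∃ u, m * u ≡ 1 [MOD 2 ^ j] := by
    rcases Nat.eq_zero_or_pos j with rfl | hj0
    · exact ⟨0, by simp [Nat.modEq_one]⟩
    · have h1 : 1 < 2 ^ j := Nat.one_lt_two_pow hj0.ne'
      obtain ⟨u, -, hu⟩ := Nat.exists_mul_mod_eq_one_of_coprime hcop h1
      exact ⟨u, by rw [Nat.ModEq, hu, Nat.mod_eq_of_lt h1]⟩
  refine ⟨b ^ (m * u), ⟨k, ?_⟩, ?_⟩
  · rw [← pow_mul, show m * u * 2 ^ k = (2 ^ k * m) * u by ring, pow_mul, ← h, pow_card_eq_one', one_pow]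
  · rw [map_pow, hb]
    have := pow_eq_pow_iff_modEq.2 (hu.of_dvd (orderOf_dvd_of_pow_eq_one hj))
    rw [this, pow_one]

lemma leg_l_one {p l : ℕ} [Fact p.Prime] [Fact l.Prime] (hp : p ≠ 2) (hl4 : l % 4 = 1) (h : l ≡ 1 [MOD p]) :
    legendreSym p l = 1 ∧ legendreSym l p = 1 := by
  have h1 : legendreSym p l = 1 := by
    rw [legendreSym.mod, show (l : ℤ) % p = 1 % p from (Int.natCast_modEq_iff (b := 1)).2 h, ← legendreSym.mod, legendreSym.at_one]
  exact ⟨h1, by rw [← legendreSym.quadratic_reciprocity_one_mod_four hl4 hp, h1]⟩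

lemma leg_l_neg {p l : ℕ} [Fact p.Prime] [Fact l.Prime] (hp : p % 4 = 3) (hl4 : l % 4 = 1) (h : p ∣ l + 1) :
    legendreSym p l = -1 ∧ legendreSym l p = -1 := by
  have h1 : legendreSym p l = -1 := by
    have : (l : ℤ) % p = (-1) % p := by
      rw [← Int.ModEq]
      apply Int.ModEq.symm
      rw [Int.modEq_iff_dvd]
      have : (p : ℤ) ∣ ((l + 1 : ℕ) : ℤ) := by exact_mod_cast h
      push_cast at this; simpa using this
    rw [legendreSym.mod, this, ← legendreSym.mod, leg_neg_one hp]
  exact ⟨h1, by rw [← legendreSym.quadratic_reciprocity_one_mod_four hl4 (by rintro rfl; omega), h1]⟩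

lemma leg_l_two {l : ℕ} [Fact l.Prime] (hl8 : l % 8 = 1) : legendreSym l 2 = 1 := by
  rw [legendreSym.at_two (by rintro rfl; omega)]
  have : (l : ZMod 8) = 1 := by
    have : ((l : ℕ) : ZMod 8) = ((1 : ℕ) : ZMod 8) := by
      rw [ZMod.natCast_eq_natCast_iff]; exact hl8
    exact_mod_cast this
  rw [this]; decide

lemma Qf_ideal' {l : ℕ} [Fact l.Prime] (n : ℕ) (h : l ≡ 1 [MOD 2 ^ (n + 3)]) : ∃ I : Ideal (𝓞 (Qf n)), Ideal.absNorm I = l := by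
  obtain ⟨z, h0, hz⟩ := exists_zseq n h
  obtain ⟨I, hI, -⟩ := Qf_ideal z n h0 hz n le_rfl
  exact ⟨I, hI⟩

namespace Hyp
variable {q r s : ℕ} (h : Hyp q r s)
include h

/-- a prime with signs (+,-,-), with ideals of that norm in the layers -/
lemma l1 (n : ℕ) : ∃ l : ℕ, l.Prime ∧ @legendreSym q ⟨h.hq⟩ l = 1 ∧ @legendreSym r ⟨h.hr⟩ l = -1 ∧ @legendreSym s ⟨h.hs⟩ l = -1 ∧
    (∃ I : Ideal (𝓞 (Ef (2 * q * (r * s)) n)), Ideal.absNorm I = l) ∧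
    (∃ I : Ideal (𝓞 (Kf (2 * q) (r * s) n)), Ideal.absNorm I = l) := by
  have fq := Fact.mk h.hq
  have fr := Fact.mk h.hr
  have fs := Fact.mk h.hs
  obtain ⟨l, hl, hA, hB⟩ := exists_l (2 ^ (n + 3) * q) (r * s) (mul_ne_zero (by positivity) h.hq.ne_zero)
    (mul_ne_zero h.hr.ne_zero h.hs.ne_zero) (by
      have c2 : Nat.Coprime 2 r := (Nat.coprime_primes Nat.prime_two h.hr).2 (Ne.symm h.r2)
      have c3 : Nat.Coprime 2 s := (Nat.coprime_primes Nat.prime_two h.hs).2 (Ne.symm h.s2)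
      have c4 := (Nat.coprime_primes h.hq h.hr).2 h.hqr
      have c5 := (Nat.coprime_primes h.hq h.hs).2 h.hqs
      exact Nat.Coprime.mul_left ((c2.mul_right c3).pow_left _) (c4.mul_right c5))
  have fl := Fact.mk hl
  have hA1 : l ≡ 1 [MOD 2 ^ (n + 3)] := hA.of_mul_right _
  have hA2 : l ≡ 1 [MOD q] := hA.of_mul_left _
  have h8 : l % 8 = 1 := hA1.of_dvd (show 8 ∣ 2 ^ (n + 3) from ⟨2 ^ n, by ring⟩)
  have h4 : l % 4 = 1 := by omega
  obtain ⟨q1, q1'⟩ := leg_l_one h.q2 h4 hA2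
  obtain ⟨r1, r1'⟩ := leg_l_neg h.r4 h4 ((dvd_mul_right _ _).trans hB)
  obtain ⟨s1, s1'⟩ := leg_l_neg h.s4 h4 ((dvd_mul_left _ _).trans hB)
  have t1 := leg_l_two h8
  have l2 : l ≠ 2 := by omega
  have I0 := Qf_ideal' n hA1
  refine ⟨l, hl, q1, r1, s1, ?_, ?_⟩
  · obtain ⟨g, H⟩ := quadQE h.NSD n
    refine lift_sqrt H l2 ?_ I0
    push_cast; rw [legendreSym.mul, legendreSym.mul, legendreSym.mul, t1, q1', r1', s1']; norm_num
  · obtain ⟨g, H⟩ := quadQE h.NSk n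
    obtain ⟨g', H'⟩ := quadK h.NSk h.NSM h.NSD n
    refine lift_sqrt H' l2 ?_ (lift_sqrt H l2 ?_ I0)
    · push_cast; rw [legendreSym.mul, r1', s1']; norm_num
    · push_cast; rw [legendreSym.mul, t1, q1']; norm_num

lemma l2 (n : ℕ) : ∃ l : ℕ, l.Prime ∧ @legendreSym q ⟨h.hq⟩ l = -1 ∧ @legendreSym r ⟨h.hr⟩ l = -1 ∧ @legendreSym s ⟨h.hs⟩ l = 1 ∧
    (∃ I : Ideal (𝓞 (Ef (2 * q * (r * s)) n)), Ideal.absNorm I = l) := by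
  have fq := Fact.mk h.hq
  have fr := Fact.mk h.hr
  have fs := Fact.mk h.hs
  obtain ⟨l, hl, hA, hB⟩ := exists_l (2 ^ (n + 3) * s) (q * r) (mul_ne_zero (by positivity) h.hs.ne_zero)
    (mul_ne_zero h.hq.ne_zero h.hr.ne_zero) (by
      have c2 : Nat.Coprime 2 r := (Nat.coprime_primes Nat.prime_two h.hr).2 (Ne.symm h.r2)
      have c3 : Nat.Coprime 2 q := (Nat.coprime_primes Nat.prime_two h.hq).2 (Ne.symm h.q2)
      have c4 := (Nat.coprime_primes h.hs h.hr).2 h.hrs.symm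
      have c5 := (Nat.coprime_primes h.hs h.hq).2 h.hqs.symm
      exact Nat.Coprime.mul_left ((c3.mul_right c2).pow_left _) (c5.mul_right c4))
  have fl := Fact.mk hl
  have hA1 : l ≡ 1 [MOD 2 ^ (n + 3)] := hA.of_mul_right _
  have hA2 : l ≡ 1 [MOD s] := hA.of_mul_left _
  have h8 : l % 8 = 1 := hA1.of_dvd (show 8 ∣ 2 ^ (n + 3) from ⟨2 ^ n, by ring⟩)
  have h4 : l % 4 = 1 := by omega
  obtain ⟨s1, s1'⟩ := leg_l_one h.s2 h4 hA2
  obtain ⟨q1, q1'⟩ := leg_l_neg h.q4 h4 ((dvd_mul_right _ _).trans hB)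
  obtain ⟨r1, r1'⟩ := leg_l_neg h.r4 h4 ((dvd_mul_left _ _).trans hB)
  have t1 := leg_l_two h8
  have l2 : l ≠ 2 := by omega
  have I0 := Qf_ideal' n hA1
  refine ⟨l, hl, q1, r1, s1, ?_⟩
  obtain ⟨g, H⟩ := quadQE h.NSD n
  refine lift_sqrt H l2 ?_ I0
  push_cast; rw [legendreSym.mul, legendreSym.mul, legendreSym.mul, t1, q1', r1', s1']; norm_num

/-- a class whose norm has distinct signs at q and r is not a square -/
lemma nonsq_qr {I : Ideal (𝓞 (Ef (2 * q * (r * s)) 0))} (hI : I ≠ ⊥)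
    (hq : @legendreSym q ⟨h.hq⟩ (Ideal.absNorm I) ≠ 0) (hr : @legendreSym r ⟨h.hr⟩ (Ideal.absNorm I) ≠ 0)
    (hne : @legendreSym q ⟨h.hq⟩ (Ideal.absNorm I) ≠ @legendreSym r ⟨h.hr⟩ (Ideal.absNorm I)) : ¬ IsSquare (cls I) := by
  intro hc
  have fq := Fact.mk h.hq
  have fr := Fact.mk h.hr
  obtain ⟨e, -, Gq, Gr, -⟩ := h.genus2 (k := 2) (Or.inr rfl) (by ring) h.NSD I hI hc
  apply hne
  rw [Gq, Gr]
  · intro hd; apply hr; rw [legendreSym.eq_zero_iff, ZMod.intCast_zmod_eq_zero_iff_dvd]; exact_mod_cast hd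
  · intro hd; apply hq; rw [legendreSym.eq_zero_iff, ZMod.intCast_zmod_eq_zero_iff_dvd]; exact_mod_cast hd

lemma nonsq_qs {I : Ideal (𝓞 (Ef (2 * q * (r * s)) 0))} (hI : I ≠ ⊥)
    (hq : @legendreSym q ⟨h.hq⟩ (Ideal.absNorm I) ≠ 0) (hs : @legendreSym s ⟨h.hs⟩ (Ideal.absNorm I) ≠ 0)
    (hne : @legendreSym q ⟨h.hq⟩ (Ideal.absNorm I) ≠ @legendreSym s ⟨h.hs⟩ (Ideal.absNorm I)) : ¬ IsSquare (cls I) := by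
  intro hc
  have fq := Fact.mk h.hq
  have fs := Fact.mk h.hs
  obtain ⟨e, -, Gq, -, Gs, -⟩ := h.genus2 (k := 2) (Or.inr rfl) (by ring) h.NSD I hI hc
  apply hne
  rw [Gq, Gs]
  · intro hd; apply hs; rw [legendreSym.eq_zero_iff, ZMod.intCast_zmod_eq_zero_iff_dvd]; exact_mod_cast hd
  · intro hd; apply hq; rw [legendreSym.eq_zero_iff, ZMod.intCast_zmod_eq_zero_iff_dvd]; exact_mod_cast hd

theorem surj (n : ℕ) {c : ClassGroup (𝓞 (Ef (2 * q * (r * s)) 0))} (hc : c ∈ tw _) :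
    ∃ b ∈ tw (ClassGroup (𝓞 (Ef (2 * q * (r * s)) n))), clNorm (Ef (2 * q * (r * s)) 0) (Ef (2 * q * (r * s)) n) b = c := by
  obtain ⟨l, hl, a1, a2, a3, ⟨I, hI⟩, -⟩ := h.l1 n
  obtain ⟨m, hm, b1, b2, b3, ⟨J, hJ⟩⟩ := h.l2 n
  have hI0 := h.ne_of_norm hl.ne_zero hI
  have hJ0 := h.ne_of_norm hm.ne_zero hJ
  have fq := Fact.mk h.hq
  have fr := Fact.mk h.hr
  have fs := Fact.mk h.hs
  have nI : Ideal.absNorm (iNm (Ef (2 * q * (r * s)) 0) (Ef (2 * q * (r * s)) n) I) = l := by rw [absNorm_iNm, hI]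
  have nJ : Ideal.absNorm (iNm (Ef (2 * q * (r * s)) 0) (Ef (2 * q * (r * s)) n) J) = m := by rw [absNorm_iNm, hJ]
  have zI := iNm_ne (Ef (2 * q * (r * s)) 0) (Ef (2 * q * (r * s)) n) hI0
  have zJ := iNm_ne (Ef (2 * q * (r * s)) 0) (Ef (2 * q * (r * s)) n) hJ0
  have x1 : ¬ IsSquare (cls (iNm (Ef (2 * q * (r * s)) 0) (Ef (2 * q * (r * s)) n) I)) := by
    apply h.nonsq_qr zI <;> rw [nI]
    · rw [a1]; norm_num
    · rw [a2]; norm_num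
    · rw [a1, a2]; norm_num
  have x2 : ¬ IsSquare (cls (iNm (Ef (2 * q * (r * s)) 0) (Ef (2 * q * (r * s)) n) J)) := by
    apply h.nonsq_qs zJ <;> rw [nJ]
    · rw [b1]; norm_num
    · rw [b3]; norm_num
    · rw [b1, b3]; norm_num
  have x3 : ¬ IsSquare (cls (iNm (Ef (2 * q * (r * s)) 0) (Ef (2 * q * (r * s)) n) I) * cls (iNm (Ef (2 * q * (r * s)) 0) (Ef (2 * q * (r * s)) n) J)) := by
    rw [← cls_mul zI zJ]
    have nIJ : ((Ideal.absNorm (iNm (Ef (2 * q * (r * s)) 0) (Ef (2 * q * (r * s)) n) I * iNm (Ef (2 * q * (r * s)) 0) (Ef (2 * q * (r * s)) n) J) : ℕ) : ℤ) = (l : ℤ) * m := by rw [map_mul, nI, nJ]; push_cast; rfl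
    apply h.nonsq_qr (mul_ne_zero zI zJ) <;> rw [nIJ]
    · rw [legendreSym.mul, a1, b1]; norm_num
    · rw [legendreSym.mul, a2, b2]; norm_num
    · rw [legendreSym.mul, legendreSym.mul, a1, b1, a2, b2]; norm_num
  have G := gen_of_nonsq h.tors0 _ _ x1 x2 x3
  have m1 : cls (iNm (Ef (2 * q * (r * s)) 0) (Ef (2 * q * (r * s)) n) I) ∈ (clNorm (Ef (2 * q * (r * s)) 0) (Ef (2 * q * (r * s)) n)).range := ⟨cls I, clNorm_cls (Ef (2 * q * (r * s)) 0) (Ef (2 * q * (r * s)) n) hI0⟩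
  have m2 : cls (iNm (Ef (2 * q * (r * s)) 0) (Ef (2 * q * (r * s)) n) J) ∈ (clNorm (Ef (2 * q * (r * s)) 0) (Ef (2 * q * (r * s)) n)).range := ⟨cls J, clNorm_cls (Ef (2 * q * (r * s)) 0) (Ef (2 * q * (r * s)) n) hJ0⟩
  have key := tw_le_of_gen (clNorm (Ef (2 * q * (r * s)) 0) (Ef (2 * q * (r * s)) n)).range (by
    intro g
    rcases G g with h1 | h1 | h1 | h1
    · exact ⟨1, one_mem _, by rwa [mul_one]⟩
    · exact ⟨_, m1, h1⟩
    · exact ⟨_, m2, h1⟩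
    · exact ⟨_, mul_mem m1 m2, h1⟩)
  obtain ⟨b, hb⟩ := key hc
  exact tw_lift (clNorm (Ef (2 * q * (r * s)) 0) (Ef (2 * q * (r * s)) n)) hc hb

end Hyp

/-- the map induced on 2-primary parts -/
def twMap {G H : Type*} [CommGroup G] [CommGroup H] (f : G →* H) : tw G →* tw H :=
  (f.comp (tw G).subtype).codRestrict (tw H) (fun x => map_tw f x.2)

lemma twMap_coe {G H : Type*} [CommGroup G] [CommGroup H] (f : G →* H) (x : tw G) : (twMap f x : H) = f x := rfl

lemma fukuda_group {A A' : Type*} [CommGroup A] [Finite A] [CommGroup A'] [Finite A'] (h2 : ∀ a : A, ∃ k : ℕ, a ^ 2 ^ k = 1)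
    (g : A →* A) (hg : ∀ a, g (g (g (g a))) = a) (N : A →* A') (hN : Function.Surjective N) (hNg : ∀ a, N (g a) = N a)
    (hc : Nat.card {a : A // g (g a) = a} ≤ Nat.card A') (a : A) : g a = a := by
  let δ : A →* A := (g.comp g) / MonoidHom.id A
  let B : Subgroup A := (g / MonoidHom.id A).range
  have hδ : ∀ a, δ a = g (g a) / a := fun a => rfl
  have hker : Nat.card δ.ker ≤ Nat.card A' := by
    refine le_trans (le_of_eq ?_) hc
    apply Nat.card_congr
    refine Equiv.subtypeEquivRight (fun x => ?_)
    rw [MonoidHom.mem_ker, hδ, div_eq_one]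
  have hle : δ.range ≤ N.ker := by
    rintro _ ⟨x, rfl⟩
    rw [MonoidHom.mem_ker, hδ, map_div, hNg, hNg, div_self']
  have hD : δ.range = N.ker := by
    apply Subgroup.eq_of_le_of_card_ge hle
    have c1 : Nat.card δ.ker * Nat.card δ.range = Nat.card A := by
      rw [← Subgroup.index_ker]; exact Subgroup.card_mul_index _
    have c2 : Nat.card N.ker * Nat.card A' = Nat.card A := by
      have : Nat.card N.range = Nat.card A' := by
        rw [MonoidHom.range_eq_top.2 hN]; exact Subgroup.card_top
      rw [← this, ← Subgroup.index_ker]; exact Subgroup.card_mul_index _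
    have p : 0 < Nat.card A' := Nat.card_pos
    apply Nat.le_of_mul_le_mul_right _ p
    calc _ = Nat.card δ.ker * Nat.card δ.range := by rw [c1, c2]
      _ ≤ Nat.card A' * Nat.card δ.range := Nat.mul_le_mul_right _ hker
      _ = _ := mul_comm _ _
  have hBg : ∀ x ∈ B, g x ∈ B := by
    rintro _ ⟨x, rfl⟩
    refine ⟨g x, ?_⟩
    simp
  have c1 : ∀ x ∈ B, ∃ y ∈ B, x = g y * y := by
    rintro _ ⟨x, rfl⟩
    have : (g / MonoidHom.id A) x ∈ N.ker := by
      rw [MonoidHom.mem_ker]; simp [hNg]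
    rw [← hD] at this
    obtain ⟨b, hb⟩ := this
    refine ⟨g b / b, ⟨b, rfl⟩, ?_⟩
    rw [← hb, hδ, map_div, div_mul_div_cancel]
  have c2 : ∀ x ∈ B, ∃ y ∈ B, x = y ^ 2 := by
    intro x hx
    obtain ⟨y1, h1, rfl⟩ := c1 x hx
    obtain ⟨y2, h2, rfl⟩ := c1 y1 h1
    obtain ⟨y3, h3, rfl⟩ := c1 y2 h2
    obtain ⟨y, h4, rfl⟩ := c1 y3 h3
    have e1 := hBg _ h4
    have e2 := hBg _ e1
    have e3 := hBg _ e2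
    refine ⟨y * g (g (g y)) ^ 2 * g (g y) ^ 3 * g y ^ 2,
      mul_mem (mul_mem (mul_mem h4 (pow_mem e3 2)) (pow_mem e2 3)) (pow_mem e1 2), ?_⟩
    simp only [map_mul, hg]
    generalize g (g (g y)) = u
    generalize g (g y) = v
    generalize g y = w
    simp only [mul_pow, ← pow_mul]
    simp only [pow_succ, pow_zero, one_mul]
    simp only [mul_comm, mul_left_comm]
  have c3 : ∀ k : ℕ, ∀ x ∈ B, ∃ y ∈ B, x = y ^ 2 ^ k := by
    intro k
    induction k with
    | zero => intro x hx; exact ⟨x, hx, by simp⟩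
    | succ k ih =>
      intro x hx
      obtain ⟨y, hy, rfl⟩ := ih x hx
      obtain ⟨z, hz, rfl⟩ := c2 y hy
      exact ⟨z, hz, by rw [← pow_mul, pow_succ']⟩
  have hcard : ∃ K : ℕ, ∀ a : A, a ^ 2 ^ K = 1 := by
    choose k hk using h2
    have := Fintype.ofFinite A
    refine ⟨Finset.univ.sup k, fun a => ?_⟩
    have : k a ≤ Finset.univ.sup k := Finset.le_sup (Finset.mem_univ a)
    obtain ⟨t, ht⟩ := Nat.exists_eq_add_of_le this
    rw [ht, pow_add, pow_mul, hk, one_pow]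
  obtain ⟨K, hK⟩ := hcard
  obtain ⟨y, -, hy⟩ := c3 K (g a / a) ⟨a, rfl⟩
  rw [hK] at hy
  exact div_eq_one.1 hy

lemma ss_mem_Ef (a k : ℕ) : ss k ∈ Ef a (k + 1) := ss_mem _ _

lemma ss_ne (k : ℕ) : ss k ≠ 0 := by
  induction k with
  | zero => exact cc_ne 0
  | succ k ih => exact div_ne_zero ih (cc_ne _)

lemma gamma_ss {a k : ℕ} {γ} (H : IsQuad (Ef a k) (Ef a (k + 1)) γ ⟨cc (k + 1), cc_mem_Ef _ _⟩) :
    γ ⟨ss k, ss_mem_Ef a k⟩ = -⟨ss k, ss_mem_Ef a k⟩ := by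
  cases k with
  | zero => exact H.neg
  | succ k =>
    have a5 := H.fix ⟨ss k, ss_mem_Ef a k⟩
    have a6 : algebraMap (Ef a (k + 1)) (Ef a (k + 2)) ⟨ss k, ss_mem_Ef a k⟩ =
      (⟨ss (k + 1), ss_mem_Ef a (k + 1)⟩ : Ef a (k + 2)) * ⟨cc (k + 2), cc_mem_Ef _ _⟩ := Subtype.ext (ss_succ k).symm
    rw [a6, map_mul, H.neg, mul_neg, ← neg_mul] at a5
    have a7 := mul_right_cancel₀ H.ne a5
    exact neg_eq_iff_eq_neg.1 a7

lemma four_aut {a k : ℕ} (h : NS a) {γ} (H : IsQuad (Ef a k) (Ef a (k + 1)) γ ⟨cc (k + 1), cc_mem_Ef _ _⟩)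
    {γ'} (H' : IsQuad (Ef a (k + 1)) (Ef a (k + 2)) γ' ⟨cc (k + 2), cc_mem_Ef _ _⟩) :
    ∃ g : Ef a (k + 2) ≃+* Ef a (k + 2),
      (∀ x, g (algebraMap (Ef a (k + 1)) (Ef a (k + 2)) x) = algebraMap (Ef a (k + 1)) (Ef a (k + 2)) (γ x)) ∧ g.trans g = γ' := by
  have hs1 : ss (k + 1) ∈ Ef a (k + 2) := ss_mem_Ef a (k + 1)
  have e0 : (((⟨ss (k + 1), hs1⟩ : Ef a (k + 2)) : ℝ)) ^ 2 = γ ⟨cc (k + 2) ^ 2, cc_sq_mem _ (k + 1)⟩ := by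
    have : (⟨cc (k + 2) ^ 2, cc_sq_mem _ (k + 1)⟩ : Ef a (k + 1)) = 2 + ⟨cc (k + 1), cc_mem_Ef _ _⟩ :=
      Subtype.ext (cc_succ (k + 1))
    have e1 : γ ⟨cc (k + 2) ^ 2, cc_sq_mem _ (k + 1)⟩ = 2 + -⟨cc (k + 1), cc_mem_Ef _ _⟩ := by
      refine (congrArg γ this).trans ?_
      rw [map_add, H.neg, map_ofNat]
    refine Eq.trans ?_ (congrArg Subtype.val e1).symm
    refine (ss_sq (k + 1)).trans ?_
    exact sub_eq_add_neg _ _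
  obtain ⟨g, h1, h2⟩ := sub_ext (E := Ef a (k + 1)) (F := Ef a (k + 2)) (cc_sq_mem _ (k + 1)) (cc_mem_Ef a (k + 2))
    (Ef_succ_le a (k + 1)) (cc_notMem_Ef h (k + 1)) γ ⟨ss (k + 1), hs1⟩ e0
  refine ⟨g, h1, ?_⟩
  apply Ef_aut_ext
  · have a0 : γ ⟨√(a : ℝ), sqrt_mem_Ef a (k + 1)⟩ = ⟨√(a : ℝ), sqrt_mem_Ef a (k + 1)⟩ :=
      H.fix ⟨√(a : ℝ), sqrt_mem_Ef a k⟩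
    have a1 : g ⟨√(a : ℝ), sqrt_mem_Ef a (k + 2)⟩ = ⟨√(a : ℝ), sqrt_mem_Ef a (k + 2)⟩ :=
      (h1 ⟨√(a : ℝ), sqrt_mem_Ef a (k + 1)⟩).trans (congrArg (algebraMap (Ef a (k + 1)) (Ef a (k + 2))) a0)
    have a2 : γ' ⟨√(a : ℝ), sqrt_mem_Ef a (k + 2)⟩ = ⟨√(a : ℝ), sqrt_mem_Ef a (k + 2)⟩ :=
      H'.fix ⟨√(a : ℝ), sqrt_mem_Ef a (k + 1)⟩
    rw [a2]
    exact (congrArg g a1).trans a1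
  · have a0 := (h1 ⟨ss k, ss_mem_Ef a k⟩).trans (congrArg (algebraMap (Ef a (k + 1)) (Ef a (k + 2))) (gamma_ss H))
    have a6 : algebraMap (Ef a (k + 1)) (Ef a (k + 2)) ⟨ss k, ss_mem_Ef a k⟩ =
      (⟨ss (k + 1), hs1⟩ : Ef a (k + 2)) * ⟨cc (k + 2), cc_mem_Ef _ _⟩ := Subtype.ext (ss_succ k).symm
    rw [map_neg, a6, map_mul, h2, mul_comm, ← mul_neg] at a0
    have hne : (⟨ss (k + 1), hs1⟩ : Ef a (k + 2)) ≠ 0 := fun h0 => ss_ne (k + 1) (congrArg Subtype.val h0)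
    have a7 := mul_left_cancel₀ hne a0
    have a8 : γ' ⟨cc (k + 2), cc_mem_Ef a (k + 2)⟩ = -⟨cc (k + 2), cc_mem_Ef a (k + 2)⟩ := H'.neg
    rw [a8]
    exact (congrArg g h2).trans a7

/-- trivial action means the full 2-part is fixed -/
lemma card_fix_of_triv {L : Type*} [Field L] [NumberField L] {g : L ≃+* L}
    (h : ∀ c ∈ tw (ClassGroup (𝓞 L)), clAct g c = c) : fixCl g ⊓ tw (ClassGroup (𝓞 L)) = tw (ClassGroup (𝓞 L)) :=
  inf_eq_right.2 (fun c hc => h c hc)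

/-- the inductive step -/
lemma fukuda_step {a k : ℕ} (h : NS a) (hu : UniqAbove (Ef a (k + 1)) 2)
    (hsurj : ∀ c ∈ tw (ClassGroup (𝓞 (Ef a 0))), ∃ b ∈ tw (ClassGroup (𝓞 (Ef a (k + 2)))),
      clNorm (Ef a 0) (Ef a (k + 2)) b = c)
    (hsurj' : ∀ c ∈ tw (ClassGroup (𝓞 (Ef a 0))), ∃ b ∈ tw (ClassGroup (𝓞 (Ef a (k + 1)))),
      clNorm (Ef a 0) (Ef a (k + 1)) b = c)
    (hcard : Nat.card (tw (ClassGroup (𝓞 (Ef a (k + 1))))) ≤ Nat.card (tw (ClassGroup (𝓞 (Ef a 0)))))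
    {γ} (H : IsQuad (Ef a k) (Ef a (k + 1)) γ ⟨cc (k + 1), cc_mem_Ef _ _⟩)
    (ht : ∀ c ∈ tw (ClassGroup (𝓞 (Ef a (k + 1)))), clAct γ c = c)
    {γ'} (H' : IsQuad (Ef a (k + 1)) (Ef a (k + 2)) γ' ⟨cc (k + 2), cc_mem_Ef _ _⟩)
    (c : ClassGroup (𝓞 (Ef a (k + 2)))) (hc : c ∈ tw (ClassGroup (𝓞 (Ef a (k + 2))))) : clAct γ' c = c := by
  obtain ⟨g, h1, h2⟩ := four_aut h H H'
  have hgg : ∀ c, clAct g (clAct g c) = clAct γ' c := fun c => by rw [clAct_clAct, h2]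
  have hinj : Function.Bijective (twMap (clNorm (Ef a 0) (Ef a (k + 1)))) := by
    apply Function.Surjective.bijective_of_nat_card_le _ hcard
    rintro ⟨c, hc⟩
    obtain ⟨b, hb, e⟩ := hsurj' c hc
    exact ⟨⟨b, hb⟩, Subtype.ext e⟩
  have key := fukuda_group (A := tw (ClassGroup (𝓞 (Ef a (k + 2))))) (A' := tw (ClassGroup (𝓞 (Ef a (k + 1)))))
    (by rintro ⟨x, n, hx⟩; exact ⟨n, Subtype.ext hx⟩) (twMap (clAct g))
    (by
      intro x
      apply Subtype.ext
      change clAct g (clAct g (clAct g (clAct g (x : ClassGroup (𝓞 (Ef a (k + 2))))))) = x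
      rw [hgg, hgg, clAct_clAct]
      have : γ'.trans γ' = RingEquiv.refl _ := RingEquiv.ext (fun x => H'.invol x)
      rw [this, clAct_refl])
    (twMap (clNorm (Ef a (k + 1)) (Ef a (k + 2))))
    (by
      intro x
      obtain ⟨b, hb, e⟩ := hsurj _ (twMap (clNorm (Ef a 0) (Ef a (k + 1))) x).2
      refine ⟨⟨b, hb⟩, hinj.1 (Subtype.ext ?_)⟩
      refine Eq.trans ?_ e
      exact clNorm_tower (F := Ef a 0) (K := Ef a (k + 1)) (L := Ef a (k + 2)) b)
    (by
      intro x
      apply Subtype.ext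
      refine (clNorm_clAct g γ h1 (x : ClassGroup (𝓞 (Ef a (k + 2))))).trans ?_
      exact ht _ (twMap (clNorm (Ef a (k + 1)) (Ef a (k + 2))) x).2)
    (by
      refine le_trans (le_of_eq ?_) (step_cc H' hu)
      refine Nat.card_congr ⟨fun x => ⟨x.1.1, ?_, x.1.2⟩, fun x => ⟨⟨x.1, x.2.2⟩, ?_⟩, fun _ => rfl, fun _ => rfl⟩
      · have := congrArg Subtype.val x.2
        exact (hgg _).symm.trans this
      · exact Subtype.ext ((hgg _).trans x.2.1))
  have k1 := fun c hc => congrArg Subtype.val (key ⟨c, hc⟩)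
  rw [← hgg]
  exact (congrArg (clAct g) (k1 c hc)).trans (k1 c hc)

namespace Hyp
variable {q r s : ℕ} (h : Hyp q r s)
include h

lemma D8 : (q * (r * s)) % 8 = 7 := by
  rw [Nat.mul_mod, h.hq8, h.rs4]

lemma uniqD (n : ℕ) : UniqAbove (Ef (2 * q * (r * s)) n) 2 := by
  have hN := h.NSD
  rw [mul_assoc] at hN ⊢
  exact Ef_uniq_two _ n h.D8 hN

lemma fukuda_all (hp : (∃ x y : ℕ, s * x ^ 2 = 2 * q * r * y ^ 2 + 1) ∨ (∃ x y : ℕ, 2 * r * x ^ 2 = q * s * y ^ 2 + 1))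
    (n : ℕ) : Nat.card (tw (ClassGroup (𝓞 (Ef (2 * q * (r * s)) (n + 1))))) ≤ Nat.card (tw (ClassGroup (𝓞 (Ef (2 * q * (r * s)) 0)))) ∧
      ∃ γ, IsQuad (Ef (2 * q * (r * s)) n) (Ef (2 * q * (r * s)) (n + 1)) γ ⟨cc (n + 1), cc_mem_Ef _ _⟩ ∧
        ∀ c ∈ tw (ClassGroup (𝓞 (Ef (2 * q * (r * s)) (n + 1)))), clAct γ c = c := by
  induction n with
  | zero =>
    obtain ⟨γ, H⟩ := quadE h.NSD 0
    have h1 : ∀ c ∈ tw (ClassGroup (𝓞 (Ef (2 * q * (r * s)) (0 + 1)))), clAct γ c = c :=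
      fun c hc => h.first hp (mul_assoc _ _ _) H hc
    refine ⟨?_, γ, H, h1⟩
    have := step_cc H (h.uniqD 0)
    rwa [card_fix_of_triv h1] at this
  | succ k ih =>
    obtain ⟨hc, γ, H, ht⟩ := ih
    obtain ⟨γ', H'⟩ := quadE h.NSD (k + 1)
    have h1 := fukuda_step h.NSD (h.uniqD (k + 1)) (fun c hc => h.surj (k + 2) hc) (fun c hc => h.surj (k + 1) hc) hc H ht H'
    refine ⟨?_, γ', H', h1⟩
    have := step_cc H' (h.uniqD (k + 1))
    rw [card_fix_of_triv h1] at this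
    exact this.trans hc

lemma card_An (hp : (∃ x y : ℕ, s * x ^ 2 = 2 * q * r * y ^ 2 + 1) ∨ (∃ x y : ℕ, 2 * r * x ^ 2 = q * s * y ^ 2 + 1))
    (n : ℕ) : Nat.card (tw (ClassGroup (𝓞 (Ef (2 * q * (r * s)) n)))) ≤ Nat.card (tw (ClassGroup (𝓞 (Ef (2 * q * (r * s)) 0)))) := by
  cases n with
  | zero => exact le_rfl
  | succ k => exact (h.fukuda_all hp k).1
end Hyp

lemma cyclic_of_two_tors {S : Type*} [CommGroup S] [Finite S] (h2 : ∀ a : S, ∃ k : ℕ, a ^ 2 ^ k = 1)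
    (h : Nat.card (powMonoidHom 2 : S →* S).ker ≤ 2) : IsCyclic S := by
  have hk : ∀ k : ℕ, Nat.card (powMonoidHom (2 ^ k) : S →* S).ker ≤ 2 ^ k := by
    intro k
    induction k with
    | zero =>
      have : (powMonoidHom (2 ^ 0) : S →* S).ker = ⊥ := by
        ext x; simp [MonoidHom.mem_ker]
      rw [this]; simp
    | succ k ih =>
      let T := (powMonoidHom (2 ^ (k + 1)) : S →* S).ker
      let f : T →* (powMonoidHom (2 ^ k) : S →* S).ker :=
        ((powMonoidHom 2 : S →* S).comp T.subtype).codRestrict _ (fun x => by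
          have := x.2
          rw [MonoidHom.mem_ker] at this ⊢
          simp only [powMonoidHom_apply, MonoidHom.comp_apply, Subgroup.coe_subtype] at this ⊢
          rw [← pow_mul, ← pow_succ']; exact this)
      have c1 : Nat.card f.ker * Nat.card f.range = Nat.card T := by
        rw [← Subgroup.index_ker]; exact Subgroup.card_mul_index _
      have c2 : Nat.card f.range ≤ 2 ^ k := (Nat.card_le_card_of_injective _ Subtype.val_injective).trans ih
      have c3 : Nat.card f.ker ≤ 2 := by
        refine le_trans (Nat.card_le_card_of_injective
          (fun x : f.ker => (⟨x.1.1, ?_⟩ : (powMonoidHom 2 : S →* S).ker)) ?_) h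
        · have := congrArg Subtype.val x.2
          exact this
        · intro x y hxy
          have hxy' : (x.1.1 : S) = y.1.1 := congrArg (fun t : (powMonoidHom 2 : S →* S).ker => (t : S)) hxy
          exact Subtype.ext (Subtype.ext hxy')
      change Nat.card T ≤ _
      rw [← c1, pow_succ']
      exact Nat.mul_le_mul c3 c2
  have := Fintype.ofFinite S
  classical
  apply isCyclic_of_card_pow_eq_one_le
  intro n hn
  obtain ⟨k, m, hm, e⟩ := Nat.exists_eq_two_pow_mul_odd (n := n) hn.ne'
  have h1 : ∀ x : S, x ^ n = 1 → x ^ 2 ^ k = 1 := by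
    intro x hx
    obtain ⟨j, hj⟩ := h2 x
    have a1 := orderOf_dvd_of_pow_eq_one hx
    have a2 := orderOf_dvd_of_pow_eq_one hj
    apply orderOf_dvd_iff_pow_eq_one.1
    rw [e] at a1
    refine Nat.Coprime.dvd_of_dvd_mul_right ?_ a1
    exact Nat.Coprime.coprime_dvd_left a2 ((Nat.coprime_two_left.2 hm).pow_left j)
  calc _ = Nat.card {x : S // x ^ n = 1} := by
        rw [Nat.card_eq_fintype_card, Fintype.card_subtype]
    _ ≤ Nat.card (powMonoidHom (2 ^ k) : S →* S).ker := by
        refine Nat.card_le_card_of_injective (fun x => ⟨x.1, ?_⟩) ?_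
        · rw [MonoidHom.mem_ker]; exact h1 _ x.2
        · intro x y hxy
          have hxy' : (x.1 : S) = y.1 := congrArg (fun t : (powMonoidHom (2 ^ k) : S →* S).ker => (t : S)) hxy
          exact Subtype.ext hxy'
    _ ≤ 2 ^ k := hk k
    _ ≤ n := by
        rw [e]; exact Nat.le_mul_of_pos_right _ hm.pos

lemma final_group {A C : Type*} [CommGroup A] [Finite A] [CommGroup C] [Finite C] (h2 : ∀ a : A, ∃ k : ℕ, a ^ 2 ^ k = 1)
    {m : ℕ} (hA : Nat.card A = 2 ^ m) (h4 : Nat.card (powMonoidHom 2 : A →* A).ker ≤ 4) {p : A} (hp2 : p ^ 2 = 1)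
    (hp : ¬ IsSquare p) (N : C →* A) (hC : 2 * Nat.card C ≤ Nat.card A) (hsq : ∀ a : A, a ^ 2 ∈ N.range) (hpN : p ∈ N.range) :
    Nonempty (C ≃* Multiplicative (ZMod 2) × Multiplicative (ZMod (2 ^ (m - 2)))) := by
  let S := (powMonoidHom 2 : A →* A).range
  let Z := Subgroup.zpowers p
  have hpS : p ∉ S := by
    rintro ⟨x, hx⟩
    exact hp ⟨x, by rw [← sq]; exact hx.symm⟩
  have hp1 : p ≠ 1 := fun h => hp (h ▸ IsSquare.one)
  have ho : orderOf p = 2 := orderOf_eq_prime hp2 hp1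
  have cZ : Nat.card Z = 2 := by rw [Nat.card_zpowers, ho]
  have c1 : Nat.card (powMonoidHom 2 : A →* A).ker * Nat.card S = Nat.card A := by
    rw [← Subgroup.index_ker]; exact Subgroup.card_mul_index _
  have hZ : ∀ z ∈ Z, z = 1 ∨ z = p := by
    intro z hz
    obtain ⟨k, rfl⟩ := Subgroup.mem_zpowers_iff.1 hz
    have hz2 : p ^ (2 : ℤ) = 1 := by exact_mod_cast hp2
    rcases Int.even_or_odd' k with ⟨j, rfl | rfl⟩
    · left; rw [zpow_mul, hz2, one_zpow]
    · right; rw [zpow_add, zpow_mul, hz2, one_zpow, one_mul, zpow_one]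
  let f : Z × S →* A := Z.subtype.coprod S.subtype
  have hf : Function.Injective f := by
    rw [injective_iff_map_eq_one]
    rintro ⟨z, y⟩ hzy
    have e : (z : A) * y = 1 := hzy
    have hz : (z : A) = 1 := by
      rcases hZ z z.2 with h | h
      · exact h
      · exfalso; apply hpS
        rw [← h, eq_inv_of_mul_eq_one_left e]
        exact inv_mem y.2
    rw [hz, one_mul] at e
    exact Prod.ext (Subtype.ext hz) (Subtype.ext e)
  have hr : f.range ≤ N.range := by
    rintro _ ⟨⟨z, y⟩, rfl⟩
    refine mul_mem (?_ : (z : A) ∈ _) (?_ : (y : A) ∈ _)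
    · rcases hZ z z.2 with h | h <;> rw [h]
      · exact one_mem _
      · exact hpN
    · obtain ⟨x, hx⟩ := y.2
      rw [← hx]; exact hsq x
  have c2 : Nat.card f.range = 2 * Nat.card S := by
    rw [← Nat.card_congr (MonoidHom.ofInjective hf).toEquiv, Nat.card_prod, cZ]
  have c3 : Nat.card f.range ≤ Nat.card N.range := Nat.card_le_card_of_injective _ (Subgroup.inclusion_injective hr)
  have c4 : Nat.card N.range ≤ Nat.card C := Nat.card_le_card_of_surjective _ N.rangeRestrict_surjective
  have pS : 0 < Nat.card S := Nat.card_pos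
  have cS : 4 * Nat.card S = Nat.card A := by nlinarith
  have cC : Nat.card C = 2 * Nat.card S := by omega
  have hNinj : Function.Injective N := by
    have := (Function.Surjective.bijective_of_nat_card_le N.rangeRestrict_surjective (by omega)).1
    intro x y hxy
    exact this (Subtype.ext hxy)
  have hrr : f.range = N.range := Subgroup.eq_of_le_of_card_ge hr (by omega)
  have k4 : Nat.card (powMonoidHom 2 : A →* A).ker = 4 := by
    rw [← cS] at c1; exact Nat.eq_of_mul_eq_mul_right pS c1
  have hScyc : IsCyclic S := by
    apply cyclic_of_two_tors
    · rintro ⟨x, hx⟩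
      obtain ⟨k, hk⟩ := h2 x
      exact ⟨k, Subtype.ext hk⟩
    · -- S[2] × Z injects into A[2]
      have : Nat.card (Z × (powMonoidHom 2 : S →* S).ker) ≤ Nat.card (powMonoidHom 2 : A →* A).ker := by
        refine Nat.card_le_card_of_injective (fun x => ⟨f (x.1, x.2.1), ?_⟩) ?_
        · rw [MonoidHom.mem_ker]
          have e1 : (x.1 : A) ^ 2 = 1 := by
            rcases hZ _ x.1.2 with h | h <;> rw [h]
            · exact one_pow _
            · exact hp2
          have e2 : ((x.2.1 : S) : A) ^ 2 = 1 := congrArg Subtype.val x.2.2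
          change ((x.1 : A) * (x.2.1 : S)) ^ 2 = 1
          rw [mul_pow, e1, e2, one_mul]
        · intro x y hxy
          have := hf (congrArg Subtype.val hxy)
          have t1 : x.1 = y.1 := congrArg (fun t : Z × S => t.1) this
          have t2 : (x.2 : S) = y.2 := congrArg (fun t : Z × S => t.2) this
          exact Prod.ext t1 (Subtype.ext t2)
      rw [Nat.card_prod, cZ] at this
      omega
  have hm : Nat.card S = 2 ^ (m - 2) := by
    have hm2 : 2 ≤ m := by
      by_contra! hlt
      have : 2 ^ m < 2 ^ 2 := Nat.pow_lt_pow_right (by norm_num) hlt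
      omega
    obtain ⟨j, rfl⟩ := Nat.exists_eq_add_of_le hm2
    rw [hA, pow_add] at cS
    rw [Nat.add_sub_cancel_left]; omega
  have : NeZero (2 ^ (m - 2)) := ⟨by positivity⟩
  have e1 : Z ≃* Multiplicative (ZMod 2) := mulEquivOfCyclicCardEq (by rw [cZ]; simp)
  have e2 : S ≃* Multiplicative (ZMod (2 ^ (m - 2))) := mulEquivOfCyclicCardEq (by rw [hm]; simp)
  exact ⟨(MonoidHom.ofInjective hNinj).trans ((MulEquiv.subgroupCongr hrr.symm).trans ((MonoidHom.ofInjective hf).symm.trans (e1.prodCongr e2)))⟩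

lemma nat_coprime_not_mem {R : Type*} [CommRing R] (P : Ideal R) [hP : P.IsPrime] {a b : ℕ} (h : Nat.Coprime a b)
    (ha : (a : R) ∈ P) (hb : (b : R) ∈ P) : False := by
  have h1 := Nat.isCoprime_iff_coprime.2 h
  obtain ⟨u, v, e⟩ := h1
  apply hP.ne_top
  rw [Ideal.eq_top_iff_one]
  have e' : (u : R) * a + v * b = 1 := by exact_mod_cast congrArg (Int.cast : ℤ → R) e
  rw [← e']
  exact add_mem (P.mul_mem_left _ ha) (P.mul_mem_left _ hb)

lemma neg_inert {F : IntermediateField ℚ ℝ} [NumberField F] {g : F ≃+* F} {a : ℕ} {hm : √(a : ℝ) ∈ F}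
    (hg : g ⟨_, hm⟩ = -⟨_, hm⟩) (P : Ideal (𝓞 F)) (hI : Inertial g P) : ((4 * a : ℕ) : 𝓞 F) ∈ P := by
  have h1 := hI (oR _ hm (isInt_sqrt _))
  have h6 := P.mul_mem_left (2 * oR _ hm (isInt_sqrt _)) h1
  have h2 : oR _ hm (isInt_sqrt _) - oAct g (oR _ hm (isInt_sqrt _)) = 2 * oR _ hm (isInt_sqrt _) := by
    apply toR_inj
    rw [map_sub, toR_oAct, toR_oR, oR_coe, map_mul, toR_two, toR_oR]
    have h5 : ((g ⟨_, hm⟩ : F) : ℝ) = -√(a : ℝ) := by rw [hg]; rfl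
    rw [h5]; ring
  rw [h2] at h6
  convert h6 using 1
  apply toR_inj
  rw [map_mul, map_mul, toR_oR, toR_two, map_natCast]
  push_cast
  linear_combination -4 * (sq_sqrt_nat a)

lemma Km_neg {a b n : ℕ} {g} (H : IsQuad (Ef (a * b) n) (Kf a b n) g ⟨√(b : ℝ), sqrt_mem_Kf' _ _ _⟩) :
    g ⟨√(a : ℝ), sqrt_mem_Kf a b n⟩ = -⟨√(a : ℝ), sqrt_mem_Kf a b n⟩ := by
  have a5 := H.fix ⟨√((a * b : ℕ) : ℝ), sqrt_mem_Ef _ n⟩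
  have a6 : algebraMap (Ef (a * b) n) (Kf a b n) ⟨√((a * b : ℕ) : ℝ), sqrt_mem_Ef _ n⟩ =
    (⟨√(a : ℝ), sqrt_mem_Kf a b n⟩ : Kf a b n) * ⟨√(b : ℝ), sqrt_mem_Kf' a b n⟩ := Subtype.ext (by
      change √((a * b : ℕ) : ℝ) = √(a : ℝ) * √(b : ℝ)
      rw [Nat.cast_mul, Real.sqrt_mul (Nat.cast_nonneg a)])
  rw [a6, map_mul, H.neg, mul_neg, ← neg_mul] at a5
  have a7 := mul_right_cancel₀ H.ne a5
  exact neg_eq_iff_eq_neg.1 a7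

lemma Km_comp {a b n : ℕ} {g} (H : IsQuad (Ef (a * b) n) (Kf a b n) g ⟨√(b : ℝ), sqrt_mem_Kf' _ _ _⟩)
    {g1} (H1 : IsQuad (Ef a n) (Kf a b n) g1 ⟨√(b : ℝ), sqrt_mem_Kf' _ _ _⟩)
    {g2} (H2 : IsQuad (Ef b n) (Kf a b n) g2 ⟨√(a : ℝ), sqrt_mem_Kf _ _ _⟩) : g = g1.trans g2 := by
  apply Kf_aut_ext
  · have b1 : g1 ⟨√(a : ℝ), sqrt_mem_Kf a b n⟩ = ⟨√(a : ℝ), sqrt_mem_Kf a b n⟩ := H1.fix ⟨√(a : ℝ), sqrt_mem_Ef a n⟩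
    refine (Km_neg H).trans ?_
    exact (H2.neg.symm).trans (congrArg g2 b1.symm)
  · have b2 : g2 ⟨√(b : ℝ), sqrt_mem_Kf' a b n⟩ = ⟨√(b : ℝ), sqrt_mem_Kf' a b n⟩ := H2.fix ⟨√(b : ℝ), sqrt_mem_Ef b n⟩
    have b1 : g1 ⟨√(b : ℝ), sqrt_mem_Kf' a b n⟩ = -⟨√(b : ℝ), sqrt_mem_Kf' a b n⟩ := H1.neg
    refine H.neg.trans ?_
    refine Eq.trans ?_ (congrArg g2 b1.symm)
    rw [map_neg, b2]
  · have b0 : g ⟨cc n, cc_mem_Kf a b n⟩ = ⟨cc n, cc_mem_Kf a b n⟩ := H.fix ⟨cc n, cc_mem_Ef _ n⟩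
    have b1 : g1 ⟨cc n, cc_mem_Kf a b n⟩ = ⟨cc n, cc_mem_Kf a b n⟩ := H1.fix ⟨cc n, cc_mem_Ef _ n⟩
    have b2 : g2 ⟨cc n, cc_mem_Kf a b n⟩ = ⟨cc n, cc_mem_Kf a b n⟩ := H2.fix ⟨cc n, cc_mem_Ef _ n⟩
    exact b0.trans (b2.symm.trans (congrArg g2 b1.symm))

namespace Hyp
variable {q r s : ℕ} (h : Hyp q r s)
include h

lemma card_Cn (hp : (∃ x y : ℕ, s * x ^ 2 = 2 * q * r * y ^ 2 + 1) ∨ (∃ x y : ℕ, 2 * r * x ^ 2 = q * s * y ^ 2 + 1))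
    (n : ℕ) : 2 * Nat.card (tw (ClassGroup (𝓞 (Kf (2 * q) (r * s) n)))) ≤ Nat.card (tw (ClassGroup (𝓞 (Ef (2 * q * (r * s)) 0)))) := by
  obtain ⟨g, H⟩ := quadKm h.NSk h.NSM h.NSD n
  obtain ⟨g1, H1⟩ := quadK h.NSk h.NSM h.NSD n
  obtain ⟨g2, H2⟩ := quadK' h.NSk h.NSM h.NSD n
  have e := Km_comp H H1 H2
  have ht : ∀ c ∈ tw (ClassGroup (𝓞 (Kf (2 * q) (r * s) n))), clAct g c = c := by
    intro c hc
    rw [e, ← clAct_clAct, H1.neg_of_triv (h.k_tw n) hc, map_inv, H2.neg_of_triv (h.M_tw n) hc, inv_inv]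
  have := H.chev2a (algebraMap _ ℝ) ∅ (by simp) (by
    intro P hP _ hI
    exfalso
    have i1 := neg_inert (Km_neg H) P hI
    have e8 : 4 * (2 * q) = 2 ^ 3 * q := by ring
    rw [e8] at i1
    rcases h.half_inert H.neg P hI with i2 | i2
    · refine nat_coprime_not_mem P ?_ i1 i2
      exact Nat.Coprime.mul_left (((Nat.coprime_primes Nat.prime_two h.hr).2 h.r2.symm).pow_left 3) ((Nat.coprime_primes h.hq h.hr).2 h.hqr)
    · refine nat_coprime_not_mem P ?_ i1 i2
      exact Nat.Coprime.mul_left (((Nat.coprime_primes Nat.prime_two h.hs).2 h.s2.symm).pow_left 3) ((Nat.coprime_primes h.hq h.hs).2 h.hqs))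
  rw [card_fix_of_triv ht, Finset.card_empty, pow_zero, mul_one] at this
  exact this.trans (h.card_An hp n)

/-- the norm map from the top -/
noncomputable def fN (_ : Hyp q r s) (n : ℕ) : ClassGroup (𝓞 (Kf (2 * q) (r * s) n)) →* ClassGroup (𝓞 (Ef (2 * q * (r * s)) 0)) :=
  (clNorm (Ef (2 * q * (r * s)) 0) (Ef (2 * q * (r * s)) n)).comp (clNorm (Ef (2 * q * (r * s)) n) (Kf (2 * q) (r * s) n))

lemma fN_sq (n : ℕ) {c : ClassGroup (𝓞 (Ef (2 * q * (r * s)) 0))} (hc : c ∈ tw _) : ∃ b ∈ tw _, h.fN n b = c ^ 2 := by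
  obtain ⟨g, H⟩ := quadKm h.NSk h.NSM h.NSD n
  obtain ⟨b, hb, e⟩ := h.surj n hc
  refine ⟨clExt (Ef (2 * q * (r * s)) n) (Kf (2 * q) (r * s) n) b, map_tw _ hb, ?_⟩
  change clNorm (Ef (2 * q * (r * s)) 0) (Ef (2 * q * (r * s)) n) (clNorm (Ef (2 * q * (r * s)) n) (Kf (2 * q) (r * s) n) _) = _
  rw [clNorm_clExt, H.finrank, map_pow, e]

lemma exists_p (n : ℕ) : ∃ p ∈ tw (ClassGroup (𝓞 (Ef (2 * q * (r * s)) 0))), p ^ 2 = 1 ∧ ¬ IsSquare p ∧ ∃ b ∈ tw _, h.fN n b = p := by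
  have fq := Fact.mk h.hq
  have fr := Fact.mk h.hr
  have fs := Fact.mk h.hs
  have hD := h.D8
  obtain ⟨⟨I2, n2, sq2⟩, -⟩ := Ef_two_zero (2 * q * (r * s)) (by rw [mul_assoc]; omega) h.NSD
  obtain ⟨l, hl, a1, a2, a3, -, ⟨J, hJ⟩⟩ := h.l1 n
  obtain ⟨m, hm, b1, b2, b3, ⟨Y, hY⟩⟩ := h.l2 0
  have z2 := h.ne_of_norm two_ne_zero n2
  have hJ0 : J ≠ ⊥ := by
    rintro rfl
    rw [Ideal.absNorm_bot] at hJ; exact hl.ne_zero hJ.symm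
  have hY0 := h.ne_of_norm hm.ne_zero hY
  have m0 := iNm_ne (Ef (2 * q * (r * s)) n) (Kf (2 * q) (r * s) n) hJ0
  have m1 := iNm_ne (Ef (2 * q * (r * s)) 0) (Ef (2 * q * (r * s)) n) m0
  have nI := (absNorm_iNm (Ef (2 * q * (r * s)) 0) (Ef (2 * q * (r * s)) n) _).trans
    ((absNorm_iNm (Ef (2 * q * (r * s)) n) (Kf (2 * q) (r * s) n) J).trans hJ)
  have hfJ : h.fN n (cls J) = cls (iNm (Ef (2 * q * (r * s)) 0) (Ef (2 * q * (r * s)) n) (iNm (Ef (2 * q * (r * s)) n) (Kf (2 * q) (r * s) n) J)) := by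
    rw [← clNorm_cls _ _ m0, ← clNorm_cls _ _ hJ0]; rfl
  generalize iNm (Ef (2 * q * (r * s)) 0) (Ef (2 * q * (r * s)) n) (iNm (Ef (2 * q * (r * s)) n) (Kf (2 * q) (r * s) n) J) = I at m1 nI hfJ
  have p2 : cls I2 ^ 2 = 1 := by
    rw [sq, ← cls_mul z2 z2, sq2]; exact cls_span two_ne_zero
  have n2' : ((Ideal.absNorm I2 : ℕ) : ℤ) = 2 := by rw [n2]; rfl
  have nY' : ((Ideal.absNorm Y : ℕ) : ℤ) = m := by rw [hY]
  have nI' : ((Ideal.absNorm I : ℕ) : ℤ) = l := by rw [nI]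
  have x1 : ¬ IsSquare (cls I2) := by
    apply h.nonsq_qr z2 <;> rw [n2']
    · rw [h.leg_q_2]; norm_num
    · rw [h.leg_r_2]; norm_num
    · rw [h.leg_q_2, h.leg_r_2]; norm_num
  have x2 : ¬ IsSquare (cls Y) := by
    apply h.nonsq_qs hY0 <;> rw [nY']
    · rw [b1]; norm_num
    · rw [b3]; norm_num
    · rw [b1, b3]; norm_num
  have x3 : ¬ IsSquare (cls I2 * cls Y) := by
    rw [← cls_mul z2 hY0]
    apply h.nonsq_qr (mul_ne_zero z2 hY0) <;> rw [map_mul, Nat.cast_mul, n2', nY']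
    · rw [legendreSym.mul, h.leg_q_2, b1]; norm_num
    · rw [legendreSym.mul, h.leg_r_2, b2]; norm_num
    · rw [legendreSym.mul, legendreSym.mul, h.leg_q_2, h.leg_r_2, b1, b2]; norm_num
  have hg : IsSquare (cls I * cls I2) := by
    rcases gen_of_nonsq h.tors0 _ _ x1 x2 x3 (cls I) with i | i | i | i
    · exfalso; revert i
      apply h.nonsq_qr m1 <;> rw [nI']
      · rw [a1]; norm_num
      · rw [a2]; norm_num
      · rw [a1, a2]; norm_num
    · exact i
    · exfalso; revert i
      rw [← cls_mul m1 hY0]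
      apply h.nonsq_qr (mul_ne_zero m1 hY0) <;> rw [map_mul, Nat.cast_mul, nI', nY']
      · rw [legendreSym.mul, a1, b1]; norm_num
      · rw [legendreSym.mul, a2, b2]; norm_num
      · rw [legendreSym.mul, legendreSym.mul, a1, a2, b1, b2]; norm_num
    · exfalso; revert i
      rw [← cls_mul z2 hY0, ← cls_mul m1 (mul_ne_zero z2 hY0)]
      apply h.nonsq_qs (mul_ne_zero m1 (mul_ne_zero z2 hY0)) <;> rw [map_mul, map_mul, Nat.cast_mul, Nat.cast_mul, nI', nY', n2']
      · rw [legendreSym.mul, legendreSym.mul, h.leg_q_2, a1, b1]; norm_num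
      · rw [legendreSym.mul, legendreSym.mul, h.leg_s_2, a3, b3]; norm_num
      · rw [legendreSym.mul, legendreSym.mul, legendreSym.mul, legendreSym.mul, h.leg_q_2, h.leg_s_2, a1, a3, b1, b3]; norm_num
  have pt : cls I2 ∈ tw (ClassGroup (𝓞 (Ef (2 * q * (r * s)) 0))) := ⟨1, by rw [pow_one]; exact p2⟩
  refine ⟨cls I2, pt, p2, x1, ?_⟩
  obtain ⟨z, hz⟩ := hg
  obtain ⟨k, M, hM, hcard⟩ := Nat.exists_eq_two_pow_mul_odd (n := Nat.card (ClassGroup (𝓞 (Ef (2 * q * (r * s)) 0)))) Nat.card_pos.ne'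
  have hzM : z ^ M ∈ tw (ClassGroup (𝓞 (Ef (2 * q * (r * s)) 0))) :=
    ⟨k, by rw [← pow_mul, mul_comm M, ← hcard, pow_card_eq_one']⟩
  obtain ⟨b, hb, hbe⟩ := h.fN_sq n hzM
  have hpM : cls I2 ^ M = cls I2 := by
    obtain ⟨j, rfl⟩ := hM
    rw [pow_succ, pow_mul, p2, one_pow, one_mul]
  refine tw_lift (h.fN n) pt (b := b * (cls J ^ M)⁻¹) ?_
  rw [map_mul, map_inv, map_pow, hfJ, hbe, ← pow_mul, mul_comm M, pow_mul, sq, ← hz, mul_pow, hpM,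
    mul_inv_cancel_comm]

theorem main (hp : (∃ x y : ℕ, s * x ^ 2 = 2 * q * r * y ^ 2 + 1) ∨ (∃ x y : ℕ, 2 * r * x ^ 2 = q * s * y ^ 2 + 1))
    (n : ℕ) {m : ℕ} (hm : Nat.card (tw (ClassGroup (𝓞 (Ef (2 * q * (r * s)) 0)))) = 2 ^ m) :
    Nonempty (tw (ClassGroup (𝓞 (Kf (2 * q) (r * s) n))) ≃* Multiplicative (ZMod 2) × Multiplicative (ZMod (2 ^ (m - 2)))) := by
  obtain ⟨p, hpt, p2, pn, b, hb, e⟩ := h.exists_p n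
  refine final_group (A := tw (ClassGroup (𝓞 (Ef (2 * q * (r * s)) 0)))) (p := ⟨p, hpt⟩)
    (by rintro ⟨x, k, hx⟩; exact ⟨k, Subtype.ext hx⟩) hm ?_ (Subtype.ext p2) ?_ (twMap (h.fN n)) (h.card_Cn hp n) ?_ ⟨⟨b, hb⟩, Subtype.ext e⟩
  · have h0 : ∀ x : (powMonoidHom 2 : tw (ClassGroup (𝓞 (Ef (2 * q * (r * s)) 0))) →* tw (ClassGroup (𝓞 (Ef (2 * q * (r * s)) 0)))).ker,
        (x.1.1 : ClassGroup (𝓞 (Ef (2 * q * (r * s)) 0))) ^ 2 = 1 := fun x => congrArg Subtype.val x.2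
    refine le_trans (Nat.card_le_card_of_injective (fun x => (⟨x.1.1, h0 x⟩ : {x : ClassGroup (𝓞 (Ef (2 * q * (r * s)) 0)) // x ^ 2 = 1})) ?_) h.tors0
    intro x y hxy
    have hxy' : (x.1.1 : ClassGroup (𝓞 (Ef (2 * q * (r * s)) 0))) = y.1.1 :=
      congrArg (fun t : {x : ClassGroup (𝓞 (Ef (2 * q * (r * s)) 0)) // x ^ 2 = 1} => t.1) hxy
    exact Subtype.ext (Subtype.ext hxy')
  · rintro ⟨y, hy⟩
    exact pn ⟨y.1, congrArg Subtype.val hy⟩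
  · rintro ⟨c, hc⟩
    obtain ⟨b, hb, e⟩ := h.fN_sq n hc
    exact ⟨⟨b, hb⟩, Subtype.ext e⟩

end Hyp

lemma sylow_eq_tw {G : Type*} [CommGroup G] (P : Sylow 2 G) : (P : Subgroup G) = tw G := by
  symm
  apply P.is_maximal'
  · rintro ⟨x, k, hx⟩
    exact ⟨k, Subtype.ext hx⟩
  · intro x hx
    obtain ⟨k, hk⟩ := P.isPGroup' ⟨x, hx⟩
    exact ⟨k, congrArg Subtype.val hk⟩

lemma card_tw {G : Type*} [CommGroup G] [Finite G] : Nat.card (tw G) = 2 ^ (Nat.card G).factorization 2 := by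
  have := Fact.mk Nat.prime_two
  obtain ⟨P⟩ : Nonempty (Sylow 2 G) := inferInstance
  rw [← sylow_eq_tw P]
  exact P.card_eq_multiplicity

lemma transfer_card {X Y : IntermediateField ℚ ℝ} (h : X = Y) :
    Nat.card (ClassGroup (𝓞 X)) = Nat.card (ClassGroup (𝓞 Y)) := by subst h; rfl

lemma transfer_sylow {X Y : IntermediateField ℚ ℝ} (h : X = Y) {B : Type*} [Group B]
    (H : Nonempty (tw (ClassGroup (𝓞 Y)) ≃* B)) (P : Sylow 2 (ClassGroup (𝓞 X))) :
    Nonempty ((P : Subgroup (ClassGroup (𝓞 X))) ≃* B) := by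
  subst h
  obtain ⟨e⟩ := H
  exact ⟨(MulEquiv.subgroupCongr (sylow_eq_tw P)).trans e⟩

lemma Qadj_eq_Ef (q r s : ℕ) : Qadj {Real.sqrt (2 * (q * r * s))} = Ef (2 * q * (r * s)) 0 := by
  have e : (2 * ((q : ℝ) * r * s)) = ((2 * q * (r * s) : ℕ) : ℝ) := by push_cast; ring
  rw [e]
  apply le_antisymm
  · refine IntermediateField.adjoin_le_iff.2 ?_
    rintro x rfl
    exact sqrt_mem_Ef _ _
  · refine layer_le ?_ ?_
    · rintro x rfl
      exact IntermediateField.subset_adjoin _ _ rfl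
    · rw [cc_zero]; exact zero_mem _

lemma layer_eq_Kf (q r s n : ℕ) : layer {Real.sqrt (2 * q), Real.sqrt (r * s)} n = Kf (2 * q) (r * s) n := by
  rw [Kf]; push_cast; rfl

/-- Let q ≡ 7 (mod 8) and r ≡ s ≡ 3 (mod 8) be distinct primes with
(q/r) = (q/s) = -1 and (s/r) = 1. Write ε_{2qrs} = a + b√(2qrs) (fundamental, i.e. least
positive Pell solution) and assume 2q(a-1) is not a perfect square. Let 2^m = h₂(2qrs).
Then for every n ≥ 0, the 2-class group (the 2-Sylow subgroup of the class group) of the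
n-th layer K_n of the cyclotomic Z₂-extension of K = Q(√(2q), √(rs)) is isomorphic to
Z/2Z × Z/2^{m-2}Z; in particular the 2-class numbers of the layers are bounded, so the
Iwasawa invariants λ and μ of K vanish and Greenberg's conjecture holds for K. -/
theorem stmt16 (q r s : ℕ) (hq : q.Prime) (hr : r.Prime) (hs : s.Prime)
    (hqr : q ≠ r) (hqs : q ≠ s) (hrs : r ≠ s)
    (hq8 : q % 8 = 7) (hr8 : r % 8 = 3) (hs8 : s % 8 = 3)
    (h1 : @legendreSym r ⟨hr⟩ (q : ℤ) = -1) (h2 : @legendreSym s ⟨hs⟩ (q : ℤ) = -1)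
    (h3 : @legendreSym r ⟨hr⟩ (s : ℤ) = 1)
    (a b : ℤ) (ha : 0 < a) (hb : 0 < b)
    (hPell : a ^ 2 - 1 = 2 * q * r * s * b ^ 2)
    (hfund : ∀ a' b' : ℤ, 0 < a' → 0 < b' → a' ^ 2 - 1 = 2 * q * r * s * b' ^ 2 → a ≤ a')
    (hnsq : ¬ IsSquare (2 * q * (a - 1)))
    (m : ℕ)
    (hm : 2 ^ m = 2 ^ ((Nat.card (ClassGroup
      (𝓞 (Qadj {Real.sqrt (2 * (q * r * s))})))).factorization 2)) :
    (∀ n : ℕ, ∀ P : Sylow 2 (ClassGroup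
        (𝓞 (layer {Real.sqrt (2 * q), Real.sqrt (r * s)} n))),
      Nonempty ((P : Subgroup (ClassGroup
          (𝓞 (layer {Real.sqrt (2 * q), Real.sqrt (r * s)} n)))) ≃*
        Multiplicative (ZMod 2) × Multiplicative (ZMod (2 ^ (m - 2))))) ∧
    ∃ C : ℕ, ∀ n : ℕ, 2 ^ ((Nat.card (ClassGroup
      (𝓞 (layer {Real.sqrt (2 * q), Real.sqrt (r * s)} n)))).factorization 2) ≤ C := by
  have h : Hyp q r s := ⟨hq, hr, hs, hqr, hqs, hrs, hq8, hr8, hs8, h1, h2, h3⟩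
  obtain ⟨A, rfl⟩ := Int.eq_ofNat_of_zero_le ha.le
  obtain ⟨B, rfl⟩ := Int.eq_ofNat_of_zero_le hb.le
  have hp := h.pell (a := A) (b := B) (by exact_mod_cast hb)
    (by zify; linear_combination hPell)
    (by
      intro a' b' pa pb e
      have := hfund a' b' (by exact_mod_cast pa) (by exact_mod_cast pb) (by
        zify at e; linear_combination e)
      exact_mod_cast this)
    (by
      rintro m y e rfl
      apply hnsq
      refine ⟨2 * q * y, ?_⟩
      rw [e]; push_cast; ring)
  have hcard : Nat.card (tw (ClassGroup (𝓞 (Ef (2 * q * (r * s)) 0)))) = 2 ^ m := by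
    rw [card_tw, hm, transfer_card (Qadj_eq_Ef q r s)]
  refine ⟨fun n P => transfer_sylow (layer_eq_Kf q r s n) (h.main hp n hcard) P,
    Nat.card (tw (ClassGroup (𝓞 (Ef (2 * q * (r * s)) 0)))), fun n => ?_⟩
  rw [transfer_card (layer_eq_Kf q r s n), ← card_tw]
  have := h.card_Cn hp n
  omega
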